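/- Let (C_n) and (C'_n) be sequences where C_n and C'_n are conjugacy classes of the symmetric group S_n, with cycle counts c_j(n) and c'_j(n) respectively. Assume that c_1(n) = o(n^{2/3}), c'_1(n) = o(n^{2/3}), and (c_1(n) + c_2(n)^{1/2})(c'_1(n) + c'_2(n)^{1/2}) = o(n) as n → ∞. Then P_n → 1 as n → ∞, where P_n is the probability that two independent uniformly random elements π ∈ C_n and π' ∈ C'_n generate a subgroup of S_n containing the alternating group A_n. -/

import Mathlib

open Filter Asymptotics

/-- The number of `j`-cycles in the cycle decomposition of `π` (fixed points are `1`-cycles). -/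
noncomputable def cycleCount {n : ℕ} (π : Equiv.Perm (Fin n)) (j : ℕ) : ℕ :=
  if j = 1 then Nat.card (Function.fixedPoints ⇑π) else Multiset.count j π.cycleType

/-- The probability that, for `π₁` uniform in the conjugacy class of `π` and `π₂` uniform and
independent in the conjugacy class of `π'`, the subgroup `⟨π₁, π₂⟩` contains `A_n`. -/
noncomputable def genProb (n : ℕ) (π π' : Equiv.Perm (Fin n)) : ℝ :=
  (Nat.card {p : Equiv.Perm (Fin n) × Equiv.Perm (Fin n) //
      IsConj π p.1 ∧ IsConj π' p.2 ∧
      alternatingGroup (Fin n) ≤ Subgroup.closure {p.1, p.2}} : ℝ) /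
  ((Nat.card {σ : Equiv.Perm (Fin n) // IsConj π σ} : ℝ) *
   (Nat.card {σ : Equiv.Perm (Fin n) // IsConj π' σ} : ℝ))

/-- Two elements of `G` agreeing off a small set produce a commutator of small support. -/
lemma Equiv.Perm.card_support_commutator_le {α : Type*} [Fintype α] [DecidableEq α]
    (g k : Equiv.Perm α) :
    (g * k * g⁻¹ * k⁻¹).support.card ≤ 3 * (g.support ∩ k.support).card := by
  set D := g.support ∩ k.support with hD
  have hsub : (g * k * g⁻¹ * k⁻¹).support ⊆ D ∪ (D.image g ∪ D.image k) := by
    intro x hx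
    by_contra hx'
    simp only [Finset.mem_union, Finset.mem_image, not_or, not_exists, not_and] at hx'
    obtain ⟨h1, h2, h3⟩ := hx'
    rw [Equiv.Perm.mem_support] at hx
    apply hx
    have hmem : ∀ y, y ∈ D ↔ g y ≠ y ∧ k y ≠ y := by
      intro y; rw [hD, Finset.mem_inter, Equiv.Perm.mem_support, Equiv.Perm.mem_support]
    have a2 : g (g⁻¹ x) = x := by simp
    have a3 : k (k⁻¹ x) = x := by simp
    change g (k (g⁻¹ (k⁻¹ x))) = x
    by_cases hk : k x = x
    · have hk' : k⁻¹ x = x := by rw [Equiv.Perm.inv_eq_iff_eq]; exact hk.symm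
      rw [hk']
      by_cases hg : g x = x
      · have hg' : g⁻¹ x = x := by rw [Equiv.Perm.inv_eq_iff_eq]; exact hg.symm
        rw [hg', hk, hg]
      · have h4 : g⁻¹ x ∉ D := fun h => h2 _ h a2
        rw [hmem, not_and_or, not_not, not_not] at h4
        rcases h4 with h4 | h4
        · exact absurd (by rw [a2] at h4; rw [← h4] at a2; exact a2) hg
        · rw [h4, a2]
    · have hg : g x = x := by
        by_contra hg; exact h1 ((hmem x).2 ⟨hg, hk⟩)
      have h4 : k⁻¹ x ∉ D := fun h => h3 _ h a3
      rw [hmem, not_and_or, not_not, not_not] at h4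
      rcases h4 with h4 | h4
      · have : g⁻¹ (k⁻¹ x) = k⁻¹ x := by rw [Equiv.Perm.inv_eq_iff_eq]; exact h4.symm
        rw [this, a3, hg]
      · exact absurd (by rw [a3] at h4; rw [← h4] at a3; exact a3) hk
  calc _ ≤ _ := Finset.card_le_card hsub
    _ ≤ D.card + (D.card + D.card) :=
      (Finset.card_union_le _ _).trans (Nat.add_le_add_left ((Finset.card_union_le _ _).trans
        (Nat.add_le_add Finset.card_image_le Finset.card_image_le)) _)
    _ = _ := by ring

open Classical in
/-- In a `2`-transitive group the number of elements with prescribed values at two points does not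
depend on the points. -/
lemma exists_card_two_point_transporter {α : Type*} [Fintype α] [DecidableEq α]
     (G : Subgroup (Equiv.Perm α))
    (h2 : ∀ a b c d : α, a ≠ b → c ≠ d → ∃ g ∈ G, g a = c ∧ g b = d) :
    ∃ N : ℕ, (∀ a b : α, a ≠ b → 0 < N) ∧ ∀ a b c d : α, a ≠ b → c ≠ d →
      (Finset.univ.filter fun h : G => (h : Equiv.Perm α) a = c ∧ (h : Equiv.Perm α) b = d).card
        = N := by
  by_cases hex : ∃ a b : α, a ≠ b
  · obtain ⟨a₀, b₀, h₀⟩ := hex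
    refine ⟨(Finset.univ.filter fun h : G =>
      (h : Equiv.Perm α) a₀ = a₀ ∧ (h : Equiv.Perm α) b₀ = b₀).card, fun _ _ _ => ?_, ?_⟩
    · exact Finset.card_pos.2 ⟨1, by simp⟩
    · intro a b c d hab hcd
      obtain ⟨k, hk, hka, hkb⟩ := h2 a₀ b₀ a b h₀ hab
      obtain ⟨l, hl, hlc, hld⟩ := h2 c d a₀ b₀ hcd h₀
      refine Finset.card_equiv ((Equiv.mulLeft (⟨l, hl⟩ : G)).trans
        (Equiv.mulRight (⟨k, hk⟩ : G))) ?_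
      intro h
      simp only [Finset.mem_filter, Finset.mem_univ, true_and, Equiv.trans_apply,
        Equiv.coe_mulLeft, Equiv.coe_mulRight, Subgroup.coe_mul, Equiv.Perm.mul_apply, hka, hkb]
      conv_rhs => rw [← hlc, ← hld, l.injective.eq_iff, l.injective.eq_iff]
  · push Not at hex
    exact ⟨0, fun a b h => absurd (hex a b) h, fun a b _ _ h => absurd (hex a b) h⟩

open Classical in
lemma card_two_point_image_mem {α : Type*} [Fintype α] [DecidableEq α]
     {G : Subgroup (Equiv.Perm α)} {N : ℕ}
    (hN : ∀ a b c d : α, a ≠ b → c ≠ d →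
      (Finset.univ.filter fun h : G => (h : Equiv.Perm α) a = c ∧ (h : Equiv.Perm α) b = d).card
        = N) {a b : α} (hab : a ≠ b) (S : Finset (α × α)) (hS : ∀ p ∈ S, p.1 ≠ p.2) :
    (Finset.univ.filter fun h : G => ((h : Equiv.Perm α) a, (h : Equiv.Perm α) b) ∈ S).card
      = S.card * N := by
  rw [Finset.card_eq_sum_card_fiberwise (t := S)
    (f := fun h : G => ((h : Equiv.Perm α) a, (h : Equiv.Perm α) b))]
  · rw [← smul_eq_mul, ← Finset.sum_const]
    refine Finset.sum_congr rfl fun p hp => ?_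
    rw [← hN a b p.1 p.2 hab (hS p hp), Finset.filter_filter]
    congr 1
    ext h
    simp only [Finset.mem_filter, Finset.mem_univ, true_and]
    constructor
    · rintro ⟨-, h⟩; rw [← h]; exact ⟨rfl, rfl⟩
    · rintro ⟨h1, h2⟩; rw [h1, h2]; exact ⟨hp, rfl⟩
  · intro h hh; simpa using hh

lemma MulAction.isPreprimitive_of_two_transitive {α : Type*} (G : Subgroup (Equiv.Perm α))
    (h2 : ∀ a b c d : α, a ≠ b → c ≠ d → ∃ g ∈ G, g a = c ∧ g b = d) :
    MulAction.IsPreprimitive G α := by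
  apply MulAction.isPreprimitive_of_is_two_pretransitive
  rw [MulAction.is_two_pretransitive_iff]
  intro a b c d hab hcd
  obtain ⟨g, hg, h⟩ := h2 a b c d hab hcd
  exact ⟨⟨g, hg⟩, h⟩

open Classical in
/-- A `2`-transitive group containing a nontrivial element of small support contains the
alternating group. -/
theorem alternatingGroup_le_of_two_transitive_of_card_support {α : Type*} [Fintype α]
    [DecidableEq α] (G : Subgroup (Equiv.Perm α))
    (h2 : ∀ a b c d : α, a ≠ b → c ≠ d → ∃ g ∈ G, g a = c ∧ g b = d)
    (g₀ : Equiv.Perm α) (hg₀ : g₀ ∈ G) (h1 : g₀ ≠ 1)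
    (hcard : 4 * g₀.support.card + 8 ≤ Fintype.card α) (hn : 40 ≤ Fintype.card α) :
    alternatingGroup α ≤ G := by
  by_contra hG
  have hprim := MulAction.isPreprimitive_of_two_transitive G h2
  have hsmall : ∀ k ∈ G, k ≠ 1 → 4 ≤ k.support.card := by
    intro k hk hk1
    by_contra hlt
    have h2le : 2 ≤ k.support.card := Equiv.Perm.two_le_card_support_of_ne_one hk1
    obtain h | h : k.support.card = 2 ∨ k.support.card = 3 := by omega
    · have := Equiv.Perm.subgroup_eq_top_of_isPreprimitive_of_isSwap_mem hprim k
        (Equiv.Perm.card_support_eq_two.1 h) hk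
      exact hG (this ▸ le_top)
    · exact hG (Equiv.Perm.alternatingGroup_le_of_isPreprimitive_of_isThreeCycle_mem hprim
        (card_support_eq_three_iff.1 h) hk)
  obtain ⟨g, ⟨hg, hg1⟩, hmin⟩ := Set.exists_min_image {k | k ∈ G ∧ k ≠ 1}
    (fun k : Equiv.Perm α => k.support.card) (Set.toFinite _) ⟨g₀, hg₀, h1⟩
  have hgm : g.support.card ≤ g₀.support.card := hmin g₀ ⟨hg₀, h1⟩
  set D := g.support with hD
  set m := D.card with hm
  set n := Fintype.card α with hnn
  have hm4 : 4 ≤ m := hsmall g hg hg1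
  obtain ⟨N, hNpos, hN⟩ := exists_card_two_point_transporter G h2
  have hNpos : 0 < N := by
    obtain ⟨a, ha, b, hb, hab⟩ := Finset.one_lt_card.1 (show 1 < D.card by omega)
    exact hNpos a b hab
  let Y : G → Finset α := fun h => D.filter fun a => (h : Equiv.Perm α) a ∈ D
  let X : G → Finset α := fun h => (Y h).filter fun a => (h : Equiv.Perm α) (g a) ∉ D
  have hXY : ∀ h, (X h).card ≤ (Y h).card := fun h => Finset.card_filter_le _ _
  have key : ∀ h : G, (X h).Nonempty → 4 ≤ 3 * (Y h).card ∧ m ≤ 3 * (Y h).card := by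
    rintro h ⟨a, ha⟩
    simp only [X, Y, Finset.mem_filter] at ha
    obtain ⟨⟨ha, hha⟩, hhga⟩ := ha
    set k : Equiv.Perm α := (h : Equiv.Perm α)⁻¹ * g * h with hk
    have hks : ∀ x, x ∈ k.support ↔ (h : Equiv.Perm α) x ∈ D := by
      intro x
      rw [Equiv.Perm.mem_support, hD, Equiv.Perm.mem_support, hk, Equiv.Perm.mul_apply,
        Equiv.Perm.mul_apply, Ne, Equiv.Perm.inv_eq_iff_eq]
    have hinter : g.support ∩ k.support = Y h := by
      ext x; simp only [Y, Finset.mem_inter, Finset.mem_filter, hks]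
      rfl
    have hmemc : g * k * g⁻¹ * k⁻¹ ∈ G := by
      have : k ∈ G := G.mul_mem (G.mul_mem (G.inv_mem h.2) hg) h.2
      exact G.mul_mem (G.mul_mem (G.mul_mem hg this) (G.inv_mem hg)) (G.inv_mem this)
    have hne : g * k * g⁻¹ * k⁻¹ ≠ 1 := by
      intro hc
      have hc' : g * k = k * g := by
        rw [mul_inv_eq_one, mul_inv_eq_iff_eq_mul] at hc; exact hc
      have e := congrArg (fun q : Equiv.Perm α => q a) hc'
      simp only [Equiv.Perm.mul_apply] at e
      have h3 : k (g a) = g a := by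
        have := (hks (g a)).not.2 hhga
        rwa [Equiv.Perm.notMem_support] at this
      rw [h3] at e
      have h4 := (hks a).2 hha
      rw [Equiv.Perm.mem_support] at h4
      exact h4 (g.injective e)
    have hle := Equiv.Perm.card_support_commutator_le g k
    rw [hinter] at hle
    exact ⟨(hsmall _ hmemc hne).trans hle, (hmin _ ⟨hmemc, hne⟩).trans hle⟩
  have hineq : ∀ h : G, (X h).card ≤ (Y h).offDiag.card ∧
      (m - 3) * (X h).card ≤ 3 * (Y h).offDiag.card := by
    intro h
    rw [Finset.offDiag_card]
    rcases Finset.eq_empty_or_nonempty (X h) with h0 | hne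
    · rw [h0]; simp
    · obtain ⟨k1, k2⟩ := key h hne
      have := hXY h
      obtain ⟨y, hy⟩ : ∃ y, (Y h).card = y + 1 := ⟨(Y h).card - 1, by omega⟩
      rw [hy] at k1 k2 this ⊢
      have e : (y + 1) * (y + 1) - (y + 1) = (y + 1) * y := by
        rw [← Nat.mul_sub_one]; simp
      rw [e]
      constructor
      · nlinarith
      · have : (m - 3) ≤ 3 * y := by omega
        nlinarith
  have sumX : ∑ h : G, (X h).card = m * (m * (n - m) * N) := by
    have e1 : ∀ h : G, (X h).card = ∑ a ∈ D,
        if (((h : Equiv.Perm α) a, (h : Equiv.Perm α) (g a)) ∈ D ×ˢ Dᶜ) then 1 else 0 := by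
      intro h
      rw [← Finset.card_filter]
      congr 1
      ext a
      simp only [X, Y, Finset.mem_filter, Finset.mem_product, Finset.mem_compl]
      tauto
    simp_rw [e1]
    rw [Finset.sum_comm, ← smul_eq_mul, hm, ← Finset.sum_const]
    refine Finset.sum_congr rfl fun a ha => ?_
    rw [← Finset.card_filter, card_two_point_image_mem hN
      (Ne.symm (Equiv.Perm.mem_support.1 ha)), Finset.card_product, Finset.card_compl]
    rintro ⟨x, y⟩ hp
    simp only [Finset.mem_product, Finset.mem_compl] at hp
    intro (hxy : x = y)
    exact hp.2 (hxy ▸ hp.1)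
  have sumY : ∑ h : G, (Y h).offDiag.card = D.offDiag.card * (D.offDiag.card * N) := by
    have e1 : ∀ h : G, (Y h).offDiag.card = ∑ p ∈ D.offDiag,
        if (((h : Equiv.Perm α) p.1, (h : Equiv.Perm α) p.2) ∈ D.offDiag) then 1 else 0 := by
      intro h
      rw [← Finset.card_filter]
      congr 1
      ext ⟨a, b⟩
      simp only [Y, Finset.mem_filter, Finset.mem_offDiag, ne_eq, EmbeddingLike.apply_eq_iff_eq]
      tauto
    simp_rw [e1]
    conv_rhs => rw [← smul_eq_mul, ← Finset.sum_const]
    rw [Finset.sum_comm]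
    refine Finset.sum_congr rfl fun p hp => ?_
    rw [← Finset.card_filter, card_two_point_image_mem hN (Finset.mem_offDiag.1 hp).2.2]
    rintro p hp
    exact (Finset.mem_offDiag.1 hp).2.2
  have s1 : ∑ h : G, (X h).card ≤ ∑ h : G, (Y h).offDiag.card :=
    Finset.sum_le_sum fun h _ => (hineq h).1
  have s2 : (m - 3) * ∑ h : G, (X h).card ≤ 3 * ∑ h : G, (Y h).offDiag.card := by
    rw [Finset.mul_sum, Finset.mul_sum]
    exact Finset.sum_le_sum fun h _ => (hineq h).2
  rw [sumX, sumY, Finset.offDiag_card, ← hm] at s1 s2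
  have hmn : 4 * m + 8 ≤ n := by omega
  obtain ⟨q, hq⟩ : ∃ q, m = q + 4 := ⟨m - 4, by omega⟩
  obtain ⟨t, ht⟩ : ∃ t, n = 4 * m + 8 + t := ⟨n - (4 * m + 8), by omega⟩
  have e : m * m - m = m * (q + 3) := by rw [← Nat.mul_sub_one, hq]; simp
  have e2 : n - m = 3 * m + 8 + t := by omega
  rw [e, e2] at s1 s2
  have hmm : 0 < m * m * N := by positivity
  have t1 : 3 * m + 8 + t ≤ (q + 3) * (q + 3) := by
    refine Nat.le_of_mul_le_mul_left ?_ hmm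
    calc _ = m * (m * (3 * m + 8 + t) * N) := by ring
      _ ≤ _ := s1
      _ = _ := by ring
  have t2 : (q + 1) * (3 * m + 8 + t) ≤ 3 * ((q + 3) * (q + 3)) := by
    refine Nat.le_of_mul_le_mul_left ?_ hmm
    have : m - 3 = q + 1 := by omega
    rw [this] at s2
    calc _ = (q + 1) * (m * (m * (3 * m + 8 + t) * N)) := by ring
      _ ≤ _ := s2
      _ = _ := by ring
  have hn' : 40 ≤ 4 * m + 8 + t := by omega
  rw [hq] at t1 t2 hn'
  rcases Nat.lt_or_ge q 2 with hq2 | hq2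
  · interval_cases q <;> omega
  · nlinarith

lemma Finset.card_le_log_of_prime_dvd {P : Finset ℕ} (hP : ∀ p ∈ P, p.Prime) {m : ℕ} (hm : m ≠ 0)
    (hdvd : ∀ p ∈ P, p ∣ m) : P.card ≤ Nat.log 2 m := by
  have h1 : ∏ p ∈ P, p ∣ m := Finset.prod_primes_dvd m (fun p hp => (hP p hp).prime) hdvd
  have h2 : 2 ^ P.card ≤ ∏ p ∈ P, p := Finset.pow_card_le_prod P _ 2 fun p hp => (hP p hp).two_le
  exact Nat.le_log_of_pow_le one_lt_two (h2.trans (Nat.le_of_dvd (Nat.pos_of_ne_zero hm) h1))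

lemma Equiv.Perm.pow_apply_eq_self_iff_minimalPeriod_dvd {α : Type*} (g : Equiv.Perm α) (k : ℕ)
    (x : α) : (g ^ k) x = x ↔ Function.minimalPeriod g x ∣ k := by
  rw [← Function.isPeriodicPt_iff_minimalPeriod_dvd, Function.IsPeriodicPt, Function.IsFixedPt,
    ← Equiv.Perm.coe_pow]

lemma Equiv.Perm.minimalPeriod_ne_zero {α : Type*} [Finite α] (g : Equiv.Perm α) (x : α) :
    Function.minimalPeriod g x ≠ 0 := by
  have h := (g.pow_apply_eq_self_iff_minimalPeriod_dvd (orderOf g) x).1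
    (by simp [pow_orderOf_eq_one])
  exact fun h0 => (orderOf_pos g).ne' (Nat.eq_zero_of_zero_dvd (h0 ▸ h))

/-- A permutation having cycles of many distinct prime lengths has a nontrivial power of small
support. -/
theorem Equiv.Perm.exists_pow_ne_one_card_support_le {α : Type*} [Fintype α] [DecidableEq α]
    (g : Equiv.Perm α) (P : Finset ℕ) (hP : ∀ p ∈ P, p.Prime)
    (hcyc : ∀ p ∈ P, ∃ y, Function.minimalPeriod g y = p) (c : ℕ)
    (hcard : c * Nat.log 2 (Fintype.card α) < P.card) :
    ∃ k : ℕ, g ^ k ≠ 1 ∧ c * (g ^ k).support.card ≤ Fintype.card α := by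
  obtain ⟨p, hp, hple⟩ : ∃ p ∈ P, c * (Finset.univ.filter fun y =>
      p ∣ Function.minimalPeriod g y).card ≤ Fintype.card α := by
    by_contra hcon
    push Not at hcon
    have h1 : ∑ p ∈ P, (Finset.univ.filter fun y => p ∣ Function.minimalPeriod g y).card ≤
        Fintype.card α * Nat.log 2 (Fintype.card α) := by
      simp_rw [Finset.card_filter]
      rw [Finset.sum_comm, ← smul_eq_mul, ← Finset.card_univ, ← Finset.sum_const]
      refine Finset.sum_le_sum fun y _ => ?_
      rw [← Finset.card_filter, Finset.card_univ]
      refine (Finset.card_le_log_of_prime_dvd (m := Function.minimalPeriod g y)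
        (fun p hp => hP p (Finset.mem_filter.1 hp).1) (g.minimalPeriod_ne_zero y)
        fun p hp => (Finset.mem_filter.1 hp).2).trans (Nat.log_mono_right ?_)
      exact Function.minimalPeriod_le_card
    have h2 : P.card * Fintype.card α ≤ c * ∑ p ∈ P,
        (Finset.univ.filter fun y => p ∣ Function.minimalPeriod g y).card := by
      rw [Finset.mul_sum, ← smul_eq_mul, ← Finset.sum_const]
      exact Finset.sum_le_sum fun p hp => (hcon p hp).le
    obtain ⟨p, hp⟩ : P.Nonempty := Finset.card_pos.1 (by omega)
    obtain ⟨y, -⟩ := hcyc p hp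
    have hpos : 0 < Fintype.card α := Fintype.card_pos_iff.2 ⟨y⟩
    nlinarith [Nat.mul_le_mul_left c h1]
  have hpp := hP p hp
  obtain ⟨y, hy⟩ := hcyc p hp
  have ho : orderOf g ≠ 0 := (orderOf_pos g).ne'
  refine ⟨ordCompl[p] (orderOf g), fun h => ?_, ?_⟩
  · have h1 : (g ^ (ordCompl[p] (orderOf g))) y = y := by rw [h]; rfl
    rw [Equiv.Perm.pow_apply_eq_self_iff_minimalPeriod_dvd, hy] at h1
    exact Nat.not_dvd_ordCompl hpp ho h1
  · refine (Nat.mul_le_mul_left c (Finset.card_le_card fun x hx => ?_)).trans hple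
    rw [Finset.mem_filter]
    refine ⟨Finset.mem_univ _, ?_⟩
    by_contra hpx
    rw [Equiv.Perm.mem_support, Ne, Equiv.Perm.pow_apply_eq_self_iff_minimalPeriod_dvd] at hx
    apply hx
    have hd := (g.pow_apply_eq_self_iff_minimalPeriod_dvd (orderOf g) x).1
      (by simp [pow_orderOf_eq_one])
    rw [← Nat.ordProj_mul_ordCompl_eq_self (orderOf g) p] at hd
    exact Nat.Coprime.dvd_of_dvd_mul_left
      (((Nat.Prime.coprime_iff_not_dvd hpp).2 hpx).symm.pow_right _) hd

/-- A permutation of `p`-power order stabilizing a set of size less than `p` fixes it pointwise. -/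
lemma Equiv.Perm.apply_eq_self_of_prime_pow_order {α : Type*} [Fintype α] [DecidableEq α]
    {p : ℕ} (hp : p.Prime) (h : Equiv.Perm α) {a : ℕ} (ha : h ^ p ^ a = 1) (S : Finset α)
    (hS : ∀ y ∈ S, h y ∈ S) (hcard : S.card < p) {y : α} (hy : y ∈ S) : h y = y := by
  have hd := (h.pow_apply_eq_self_iff_minimalPeriod_dvd (p ^ a) y).1 (by simp [ha])
  obtain ⟨b, -, hb⟩ := (Nat.dvd_prime_pow hp).1 hd
  have hmem : ∀ i, h^[i] y ∈ S := by
    intro i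
    induction i with
    | zero => exact hy
    | succ i ih => rw [Function.iterate_succ_apply']; exact hS _ ih
  have hle : Function.minimalPeriod h y ≤ S.card := by
    rw [← Finset.card_range (Function.minimalPeriod h y)]
    refine Finset.card_le_card_of_injOn (fun i => h^[i] y) ?_ ?_
    · intro i _
      exact hmem i
    · intro i hi j hj hij
      exact Function.iterate_injOn_Iio_minimalPeriod (by simpa using hi) (by simpa using hj) hij
  have hb0 : b = 0 := by
    by_contra hb0
    have : p ^ 1 ≤ p ^ b := Nat.pow_le_pow_right hp.pos (Nat.one_le_iff_ne_zero.2 hb0)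
    rw [hb] at hle
    rw [pow_one] at this
    omega
  rw [hb0, pow_zero] at hb
  exact Function.minimalPeriod_eq_one_iff_isFixedPt.1 hb

open Classical in
/-- If all invariant equivalence relations of `G` are trivial and `G` has an invariant nontrivial
relation of valency less than a prime `p`, then an element of `G` with a fixed point has no
cycle of length `p`. -/
theorem minimalPeriod_ne_prime_of_small_orbital {α : Type*} [Fintype α] [DecidableEq α]
    (G : Subgroup (Equiv.Perm α))
    (hprim : ∀ r : Setoid α, (∀ g ∈ G, ∀ x y, r x y → r (g x) (g y)) → r = ⊥ ∨ r = ⊤)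
    (O : α → α → Prop) (hO : ∀ g ∈ G, ∀ x y, O x y → O (g x) (g y))
    {x₀ y₀ : α} (h₀ : O x₀ y₀) (hne : x₀ ≠ y₀) {p : ℕ} (hp : p.Prime)
    (hout : ∀ x, (Finset.univ.filter fun y => O x y).card < p)
    (hin : ∀ y, (Finset.univ.filter fun x => O x y).card < p)
    {g : Equiv.Perm α} (hg : g ∈ G) {x : α} (hx : g x = x) (y : α) :
    Function.minimalPeriod g y ≠ p := by
  intro hy
  let r : Setoid α :=
    { r := fun u v => ∀ h ∈ G, (∃ a, h ^ p ^ a = 1) → (h u = u ↔ h v = v)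
      iseqv := ⟨fun _ _ _ _ => Iff.rfl, fun huv h hh hp => (huv h hh hp).symm,
        fun huv hvw h hh hp => (huv h hh hp).trans (hvw h hh hp)⟩ }
  have hr : ∀ k ∈ G, ∀ u v, r u v → r (k u) (k v) := by
    intro k hk u v huv h hh ⟨a, ha⟩
    have := huv (k⁻¹ * h * k) (G.mul_mem (G.mul_mem (G.inv_mem hk) hh) hk) ⟨a, by
      have : k⁻¹ * h * k = k⁻¹ * h * (k⁻¹)⁻¹ := by simp
      rw [this, conj_pow, ha]; simp⟩
    simp only [Equiv.Perm.mul_apply, Equiv.Perm.inv_eq_iff_eq] at this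
    exact this
  have hr0 : r x₀ y₀ := by
    intro h hh ⟨a, ha⟩
    constructor
    · intro hfix
      refine h.apply_eq_self_of_prime_pow_order hp ha (Finset.univ.filter fun y => O x₀ y) ?_
        (hout x₀) (by simpa using h₀)
      intro z hz
      simp only [Finset.mem_filter, Finset.mem_univ, true_and] at hz ⊢
      simpa [hfix] using hO h hh _ _ hz
    · intro hfix
      refine h.apply_eq_self_of_prime_pow_order hp ha (Finset.univ.filter fun x => O x y₀) ?_
        (hin y₀) (by simpa using h₀)
      intro z hz
      simp only [Finset.mem_filter, Finset.mem_univ, true_and] at hz ⊢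
      simpa [hfix] using hO h hh _ _ hz
  rcases hprim r hr with h | h
  · rw [h] at hr0
    exact hne hr0
  · have hxy : r x y := by rw [h]; trivial
    have ho : orderOf g ≠ 0 := (orderOf_pos g).ne'
    have h1 := (hxy (g ^ (ordCompl[p] (orderOf g))) (G.pow_mem hg _)
      ⟨(orderOf g).factorization p, by
        rw [← pow_mul, mul_comm, Nat.ordProj_mul_ordCompl_eq_self, pow_orderOf_eq_one]⟩).1
      (Equiv.Perm.pow_apply_eq_self_of_apply_eq_self hx _)
    rw [Equiv.Perm.pow_apply_eq_self_iff_minimalPeriod_dvd, hy] at h1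
    exact Nat.not_dvd_ordCompl hp ho h1

/-! ### Counting permutations with prescribed images -/

lemma card_perm_comp_eq_le {α κ : Type*} [Fintype α] [DecidableEq α] [Fintype κ] [DecidableEq κ]
    (f f' : α → κ) :
    (Finset.univ.filter fun τ : Equiv.Perm α => f ∘ τ = f').card ≤
      ∏ i, (Finset.univ.filter fun a => f a = i).card.factorial := by
  have h1 := DomMulAct.stabilizer_card f
  simp only [Fintype.card_subtype] at h1
  rw [← h1]
  rcases Finset.eq_empty_or_nonempty
    (Finset.univ.filter fun τ : Equiv.Perm α => f ∘ τ = f') with h0 | ⟨τ₀, hτ₀⟩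
  · rw [h0]; simp
  · rw [Finset.mem_filter] at hτ₀
    refine Finset.card_le_card_of_injOn (fun τ => τ * τ₀⁻¹) ?_ ?_
    · intro τ hτ
      simp only [Finset.coe_filter, Finset.mem_univ, true_and, Set.mem_ofPred_eq] at hτ ⊢
      funext a
      have := congrFun (hτ.trans hτ₀.2.symm) (τ₀⁻¹ a)
      simpa using this
    · intro τ _ τ' _ h
      simpa using h

lemma card_perm_image_eq_le {α : Type*} [Fintype α] [DecidableEq α] (E F : Finset α) :
    (Finset.univ.filter fun τ : Equiv.Perm α => ∀ x, τ x ∈ E ↔ x ∈ F).card ≤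
      E.card.factorial * (Fintype.card α - E.card).factorial := by
  have h := card_perm_comp_eq_le (fun x => decide (x ∈ E)) (fun x => decide (x ∈ F))
  rw [Fintype.prod_bool] at h
  simp only [decide_eq_true_eq, decide_eq_false_iff_not, Finset.filter_mem_eq_inter,
    Finset.univ_inter] at h
  rw [Finset.filter_not, Finset.filter_mem_eq_inter, Finset.univ_inter,
    ← Finset.compl_eq_univ_sdiff,
    Finset.card_compl] at h
  convert h using 4
  simp [funext_iff]

/-! ### Sums over cycles -/

lemma Equiv.Perm.apply_eq_self_of_card_sameCycle {α : Type*} [Fintype α] [DecidableEq α]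
    (A : Equiv.Perm α) {x : α} (h : (Finset.univ.filter fun y => A.SameCycle x y).card = 1) :
    A x = x := by
  obtain ⟨z, hz⟩ := Finset.card_eq_one.1 h
  have h1 : x ∈ Finset.univ.filter fun y => A.SameCycle x y := by
    simp [Equiv.Perm.SameCycle.refl]
  have h2 : A x ∈ Finset.univ.filter fun y => A.SameCycle x y := by
    simp [Equiv.Perm.SameCycle.refl]
  rw [hz, Finset.mem_singleton] at h1 h2
  rw [h2, h1]

lemma Equiv.Perm.apply_apply_eq_self_of_card_sameCycle {α : Type*} [Fintype α] [DecidableEq α]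
    (A : Equiv.Perm α) {x : α} (h : (Finset.univ.filter fun y => A.SameCycle x y).card = 2) :
    A (A x) = x ∧ A x ≠ x := by
  have hne : A x ≠ x := by
    intro hx
    have : (Finset.univ.filter fun y => A.SameCycle x y) = {x} := by
      ext y
      simp only [Finset.mem_filter, Finset.mem_univ, true_and, Finset.mem_singleton]
      constructor
      · rintro ⟨i, hi⟩
        rw [← hi, Equiv.Perm.zpow_apply_eq_self_of_apply_eq_self hx]
      · rintro rfl; exact Equiv.Perm.SameCycle.refl _ _
    rw [this] at h
    simp at h
  refine ⟨?_, hne⟩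
  by_contra hAA
  have hsub : ({x, A x, A (A x)} : Finset α) ⊆ Finset.univ.filter fun y => A.SameCycle x y := by
    intro y hy
    simp only [Finset.mem_insert, Finset.mem_singleton] at hy
    rcases hy with rfl | rfl | rfl <;> simp [Equiv.Perm.SameCycle.refl]
  have hc : ({x, A x, A (A x)} : Finset α).card = 3 := by
    rw [Finset.card_eq_three]
    exact ⟨x, A x, A (A x), hne.symm, fun h => hAA h.symm, fun h => hne (A.injective h).symm, rfl⟩
  have := Finset.card_le_card hsub
  omega

open Classical in
/-- Bound a sum over the cycles of a permutation by the numbers of fixed points and of points of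
period two. -/
lemma sum_cycles_le {α : Type*} [Fintype α] [DecidableEq α] (A : Equiv.Perm α) (φ : ℕ → ℝ)
    {a b₁ b₂ : ℝ} (hb₁ : 0 ≤ b₁) (hb₂ : 0 ≤ b₂) (h1 : φ 1 ≤ a + b₁) (h2 : φ 2 / 2 ≤ a + b₂)
    (h3 : ∀ k, 3 ≤ k → φ k / k ≤ a) :
    ∑ q : Quotient (Equiv.Perm.SameCycle.setoid A),
      φ (Finset.univ.filter fun x => (Quotient.mk _ x : Quotient (Equiv.Perm.SameCycle.setoid A))
        = q).card ≤ a * Fintype.card α + b₁ * (Finset.univ.filter fun x => A x = x).card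
        + b₂ * (Finset.univ.filter fun x => A (A x) = x ∧ A x ≠ x).card := by
  set Q := Quotient (Equiv.Perm.SameCycle.setoid A)
  let c : α → ℕ := fun x => (Finset.univ.filter fun y => A.SameCycle x y).card
  have hc : ∀ x, (Finset.univ.filter fun y => (Quotient.mk _ y : Q) = Quotient.mk _ x).card
      = c x := by
    intro x
    simp only [c]
    congr 1
    ext y
    simp only [Finset.mem_filter, Finset.mem_univ, true_and]
    rw [Quotient.eq]
    exact ⟨fun h => Equiv.Perm.SameCycle.symm h, fun h => Equiv.Perm.SameCycle.symm h⟩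
  have hcpos : ∀ x, 0 < c x := fun x => Finset.card_pos.2
    ⟨x, by simp [Equiv.Perm.SameCycle.refl]⟩
  have e1 : ∑ q : Q, φ (Finset.univ.filter fun x => (Quotient.mk _ x : Q) = q).card
      = ∑ x : α, φ (c x) / c x := by
    rw [← Finset.sum_fiberwise (s := Finset.univ) (g := fun x => (Quotient.mk _ x : Q))]
    refine Finset.sum_congr rfl fun q _ => ?_
    obtain ⟨x, rfl⟩ := Quotient.exists_rep q
    have : ∀ y ∈ Finset.univ.filter fun y => (Quotient.mk _ y : Q) = Quotient.mk _ x,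
        φ (c y) / c y = φ (c x) / c x := by
      intro y hy
      rw [Finset.mem_filter] at hy
      rw [← hc y, hy.2, hc]
    change _ = ∑ y ∈ Finset.univ.filter fun y => (Quotient.mk _ y : Q) = Quotient.mk _ x, _
    rw [Finset.sum_congr rfl this, Finset.sum_const]
    change φ (Finset.univ.filter fun y => (Quotient.mk _ y : Q) = Quotient.mk _ x).card =
      (Finset.univ.filter fun y => (Quotient.mk _ y : Q) = Quotient.mk _ x).card • _
    rw [hc, nsmul_eq_mul]
    have := hcpos x
    field_simp
  rw [e1]
  have e2 : ∀ x, φ (c x) / c x ≤ a + b₁ * (if A x = x then 1 else 0)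
      + b₂ * (if A (A x) = x ∧ A x ≠ x then 1 else 0) := by
    intro x
    have p1 : 0 ≤ b₁ * (if A x = x then (1 : ℝ) else 0) := by split_ifs <;> simp [hb₁]
    have p2 : 0 ≤ b₂ * (if A (A x) = x ∧ A x ≠ x then (1 : ℝ) else 0) := by
      split_ifs <;> simp [hb₂]
    have := hcpos x
    obtain h | h | h : c x = 1 ∨ c x = 2 ∨ 3 ≤ c x := by omega
    · rw [h, if_pos (A.apply_eq_self_of_card_sameCycle h)]
      push_cast
      linarith
    · rw [h]
      rw [if_pos (A.apply_apply_eq_self_of_card_sameCycle h)] at p2 ⊢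
      push_cast
      linarith
    · linarith [h3 _ h]
  refine (Finset.sum_le_sum fun x _ => e2 x).trans (le_of_eq ?_)
  rw [Finset.sum_add_distrib, Finset.sum_add_distrib, ← Finset.mul_sum, ← Finset.mul_sum,
    Finset.card_filter, Finset.card_filter]
  push_cast
  simp [mul_comm]

open Classical in
lemma sum_pow_card_invariant_le {α : Type*} [Fintype α] [DecidableEq α] (A : Equiv.Perm α)
    {z : ℝ} (hz : 0 ≤ z) :
    ∑ E ∈ Finset.univ.filter (fun E : Finset α => ∀ x, A x ∈ E ↔ x ∈ E), z ^ E.card ≤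
    ∏ q : Quotient (Equiv.Perm.SameCycle.setoid A),
      (1 + z ^ (Finset.univ.filter fun x =>
        (Quotient.mk _ x : Quotient (Equiv.Perm.SameCycle.setoid A)) = q).card) := by
  set Q := Quotient (Equiv.Perm.SameCycle.setoid A)
  rw [Finset.prod_one_add]
  let Φ : Finset α → Finset Q := fun E => E.image (Quotient.mk _)
  have hmem : ∀ E : Finset α, (∀ x, A x ∈ E ↔ x ∈ E) → ∀ x y, A.SameCycle x y →
      x ∈ E → y ∈ E := by
    rintro E hE x y ⟨i, rfl⟩ hx
    have hi : ∀ i : ℤ, ∀ w, (A ^ i) w ∈ E ↔ w ∈ E := by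
      intro i
      induction i with
      | zero => simp
      | succ i ih => intro w; rw [add_comm, zpow_add, Equiv.Perm.mul_apply, zpow_one, hE, ih]
      | pred i ih =>
        intro w
        rw [sub_eq_neg_add, zpow_add, Equiv.Perm.mul_apply, ← hE]
        rw [zpow_neg_one, ← Equiv.Perm.mul_apply, mul_inv_cancel, Equiv.Perm.one_apply, ih]
    exact (hi i x).2 hx
  have hΦ : ∀ E : Finset α, (∀ x, A x ∈ E ↔ x ∈ E) → ∀ x, x ∈ E ↔ Quotient.mk _ x ∈ Φ E := by
    intro E hE x
    simp only [Φ, Finset.mem_image]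
    constructor
    · exact fun h => ⟨x, h, rfl⟩
    · rintro ⟨y, hy, hyx⟩
      exact hmem E hE y x (Quotient.exact hyx) hy
  calc ∑ E ∈ Finset.univ.filter (fun E : Finset α => ∀ x, A x ∈ E ↔ x ∈ E), z ^ E.card
      = ∑ E ∈ Finset.univ.filter (fun E : Finset α => ∀ x, A x ∈ E ↔ x ∈ E),
        ∏ q ∈ Φ E, z ^ (Finset.univ.filter fun x => (Quotient.mk _ x : Q) = q).card := by
        refine Finset.sum_congr rfl fun E hE => ?_
        rw [Finset.mem_filter] at hE
        rw [Finset.prod_pow_eq_pow_sum]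
        congr 1
        rw [Finset.card_eq_sum_card_fiberwise (t := Φ E) (f := fun x => (Quotient.mk _ x : Q))]
        · refine Finset.sum_congr rfl fun q hq => ?_
          congr 1
          ext x
          simp only [Finset.mem_filter, Finset.mem_univ, true_and, and_iff_right_iff_imp]
          rintro rfl
          exact (hΦ E hE.2 x).2 hq
        · intro x hx
          exact (hΦ E hE.2 x).1 hx
    _ = ∑ T ∈ (Finset.univ.filter (fun E : Finset α => ∀ x, A x ∈ E ↔ x ∈ E)).image Φ,
        ∏ q ∈ T, z ^ (Finset.univ.filter fun x => (Quotient.mk _ x : Q) = q).card := by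
        rw [Finset.sum_image]
        intro E hE E' hE' h
        simp only [Finset.coe_filter, Finset.mem_univ, true_and, Set.mem_ofPred_eq] at hE hE'
        ext x
        rw [hΦ E hE, hΦ E' hE', h]
    _ ≤ _ := by
        refine Finset.sum_le_sum_of_subset_of_nonneg (fun T _ => by simp) fun T _ _ => ?_
        exact Finset.prod_nonneg fun _ _ => pow_nonneg hz _

open Classical in
lemma card_invariant_sets_le {α : Type*} [Fintype α] [DecidableEq α] (A : Equiv.Perm α)
    (k : ℕ) {z s : ℝ} (hz : 0 < z) (hz1 : z ≤ 1)
    (h1 : (Finset.univ.filter fun x => A x = x).card * z ≤ k)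
    (hs : ((Finset.univ.filter fun x => A (A x) = x ∧ A x ≠ x).card : ℝ) ≤ 2 * s ^ 2)
    (h2 : s ^ 2 * z ^ 2 ≤ k) (h3 : Fintype.card α * z ^ 3 ≤ k) :
    ((Finset.univ.filter fun E : Finset α => E.card = k ∧ ∀ x, A x ∈ E ↔ x ∈ E).card : ℝ) ≤
      (Real.exp 3 / z) ^ k := by
  have e1 := sum_pow_card_invariant_le A hz.le
  have e2 : ∏ q : Quotient (Equiv.Perm.SameCycle.setoid A),
      (1 + z ^ (Finset.univ.filter fun x =>
        (Quotient.mk _ x : Quotient (Equiv.Perm.SameCycle.setoid A)) = q).card) ≤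
      Real.exp (3 * k) := by
    refine (Finset.prod_le_prod (fun _ _ => by positivity) fun q _ =>
      (add_comm _ _).trans_le (Real.add_one_le_exp _)).trans ?_
    rw [← Real.exp_sum, Real.exp_le_exp]
    have := sum_cycles_le A (fun j => z ^ j) (a := z ^ 3) (b₁ := z) (b₂ := z ^ 2 / 2)
      hz.le (by positivity) (by rw [pow_one]; linarith [pow_pos hz 3])
      (by linarith [pow_pos hz 3]) (by
        intro j hj
        have : z ^ j ≤ z ^ 3 := pow_le_pow_of_le_one hz.le hz1 hj
        have hj' : (1 : ℝ) ≤ j := by exact_mod_cast (by omega : 1 ≤ j)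
        exact (div_le_self (by positivity) hj').trans this)
    refine this.trans ?_
    have : z ^ 2 / 2 * ((Finset.univ.filter fun x => A (A x) = x ∧ A x ≠ x).card : ℝ) ≤
        z ^ 2 / 2 * (2 * s ^ 2) := mul_le_mul_of_nonneg_left hs (by positivity)
    nlinarith
  have e3 : ((Finset.univ.filter fun E : Finset α =>
      E.card = k ∧ ∀ x, A x ∈ E ↔ x ∈ E).card : ℝ) * z ^ k ≤ Real.exp (3 * k) := by
    refine le_trans ?_ (e1.trans e2)
    rw [← nsmul_eq_mul, ← Finset.sum_const]
    calc _ = ∑ E ∈ Finset.univ.filter (fun E : Finset α => E.card = k ∧ ∀ x, A x ∈ E ↔ x ∈ E),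
          z ^ E.card := Finset.sum_congr rfl fun E hE => by rw [(Finset.mem_filter.1 hE).2.1]
      _ ≤ _ := Finset.sum_le_sum_of_subset_of_nonneg
          (fun E hE => by simp only [Finset.mem_filter] at hE ⊢; exact ⟨hE.1, hE.2.2⟩)
          (fun _ _ _ => by positivity)
  rw [div_pow, ← Real.exp_nat_mul, le_div_iff₀ (by positivity), mul_comm (k : ℝ) 3]
  exact e3

open Classical in
lemma card_perm_common_invariant_le {α : Type*} [Fintype α] [DecidableEq α]
    (A B : Equiv.Perm α) (k : ℕ) :
    (Finset.univ.filter fun τ : Equiv.Perm α => ∃ E : Finset α, E.card = k ∧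
      (∀ x, A x ∈ E ↔ x ∈ E) ∧ ∀ x, (τ * B * τ⁻¹) x ∈ E ↔ x ∈ E).card ≤
    (Finset.univ.filter fun E : Finset α => E.card = k ∧ ∀ x, A x ∈ E ↔ x ∈ E).card *
    (Finset.univ.filter fun E : Finset α => E.card = k ∧ ∀ x, B x ∈ E ↔ x ∈ E).card *
      (k.factorial * (Fintype.card α - k).factorial) := by
  set SA := Finset.univ.filter fun E : Finset α => E.card = k ∧ ∀ x, A x ∈ E ↔ x ∈ E
  set SB := Finset.univ.filter fun E : Finset α => E.card = k ∧ ∀ x, B x ∈ E ↔ x ∈ E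
  rw [← Finset.card_product]
  refine le_trans (Finset.card_le_card (t := (SA ×ˢ SB).biUnion fun p =>
    Finset.univ.filter fun τ : Equiv.Perm α => ∀ x, τ x ∈ p.1 ↔ x ∈ p.2) ?_) ?_
  · intro τ hτ
    obtain ⟨E, hE, hA, hB⟩ := (Finset.mem_filter.1 hτ).2
    have hF : ∀ x, x ∈ E.map τ⁻¹.toEmbedding ↔ τ x ∈ E := by
      intro x
      simp only [Finset.mem_map, Equiv.coe_toEmbedding]
      constructor
      · rintro ⟨y, hy, rfl⟩; simpa using hy
      · intro h; exact ⟨τ x, h, by simp⟩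
    refine Finset.mem_biUnion.2 ⟨(E, E.map τ⁻¹.toEmbedding), ?_, ?_⟩
    · refine Finset.mem_product.2 ⟨Finset.mem_filter.2 ⟨Finset.mem_univ _, hE, hA⟩,
        Finset.mem_filter.2 ⟨Finset.mem_univ _, by simp [hE], fun x => ?_⟩⟩
      rw [hF, hF, ← hB (τ x)]
      simp
    · exact Finset.mem_filter.2 ⟨Finset.mem_univ _, fun x => (hF x).symm⟩
  · refine Finset.card_biUnion_le_card_mul _ _ _ fun p hp => ?_
    have := card_perm_image_eq_le p.1 p.2
    rwa [(Finset.mem_filter.1 (Finset.mem_product.1 hp).1).2.1] at this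

lemma factorial_mul_factorial_sub_le {n k : ℕ} (hk : 1 ≤ k) (hkn : 2 * k ≤ n) :
    ((k.factorial * (n - k).factorial : ℕ) : ℝ) ≤ n.factorial * (2 * k / n) ^ k := by
  have hn : (0 : ℝ) < n := by exact_mod_cast (by omega : 0 < n)
  have hk' : (0 : ℝ) < k := by exact_mod_cast hk
  have h1 := Nat.choose_mul_factorial_mul_factorial (by omega : k ≤ n)
  have h2 := Nat.pow_le_choose (α := ℝ) k n
  have h3 : ((n : ℝ) / 2) ^ k ≤ ((n + 1 - k : ℕ) : ℝ) ^ k := by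
    refine pow_le_pow_left₀ (by positivity) ?_ k
    rw [div_le_iff₀ two_pos]
    exact_mod_cast (by omega : n ≤ (n + 1 - k) * 2)
  have h4 : (k.factorial : ℝ) ≤ (k : ℝ) ^ k := by exact_mod_cast Nat.factorial_le_pow k
  have h5 : ((n : ℝ) / 2) ^ k / (k : ℝ) ^ k ≤ n.choose k := by
    refine le_trans ?_ h2
    exact div_le_div₀ (by positivity) h3 (by positivity) h4
  rw [← div_pow] at h5
  have h6 : (1 : ℝ) ≤ n.choose k * (2 * k / n) ^ k := by
    calc (1 : ℝ) = ((n : ℝ) / 2 / k) ^ k * (2 * k / n) ^ k := by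
          rw [← mul_pow]; field_simp; simp
      _ ≤ _ := mul_le_mul_of_nonneg_right h5 (by positivity)
  rw [← h1]
  push_cast
  have : (0 : ℝ) ≤ k.factorial * (n - k).factorial := by positivity
  nlinarith

lemma product_bound_aux {c c' s s' u v δ : ℝ} (hc : 0 ≤ c) (hc' : 0 ≤ c') (hs : 0 ≤ s)
    (hs' : 0 ≤ s') (hu : 1 ≤ u) (hδ : 0 < δ) (hδ1 : δ ≤ 1) (hv : 0 < v)
    (h1 : c ≤ δ * v ^ 4) (h1' : c' ≤ δ * v ^ 4)
    (h2 : (c + s) * (c' + s') ≤ δ * v ^ 6) (h3 : s ≤ v ^ 3) (h3' : s' ≤ v ^ 3) (huv : u ≤ δ * v) :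
    (c / u ^ 6 + s / u ^ 3 + v ^ 2 / u ^ 2) * (c' / u ^ 6 + s' / u ^ 3 + v ^ 2 / u ^ 2) * u ^ 6
      ≤ 6 * δ * v ^ 6 := by
  have hu0 : 0 < u := by linarith
  have hu3 : 1 ≤ u ^ 3 := one_le_pow₀ hu
  have hu2 : 1 ≤ u ^ 2 := one_le_pow₀ hu
  have e : (c / u ^ 6 + s / u ^ 3 + v ^ 2 / u ^ 2) * (c' / u ^ 6 + s' / u ^ 3 + v ^ 2 / u ^ 2)
      * u ^ 6 = (c / u ^ 3 + s) * (c' / u ^ 3 + s') + c / u ^ 2 * v ^ 2 + c' / u ^ 2 * v ^ 2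
        + s * v ^ 2 * u + s' * v ^ 2 * u + v ^ 4 * u ^ 2 := by
    field_simp
    ring
  have i1 : (c / u ^ 3 + s) * (c' / u ^ 3 + s') ≤ (c + s) * (c' + s') := by
    have := div_le_self hc hu3
    have := div_le_self hc' hu3
    gcongr
  have i2 : c / u ^ 2 * v ^ 2 ≤ δ * v ^ 6 := by
    calc _ ≤ c * v ^ 2 := by
          have := div_le_self hc hu2
          gcongr
      _ ≤ δ * v ^ 4 * v ^ 2 := by gcongr
      _ = _ := by ring
  have i2' : c' / u ^ 2 * v ^ 2 ≤ δ * v ^ 6 := by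
    calc _ ≤ c' * v ^ 2 := by
          have := div_le_self hc' hu2
          gcongr
      _ ≤ δ * v ^ 4 * v ^ 2 := by gcongr
      _ = _ := by ring
  have i3 : s * v ^ 2 * u ≤ δ * v ^ 6 := by
    calc _ ≤ v ^ 3 * v ^ 2 * (δ * v) := by gcongr
      _ = _ := by ring
  have i3' : s' * v ^ 2 * u ≤ δ * v ^ 6 := by
    calc _ ≤ v ^ 3 * v ^ 2 * (δ * v) := by gcongr
      _ = _ := by ring
  have i4 : v ^ 4 * u ^ 2 ≤ δ * v ^ 6 := by
    calc _ ≤ v ^ 4 * (δ * v) ^ 2 := by gcongr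
      _ = δ * δ * v ^ 6 := by ring
      _ ≤ 1 * δ * v ^ 6 := by gcongr
      _ = _ := by ring
  rw [e]
  linarith

open Classical in
lemma card_invariant_sets_le_of_scales {α : Type*} [Fintype α] [DecidableEq α]
    (C : Equiv.Perm α) {t u v : ℝ} {k : ℕ} (hupos : 0 < u) (huv : u ≤ v) (hu : u ^ 6 = k)
    (hvn : v ^ 6 = Fintype.card α) (ht : 0 ≤ t)
    (hCt : ((Finset.univ.filter fun x => C (C x) = x ∧ C x ≠ x).card : ℝ) ≤ 2 * t ^ 2) :
    ((Finset.univ.filter fun E : Finset α => E.card = k ∧ ∀ x, C x ∈ E ↔ x ∈ E).card : ℝ) ≤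
      (Real.exp 3 * (((Finset.univ.filter fun x => C x = x).card : ℝ) / u ^ 6 + t / u ^ 3 +
        v ^ 2 / u ^ 2)) ^ k := by
  have hv : 0 < v := by linarith
  set d : ℝ := ((Finset.univ.filter fun x => C x = x).card : ℝ)
  have hd : 0 ≤ d := Nat.cast_nonneg _
  have hy1 : 1 ≤ v ^ 2 / u ^ 2 := by
    rw [one_le_div (by positivity)]; gcongr
  have p1 : 0 ≤ d / u ^ 6 := by positivity
  have p2 : 0 ≤ t / u ^ 3 := by positivity
  obtain ⟨y, hy⟩ : ∃ y, y = d / u ^ 6 + t / u ^ 3 + v ^ 2 / u ^ 2 := ⟨_, rfl⟩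
  have hypos : 0 < y := by linarith
  have q1 : d * (1 / y) ≤ k := by
    rw [mul_one_div, div_le_iff₀ hypos, ← hu]
    calc d = u ^ 6 * (d / u ^ 6) := by field_simp
      _ ≤ _ := mul_le_mul_of_nonneg_left (by linarith) (by positivity)
  have q2 : t ^ 2 * (1 / y) ^ 2 ≤ k := by
    rw [← mul_pow, mul_one_div, ← hu, show u ^ 6 = (u ^ 3) ^ 2 by ring]
    refine pow_le_pow_left₀ (by positivity) ?_ 2
    rw [div_le_iff₀ hypos]
    calc t = u ^ 3 * (t / u ^ 3) := by field_simp
      _ ≤ _ := mul_le_mul_of_nonneg_left (by linarith) (by positivity)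
  have q3 : Fintype.card α * (1 / y) ^ 3 ≤ k := by
    rw [← hvn, show v ^ 6 = (v ^ 2) ^ 3 by ring, ← mul_pow, mul_one_div, ← hu,
      show u ^ 6 = (u ^ 2) ^ 3 by ring]
    refine pow_le_pow_left₀ (by positivity) ?_ 3
    rw [div_le_iff₀ hypos]
    calc v ^ 2 = u ^ 2 * (v ^ 2 / u ^ 2) := by field_simp
      _ ≤ _ := mul_le_mul_of_nonneg_left (by linarith) (by positivity)
  have := card_invariant_sets_le C k (z := 1 / y) (s := t) (by positivity)
    (by rw [div_le_one hypos]; linarith) q1 hCt q2 q3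
  rw [← hy]
  refine this.trans (le_of_eq ?_)
  rw [div_div_eq_mul_div, div_one]

open Classical in
lemma card_perm_common_invariant_le_pow {α : Type*} [Fintype α] [DecidableEq α]
    (A B : Equiv.Perm α) {δ s s' v : ℝ} (hδ : 0 < δ) (hδ1 : δ ≤ 1 / 2) (hs : 0 ≤ s) (hs' : 0 ≤ s')
    (hv : 0 < v) (hvn : v ^ 6 = Fintype.card α)
    (hA : (Finset.univ.filter fun x => A x = x).card ≤ δ * v ^ 4)
    (hB : (Finset.univ.filter fun x => B x = x).card ≤ δ * v ^ 4)
    (hsA : ((Finset.univ.filter fun x => A (A x) = x ∧ A x ≠ x).card : ℝ) ≤ 2 * s ^ 2)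
    (hsB : ((Finset.univ.filter fun x => B (B x) = x ∧ B x ≠ x).card : ℝ) ≤ 2 * s' ^ 2)
    (hsv : s ≤ v ^ 3) (hsv' : s' ≤ v ^ 3)
    (hAB : ((Finset.univ.filter fun x => A x = x).card + s) *
      ((Finset.univ.filter fun x => B x = x).card + s') ≤ δ * v ^ 6)
    (k : ℕ) (hk : 1 ≤ k) (hkn : (k : ℝ) ≤ δ ^ 6 * Fintype.card α) :
    ((Finset.univ.filter fun τ : Equiv.Perm α => ∃ E : Finset α, E.card = k ∧
      (∀ x, A x ∈ E ↔ x ∈ E) ∧ ∀ x, (τ * B * τ⁻¹) x ∈ E ↔ x ∈ E).card : ℝ) ≤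
    (12 * Real.exp 6 * δ) ^ k * (Fintype.card α).factorial := by
  set n := Fintype.card α
  set c : ℝ := ((Finset.univ.filter fun x => A x = x).card : ℝ)
  set c' : ℝ := ((Finset.univ.filter fun x => B x = x).card : ℝ)
  have hc : 0 ≤ c := Nat.cast_nonneg _
  have hc' : 0 ≤ c' := Nat.cast_nonneg _
  have hk' : (1 : ℝ) ≤ k := by exact_mod_cast hk
  obtain ⟨u, hu0, hu⟩ : ∃ u : ℝ, 0 ≤ u ∧ u ^ 6 = k :=
    ⟨(k : ℝ) ^ ((6 : ℕ) : ℝ)⁻¹, by positivity, Real.rpow_inv_natCast_pow (by positivity) (by simp)⟩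
  have hu1 : 1 ≤ u := by
    by_contra h
    have := pow_lt_one₀ hu0 (not_le.1 h) (n := 6) (by simp)
    linarith
  have hupos : 0 < u := by linarith
  have huv : u ≤ δ * v := by
    refine le_of_pow_le_pow_left₀ (n := 6) (by simp) (by positivity) ?_
    rw [hu, mul_pow, hvn]; exact hkn
  have huv' : u ≤ v := huv.trans (by nlinarith)
  have hpb := product_bound_aux hc hc' hs hs' hu1 hδ (by linarith) hv hA hB hAB hsv hsv' huv
  have hkn2 : 2 * k ≤ n := by
    have h1 : δ ^ 6 ≤ 1 / 2 := by
      calc δ ^ 6 ≤ δ ^ 1 := pow_le_pow_of_le_one hδ.le (by linarith) (by norm_num)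
        _ ≤ 1 / 2 := by simpa using hδ1
    have : (2 : ℝ) * k ≤ n := by nlinarith [(Nat.cast_nonneg n : (0 : ℝ) ≤ n)]
    exact_mod_cast this
  have h1 := card_perm_common_invariant_le A B k
  have h1' := (Nat.cast_le (α := ℝ)).2 h1
  rw [Nat.cast_mul, Nat.cast_mul] at h1'
  refine h1'.trans ?_
  have b1 := card_invariant_sets_le_of_scales A hupos huv' hu hvn hs hsA
  have b2 := card_invariant_sets_le_of_scales B hupos huv' hu hvn hs' hsB
  have b3 := factorial_mul_factorial_sub_le hk hkn2
  set y := c / u ^ 6 + s / u ^ 3 + v ^ 2 / u ^ 2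
  set y' := c' / u ^ 6 + s' / u ^ 3 + v ^ 2 / u ^ 2
  have hypos : 0 ≤ y := by positivity
  have hypos' : 0 ≤ y' := by positivity
  calc _ ≤ (Real.exp 3 * y) ^ k * (Real.exp 3 * y') ^ k * (n.factorial * (2 * k / n) ^ k) := by
        gcongr
    _ = (Real.exp 3 * y * (Real.exp 3 * y') * (2 * k / n)) ^ k * n.factorial := by
        rw [mul_pow _ (2 * (k : ℝ) / n) k, mul_pow (Real.exp 3 * y) (Real.exp 3 * y') k]; ring
    _ ≤ _ := by
        refine mul_le_mul_of_nonneg_right (pow_le_pow_left₀ (by positivity) ?_ k) (by positivity)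
        have e6 : Real.exp 6 = Real.exp 3 * Real.exp 3 := by rw [← Real.exp_add]; norm_num
        rw [← hu, ← hvn, mul_div_assoc', div_le_iff₀ (by positivity), e6]
        have := mul_le_mul_of_nonneg_left hpb
          (show 0 ≤ 2 * (Real.exp 3 * Real.exp 3) by positivity)
        nlinarith

open Classical in
theorem card_perm_small_common_invariant_le {α : Type*} [Fintype α] [DecidableEq α]
    (A B : Equiv.Perm α) {δ s s' v : ℝ} (hδ : 0 < δ) (hδ1 : 24 * Real.exp 6 * δ ≤ 1)
    (hs : 0 ≤ s) (hs' : 0 ≤ s')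
    (hv : 0 < v) (hvn : v ^ 6 = Fintype.card α)
    (hA : (Finset.univ.filter fun x => A x = x).card ≤ δ * v ^ 4)
    (hB : (Finset.univ.filter fun x => B x = x).card ≤ δ * v ^ 4)
    (hsA : ((Finset.univ.filter fun x => A (A x) = x ∧ A x ≠ x).card : ℝ) ≤ 2 * s ^ 2)
    (hsB : ((Finset.univ.filter fun x => B (B x) = x ∧ B x ≠ x).card : ℝ) ≤ 2 * s' ^ 2)
    (hsv : s ≤ v ^ 3) (hsv' : s' ≤ v ^ 3)
    (hAB : ((Finset.univ.filter fun x => A x = x).card + s) *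
      ((Finset.univ.filter fun x => B x = x).card + s') ≤ δ * v ^ 6) :
    ((Finset.univ.filter fun τ : Equiv.Perm α => ∃ E : Finset α, E.Nonempty ∧
      (E.card : ℝ) ≤ δ ^ 6 * Fintype.card α ∧
      (∀ x, A x ∈ E ↔ x ∈ E) ∧ ∀ x, (τ * B * τ⁻¹) x ∈ E ↔ x ∈ E).card : ℝ) ≤
    24 * Real.exp 6 * δ * (Fintype.card α).factorial := by
  have he : 1 ≤ Real.exp 6 := Real.one_le_exp (by norm_num)
  have hδ2 : δ ≤ 1 / 2 := by nlinarith
  set η := 12 * Real.exp 6 * δ with hη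
  have hη0 : 0 < η := by positivity
  have hη1 : η ≤ 1 / 2 := by linarith
  set n := Fintype.card α
  set K := ⌊δ ^ 6 * (n : ℝ)⌋₊
  have hK : ∀ k : ℕ, (k : ℝ) ≤ δ ^ 6 * n ↔ k ≤ K := fun k => (Nat.le_floor_iff (by positivity)).symm
  let S : ℕ → Finset (Equiv.Perm α) := fun k => Finset.univ.filter fun τ : Equiv.Perm α =>
    ∃ E : Finset α, E.card = k ∧ (∀ x, A x ∈ E ↔ x ∈ E) ∧ ∀ x, (τ * B * τ⁻¹) x ∈ E ↔ x ∈ E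
  have hsub : (Finset.univ.filter fun τ : Equiv.Perm α => ∃ E : Finset α, E.Nonempty ∧
      (E.card : ℝ) ≤ δ ^ 6 * Fintype.card α ∧
      (∀ x, A x ∈ E ↔ x ∈ E) ∧ ∀ x, (τ * B * τ⁻¹) x ∈ E ↔ x ∈ E) ⊆
      (Finset.range K).biUnion fun k => S (k + 1) := by
    intro τ hτ
    obtain ⟨E, hne, hE, h⟩ := (Finset.mem_filter.1 hτ).2
    have hpos := Finset.card_pos.2 hne
    have := (hK _).1 hE
    exact Finset.mem_biUnion.2 ⟨E.card - 1, by simp; omega,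
      Finset.mem_filter.2 ⟨Finset.mem_univ _, E, by omega, h⟩⟩
  calc _ ≤ (((Finset.range K).biUnion fun k => S (k + 1)).card : ℝ) := by
        exact_mod_cast Finset.card_le_card hsub
    _ ≤ ∑ k ∈ Finset.range K, ((S (k + 1)).card : ℝ) := by exact_mod_cast Finset.card_biUnion_le
    _ ≤ ∑ k ∈ Finset.range K, η ^ (k + 1) * n.factorial := by
        refine Finset.sum_le_sum fun k hk => ?_
        exact card_perm_common_invariant_le_pow A B hδ hδ2 hs hs' hv hvn hA hB hsA hsB hsv hsv' hAB
          (k + 1) (by omega) ((hK _).2 (by simpa using hk))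
    _ = η * n.factorial * ∑ k ∈ Finset.range K, η ^ k := by
        rw [Finset.mul_sum]; refine Finset.sum_congr rfl fun k _ => by ring
    _ ≤ η * n.factorial * 2 := by
        refine mul_le_mul_of_nonneg_left ?_ (by positivity)
        rw [geom_sum_eq (by linarith), ← neg_div_neg_eq, div_le_iff₀ (by linarith)]
        have : 0 ≤ η ^ K := by positivity
        linarith
    _ = _ := by rw [hη]; ring

/-! ### Invariant partitions -/

lemma sum_prod_factorial_fiber {κ : Type*} [Fintype κ] [DecidableEq κ] (k : ℕ) :
    ∑ f : Fin k → κ, ∏ i, (Finset.univ.filter fun a => f a = i).card.factorial =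
      ∏ j ∈ Finset.range k, (j + Fintype.card κ) := by
  induction k with
  | zero => simp
  | succ k ih =>
    rw [Finset.prod_range_succ, ← ih, ← (Fin.consEquiv (fun _ => κ)).sum_comp,
      Fintype.sum_prod_type, Finset.sum_comm, Finset.sum_mul]
    refine Finset.sum_congr rfl fun f _ => ?_
    have h1 : ∀ a : κ, ∏ i, (Finset.univ.filter fun t =>
        (Fin.consEquiv (fun _ => κ)) (a, f) t = i).card.factorial =
        (∏ i, (Finset.univ.filter fun t => f t = i).card.factorial) *
          ((Finset.univ.filter fun t => f t = a).card + 1) := by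
      intro a
      have h2 : ∀ i, (Finset.univ.filter fun t =>
          (Fin.consEquiv (fun _ => κ)) (a, f) t = i).card.factorial =
          (Finset.univ.filter fun t => f t = i).card.factorial *
            (if a = i then (Finset.univ.filter fun t => f t = i).card + 1 else 1) := by
        intro i
        rw [Fin.card_filter_univ_succ]
        simp only [Fin.consEquiv, Equiv.coe_fn_mk, Fin.cons_zero, Fin.cons_succ]
        split_ifs with h
        · rw [Nat.factorial_succ, mul_comm]
        · simp
      rw [Finset.prod_congr rfl fun i _ => h2 i, Finset.prod_mul_distrib,
        Finset.prod_ite_eq Finset.univ a]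
      simp
    rw [Finset.sum_congr rfl fun a _ => h1 a, ← Finset.mul_sum, Finset.sum_add_distrib]
    congr 1
    have := Finset.card_eq_sum_card_fiberwise (s := (Finset.univ : Finset (Fin k))) (f := f)
      (t := Finset.univ) (by simp)
    simp only [Finset.card_univ, Fintype.card_fin] at this
    rw [← this]
    simp

open Classical in
/-- The generating function of the number of cycles is at most `(2 * m) ^ m` at `m`. -/
lemma sum_pow_card_cycles_le (m : ℕ) :
    ∑ ρ : Equiv.Perm (Fin m), m ^ Fintype.card (Quotient (Equiv.Perm.SameCycle.setoid ρ)) ≤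
      (2 * m) ^ m := by
  have h1 : ∀ ρ : Equiv.Perm (Fin m),
      m ^ Fintype.card (Quotient (Equiv.Perm.SameCycle.setoid ρ)) ≤
      (Finset.univ.filter fun f : Fin m → Fin m => f ∘ ρ = f).card := by
    intro ρ
    have : m ^ Fintype.card (Quotient (Equiv.Perm.SameCycle.setoid ρ)) =
        (Finset.univ : Finset (Quotient (Equiv.Perm.SameCycle.setoid ρ) → Fin m)).card := by
      rw [Finset.card_univ, Fintype.card_fun, Fintype.card_fin]
    rw [this]
    refine Finset.card_le_card_of_injOn (fun F x => F (Quotient.mk _ x)) ?_ ?_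
    · intro F _
      simp only [Finset.coe_filter, Finset.mem_univ, true_and, Set.mem_ofPred_eq]
      funext x
      simp only [Function.comp_apply]
      congr 1
      exact Quotient.sound (Equiv.Perm.SameCycle.symm (Equiv.Perm.sameCycle_apply_right.2
        (Equiv.Perm.SameCycle.refl _ _)))
    · intro F _ F' _ h
      funext q
      obtain ⟨x, rfl⟩ := Quotient.exists_rep q
      exact congrFun h x
  calc _ ≤ ∑ ρ : Equiv.Perm (Fin m),
        (Finset.univ.filter fun f : Fin m → Fin m => f ∘ ρ = f).card :=
        Finset.sum_le_sum fun ρ _ => h1 ρ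
    _ = ∑ f : Fin m → Fin m,
        (Finset.univ.filter fun ρ : Equiv.Perm (Fin m) => f ∘ ρ = f).card := by
        simp_rw [Finset.card_filter]; rw [Finset.sum_comm]
    _ ≤ ∑ f : Fin m → Fin m, ∏ i, (Finset.univ.filter fun a => f a = i).card.factorial :=
        Finset.sum_le_sum fun f _ => card_perm_comp_eq_le f f
    _ = ∏ j ∈ Finset.range m, (j + m) := by rw [sum_prod_factorial_fiber, Fintype.card_fin]
    _ ≤ ∏ j ∈ Finset.range m, (2 * m) := Finset.prod_le_prod' fun j hj => by
        have := Finset.mem_range.1 hj; omega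
    _ = _ := by simp

lemma Equiv.Perm.semiconj_zpow_apply {α κ : Type*} {A : Equiv.Perm α} {ρ : Equiv.Perm κ}
    {β : α → κ} (h : ∀ x, β (A x) = ρ (β x)) (i : ℤ) (x : α) : β ((A ^ i) x) = (ρ ^ i) (β x) := by
  induction i generalizing x with
  | zero => simp
  | succ i ih =>
    rw [add_comm, zpow_add, zpow_add, Equiv.Perm.mul_apply, Equiv.Perm.mul_apply, zpow_one,
      zpow_one, h, ih]
  | pred i ih =>
    rw [sub_eq_neg_add, zpow_add, zpow_add, Equiv.Perm.mul_apply, Equiv.Perm.mul_apply,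
      zpow_neg_one, zpow_neg_one, ← ih, Equiv.Perm.eq_inv_iff_eq, ← h]
    congr 1
    rw [← Equiv.Perm.mul_apply, mul_inv_cancel, Equiv.Perm.one_apply]

open Classical in
/-- A labelled partition into blocks of size `b`, compatible with `A`. -/
lemma card_cycles_le_mul {α κ : Type*} [Fintype α] [DecidableEq α] [Fintype κ] [DecidableEq κ]
    {A : Equiv.Perm α} {ρ : Equiv.Perm κ} {β : α → κ} (h : ∀ x, β (A x) = ρ (β x)) {b : ℕ}
    (hb : ∀ i, (Finset.univ.filter fun x => β x = i).card = b) :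
    Fintype.card (Quotient (Equiv.Perm.SameCycle.setoid A)) ≤
      b * Fintype.card (Quotient (Equiv.Perm.SameCycle.setoid ρ)) := by
  have hex : ∀ q : Quotient (Equiv.Perm.SameCycle.setoid A), ∃ x, Quotient.mk _ x = q ∧
      ∃ d : Quotient (Equiv.Perm.SameCycle.setoid ρ), β x = d.out := by
    intro q
    obtain ⟨y, rfl⟩ := Quotient.exists_rep q
    have h1 : ρ.SameCycle (β y)
        (Quotient.mk (Equiv.Perm.SameCycle.setoid ρ) (β y)).out :=
      Equiv.Perm.SameCycle.symm (Quotient.mk_out (s := Equiv.Perm.SameCycle.setoid ρ) (β y))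
    obtain ⟨i, hi⟩ := h1
    refine ⟨(A ^ i) y, Quotient.sound ?_, Quotient.mk _ (β y), ?_⟩
    · exact Equiv.Perm.SameCycle.symm ⟨i, rfl⟩
    · rw [Equiv.Perm.semiconj_zpow_apply h, hi]
  choose φ hφ hd using hex
  have hle : Fintype.card (Quotient (Equiv.Perm.SameCycle.setoid A)) ≤
      ((Finset.univ : Finset (Quotient (Equiv.Perm.SameCycle.setoid ρ))).biUnion
        fun d => Finset.univ.filter fun x => β x = d.out).card := by
    rw [← Finset.card_univ]
    refine Finset.card_le_card_of_injOn φ ?_ ?_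
    · intro q _
      obtain ⟨d, hd⟩ := hd q
      simp only [Finset.coe_biUnion, Set.mem_iUnion]
      exact ⟨d, by simp, by simpa using hd⟩
    · intro q _ q' _ hqq
      rw [← hφ q, ← hφ q', hqq]
  refine hle.trans ?_
  rw [mul_comm, ← Finset.card_univ (α := Quotient (Equiv.Perm.SameCycle.setoid ρ))]
  exact Finset.card_biUnion_le_card_mul _ _ _ fun d _ => (hb _).le

open Classical in
lemma card_semiconj_le {α κ : Type*} [Fintype α] [DecidableEq α] [Fintype κ] [DecidableEq κ]
    (A : Equiv.Perm α) (ρ : Equiv.Perm κ) :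
    (Finset.univ.filter fun β : α → κ => ∀ x, β (A x) = ρ (β x)).card ≤
      Fintype.card κ ^ Fintype.card (Quotient (Equiv.Perm.SameCycle.setoid A)) := by
  rw [← Fintype.card_fun, ← Finset.card_univ]
  refine Finset.card_le_card_of_injOn (fun β q => β q.out) (fun _ _ => Finset.mem_univ _) ?_
  intro β hβ β' hβ' hh
  simp only [Finset.coe_filter, Finset.mem_univ, true_and, Set.mem_ofPred_eq] at hβ hβ'
  funext y
  obtain ⟨i, hi⟩ : A.SameCycle (Quotient.mk (Equiv.Perm.SameCycle.setoid A) y).out y :=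
    Quotient.mk_out (s := Equiv.Perm.SameCycle.setoid A) y
  have := congrFun hh (Quotient.mk (Equiv.Perm.SameCycle.setoid A) y)
  simp only at this
  rw [← hi, Equiv.Perm.semiconj_zpow_apply hβ, Equiv.Perm.semiconj_zpow_apply hβ', this]

open Classical in
/-- The number of labelled partitions into `m` blocks of size `b` compatible with `A`. -/
lemma card_block_labellings_le {α : Type*} [Fintype α] [DecidableEq α]
    (A : Equiv.Perm α) {b m q : ℕ}
    (hq : ∀ D, Fintype.card (Quotient (Equiv.Perm.SameCycle.setoid A)) ≤ b * D → q ≤ D)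
    (hm : 0 < m)
    (hqN : q ≤ Fintype.card (Quotient (Equiv.Perm.SameCycle.setoid A))) :
    (Finset.univ.filter fun β : α → Fin m =>
      (∀ i, (Finset.univ.filter fun x => β x = i).card = b) ∧
        ∃ ρ : Equiv.Perm (Fin m), ∀ x, β (A x) = ρ (β x)).card ≤
      m ^ (Fintype.card (Quotient (Equiv.Perm.SameCycle.setoid A)) - q) * (2 * m) ^ m := by
  set N := Fintype.card (Quotient (Equiv.Perm.SameCycle.setoid A))
  let S : Equiv.Perm (Fin m) → Finset (α → Fin m) := fun ρ => Finset.univ.filter fun β =>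
    (∀ i, (Finset.univ.filter fun x => β x = i).card = b) ∧ ∀ x, β (A x) = ρ (β x)
  have h1 : ∀ ρ, (S ρ).card ≤
      m ^ (N - q) * m ^ Fintype.card (Quotient (Equiv.Perm.SameCycle.setoid ρ)) := by
    intro ρ
    rcases Finset.eq_empty_or_nonempty (S ρ) with h0 | ⟨β, hβ⟩
    · rw [h0]; simp
    · have hβ := (Finset.mem_filter.1 hβ).2
      have h2 := hq _ (card_cycles_le_mul hβ.2 hβ.1)
      calc (S ρ).card ≤ (Finset.univ.filter fun β : α → Fin m => ∀ x, β (A x) = ρ (β x)).card :=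
            Finset.card_le_card fun β hβ => by
              simp only [S, Finset.mem_filter] at hβ ⊢; exact ⟨hβ.1, hβ.2.2⟩
        _ ≤ m ^ N := by simpa using card_semiconj_le A ρ
        _ = m ^ (N - q) * m ^ q := by rw [← pow_add, Nat.sub_add_cancel hqN]
        _ ≤ _ := Nat.mul_le_mul_left _ (Nat.pow_le_pow_right hm h2)
  calc _ ≤ ((Finset.univ : Finset (Equiv.Perm (Fin m))).biUnion S).card := by
        refine Finset.card_le_card fun β hβ => ?_
        simp only [Finset.mem_filter, Finset.mem_univ, true_and] at hβ
        obtain ⟨hb, ρ, hρ⟩ := hβ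
        exact Finset.mem_biUnion.2 ⟨ρ, Finset.mem_univ _, by simp [S]; exact ⟨hb, hρ⟩⟩
    _ ≤ ∑ ρ, (S ρ).card := Finset.card_biUnion_le
    _ ≤ ∑ ρ : Equiv.Perm (Fin m),
        m ^ (N - q) * m ^ Fintype.card (Quotient (Equiv.Perm.SameCycle.setoid ρ)) :=
        Finset.sum_le_sum fun ρ _ => h1 ρ
    _ ≤ _ := by rw [← Finset.mul_sum]; exact Nat.mul_le_mul_left _ (sum_pow_card_cycles_le m)

open Classical in
lemma exists_labelling_of_setoid {α : Type*} [Fintype α] [DecidableEq α] {b m : ℕ} (hb : 0 < b)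
    (hbm : b * m = Fintype.card α) (r : Setoid α)
    (hr : ∀ x, (Finset.univ.filter fun y => r x y).card = b) :
    ∃ β : α → Fin m, Function.Surjective β ∧
      (∀ i, (Finset.univ.filter fun x => β x = i).card = b) ∧
      ∀ A : Equiv.Perm α, (∀ x y, r x y → r (A x) (A y)) →
        ∃ ρ : Equiv.Perm (Fin m), ∀ x, β (A x) = ρ (β x) := by
  have hfib : ∀ q : Quotient r, (Finset.univ.filter fun x => Quotient.mk r x = q).card = b := by
    intro q
    obtain ⟨x, rfl⟩ := Quotient.exists_rep q
    rw [← hr x]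
    congr 1
    ext y
    simp only [Finset.mem_filter, Finset.mem_univ, true_and]
    rw [Quotient.eq]
    exact ⟨fun h => r.symm' h, fun h => r.symm' h⟩
  have hcard : Fintype.card (Quotient r) = Fintype.card (Fin m) := by
    have := Finset.card_eq_sum_card_fiberwise (s := (Finset.univ : Finset α))
      (f := Quotient.mk r) (t := Finset.univ) (by simp)
    rw [Finset.sum_congr rfl fun q _ => hfib q] at this
    simp only [Finset.card_univ, Finset.sum_const, smul_eq_mul] at this
    rw [← hbm, mul_comm] at this
    rw [Fintype.card_fin]
    exact (Nat.eq_of_mul_eq_mul_right hb this).symm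
  let e := Fintype.equivOfCardEq hcard
  refine ⟨fun x => e (Quotient.mk r x), e.surjective.comp Quotient.mk_surjective, ?_, ?_⟩
  · intro i
    rw [← hfib (e.symm i)]
    congr 1
    ext x
    simp [Equiv.eq_symm_apply]
  · intro A hA
    let f : Quotient r → Quotient r := Quotient.map A fun x y h => hA x y h
    have hf : Function.Surjective f := by
      intro q
      obtain ⟨x, rfl⟩ := Quotient.exists_rep q
      exact ⟨Quotient.mk r (A⁻¹ x), by simp [f, Quotient.map_mk]⟩
    let ρ := Equiv.ofBijective f (Finite.injective_iff_bijective.1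
      (Finite.injective_iff_surjective.2 hf))
    refine ⟨e.permCongr ρ, fun x => ?_⟩
    simp only [Equiv.permCongr_apply, Equiv.symm_apply_apply]
    rfl

open Classical in
lemma card_perm_common_blocks_mul_le {α : Type*} [Fintype α] [DecidableEq α]
    (A B : Equiv.Perm α) {b m : ℕ} (hb : 0 < b) (hbm : b * m = Fintype.card α) :
    (Finset.univ.filter fun τ : Equiv.Perm α => ∃ r : Setoid α,
        (∀ x, (Finset.univ.filter fun y => r x y).card = b) ∧
        (∀ x y, r x y → r (A x) (A y)) ∧
        ∀ x y, r x y → r ((τ * B * τ⁻¹) x) ((τ * B * τ⁻¹) y)).card * m.factorial ≤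
      (Finset.univ.filter fun β : α → Fin m =>
        (∀ i, (Finset.univ.filter fun x => β x = i).card = b) ∧
          ∃ ρ : Equiv.Perm (Fin m), ∀ x, β (A x) = ρ (β x)).card *
      (Finset.univ.filter fun β : α → Fin m =>
        (∀ i, (Finset.univ.filter fun x => β x = i).card = b) ∧
          ∃ ρ : Equiv.Perm (Fin m), ∀ x, β (B x) = ρ (β x)).card * b.factorial ^ m := by
  set T := (Finset.univ.filter fun τ : Equiv.Perm α => ∃ r : Setoid α,
        (∀ x, (Finset.univ.filter fun y => r x y).card = b) ∧
        (∀ x y, r x y → r (A x) (A y)) ∧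
        ∀ x y, r x y → r ((τ * B * τ⁻¹) x) ((τ * B * τ⁻¹) y))
  set LA := (Finset.univ.filter fun β : α → Fin m =>
        (∀ i, (Finset.univ.filter fun x => β x = i).card = b) ∧
          ∃ ρ : Equiv.Perm (Fin m), ∀ x, β (A x) = ρ (β x))
  set LB := (Finset.univ.filter fun β : α → Fin m =>
        (∀ i, (Finset.univ.filter fun x => β x = i).card = b) ∧
          ∃ ρ : Equiv.Perm (Fin m), ∀ x, β (B x) = ρ (β x))
  have hlow : ∀ τ ∈ T, m.factorial ≤ (LA.filter fun β => β ∘ τ ∈ LB).card := by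
    intro τ hτ
    obtain ⟨r, hr, hrA, hrB⟩ := (Finset.mem_filter.1 hτ).2
    obtain ⟨β, hsurj, hβ, hρ⟩ := exists_labelling_of_setoid hb hbm r hr
    obtain ⟨ρA, hρA⟩ := hρ A hrA
    obtain ⟨ρB, hρB⟩ := hρ _ hrB
    have : m.factorial = (Finset.univ : Finset (Equiv.Perm (Fin m))).card := by
      rw [Finset.card_univ, Fintype.card_perm, Fintype.card_fin]
    rw [this]
    refine Finset.card_le_card_of_injOn (fun θ => θ ∘ β) ?_ ?_
    · intro θ _
      have hfib : ∀ i, (Finset.univ.filter fun x => (θ ∘ β) x = i).card = b := by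
        intro i
        rw [← hβ (θ⁻¹ i)]
        congr 1
        ext x
        simp [Equiv.eq_symm_apply]
      simp only [Finset.coe_filter, Set.mem_ofPred_eq, LA, LB, Finset.mem_filter, Finset.mem_univ,
        true_and]
      refine ⟨⟨hfib, θ * ρA * θ⁻¹, fun x => ?_⟩, ⟨fun i => ?_, θ * ρB * θ⁻¹, fun x => ?_⟩⟩
      · simp [hρA]
      · rw [← hfib i]
        refine Finset.card_bij (fun x _ => τ x) ?_ ?_ ?_
        · intro x hx; simpa using hx
        · intro x _ y _ h; exact τ.injective h
        · intro y hy; exact ⟨τ⁻¹ y, by simpa using hy, by simp⟩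
      · have := hρB (τ x)
        simp only [Equiv.Perm.mul_apply, Equiv.Perm.inv_def, Equiv.symm_apply_apply] at this
        simp [this]
    · intro θ _ θ' _ h
      ext i
      obtain ⟨x, rfl⟩ := hsurj i
      exact congrArg Fin.val (congrFun h x)
  have hup : ∀ β ∈ LA,
      (T.filter fun τ : Equiv.Perm α => β ∘ τ ∈ LB).card ≤ LB.card * b.factorial ^ m := by
    intro β hβ
    calc _ ≤ (LB.biUnion fun β' => Finset.univ.filter fun τ : Equiv.Perm α => β ∘ τ = β').card := by
          refine Finset.card_le_card fun τ hτ => ?_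
          have := (Finset.mem_filter.1 hτ).2
          exact Finset.mem_biUnion.2 ⟨_, this, by simp⟩
      _ ≤ LB.card * b.factorial ^ m := by
          refine Finset.card_biUnion_le_card_mul _ _ _ fun β' _ => ?_
          refine (card_perm_comp_eq_le β β').trans (le_of_eq ?_)
          rw [Finset.prod_congr rfl fun i _ => by rw [(Finset.mem_filter.1 hβ).2.1 i]]
          simp
  calc T.card * m.factorial ≤ ∑ τ ∈ T, (LA.filter fun β => β ∘ τ ∈ LB).card := by
        rw [← smul_eq_mul]; exact Finset.card_nsmul_le_sum _ _ _ hlow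
    _ = ∑ β ∈ LA, (T.filter fun τ : Equiv.Perm α => β ∘ τ ∈ LB).card := by
        simp_rw [Finset.card_filter]; rw [Finset.sum_comm]
    _ ≤ LA.card * (LB.card * b.factorial ^ m) := by
        rw [← smul_eq_mul]; exact Finset.sum_le_card_nsmul _ _ _ hup
    _ = _ := by ring

lemma pow_self_le_three_pow_mul_factorial (n : ℕ) : n ^ n ≤ 3 ^ n * n.factorial := by
  have h := Real.pow_div_factorial_le_exp (n : ℝ) (Nat.cast_nonneg n) n
  rw [div_le_iff₀ (by positivity)] at h
  have h2 : Real.exp n ≤ 3 ^ n := by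
    rw [← Real.exp_one_pow]
    exact pow_le_pow_left₀ (Real.exp_pos _).le Real.exp_one_lt_three.le _
  have h3 : (n : ℝ) ^ n ≤ 3 ^ n * n.factorial :=
    h.trans (mul_le_mul_of_nonneg_right h2 (by positivity))
  exact_mod_cast h3

lemma block_count_arith {T b m n e : ℕ} (hb : 2 ≤ b) (hm : 24 ^ 16 ≤ m) (hbm : b * m = n)
    (he : 16 * (e + m) ≤ 15 * n)
    (h : T * m.factorial ≤ m ^ e * (2 * m) ^ m * (2 * m) ^ m * b.factorial ^ m) :
    T * 2 ^ n ≤ n.factorial := by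
  have hm0 : 0 < m := by omega
  have h1 : b.factorial ^ m ≤ b ^ n := by
    rw [← hbm, pow_mul]
    exact Nat.pow_le_pow_left (Nat.factorial_le_pow b) _
  have h2 : b ^ n * m ^ n ≤ 3 ^ n * n.factorial := by
    rw [← mul_pow, hbm]; exact pow_self_le_three_pow_mul_factorial n
  have h3 := pow_self_le_three_pow_mul_factorial m
  have hmn : 2 * m ≤ n := by rw [← hbm]; exact Nat.mul_le_mul_right _ hb
  have h4 : m.factorial * (T * m ^ n) ≤
      m.factorial * (m ^ (e + m) * (12 ^ m * 3 ^ n * n.factorial)) :=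
    calc m.factorial * (T * m ^ n) = T * m.factorial * m ^ n := by ring
      _ ≤ m ^ e * (2 * m) ^ m * (2 * m) ^ m * b ^ n * m ^ n :=
        Nat.mul_le_mul_right _ (h.trans (Nat.mul_le_mul_left _ h1))
      _ = m ^ (e + m) * (2 ^ m * 2 ^ m) * m ^ m * (b ^ n * m ^ n) := by
        rw [mul_pow, pow_add]; ring
      _ ≤ m ^ (e + m) * (2 ^ m * 2 ^ m) * (3 ^ m * m.factorial) * (3 ^ n * n.factorial) :=
        Nat.mul_le_mul (Nat.mul_le_mul_left _ h3) h2
      _ = m.factorial * (m ^ (e + m) * ((2 * 2 * 3) ^ m * 3 ^ n * n.factorial)) := by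
        rw [mul_pow, mul_pow]; ring
      _ = _ := by norm_num
  have h5 := Nat.le_of_mul_le_mul_left h4 (Nat.factorial_pos m)
  obtain ⟨d, hd⟩ : ∃ d, n = (e + m) + d := ⟨n - (e + m), by omega⟩
  have h6 : T * m ^ d ≤ 12 ^ m * 3 ^ n * n.factorial := by
    refine Nat.le_of_mul_le_mul_left (?_ : m ^ (e + m) * _ ≤ m ^ (e + m) * _) (by positivity)
    calc m ^ (e + m) * (T * m ^ d) = T * m ^ n := by rw [hd, pow_add]; ring
      _ ≤ _ := h5
  have h7 : 24 ^ n ≤ m ^ d :=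
    calc 24 ^ n ≤ 24 ^ (16 * d) := Nat.pow_le_pow_right (by norm_num) (by omega)
      _ = (24 ^ 16) ^ d := by rw [pow_mul]
      _ ≤ m ^ d := Nat.pow_le_pow_left hm _
  have h8 : 12 ^ m * 3 ^ n ≤ 12 ^ n :=
    calc 12 ^ m * 3 ^ n ≤ 16 ^ m * 3 ^ n :=
          Nat.mul_le_mul_right _ (Nat.pow_le_pow_left (by norm_num) _)
      _ = 4 ^ (2 * m) * 3 ^ n := by rw [pow_mul]; norm_num
      _ ≤ 4 ^ n * 3 ^ n := Nat.mul_le_mul_right _ (Nat.pow_le_pow_right (by norm_num) hmn)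
      _ = 12 ^ n := by rw [← mul_pow]; norm_num
  refine Nat.le_of_mul_le_mul_left (?_ : 12 ^ n * _ ≤ 12 ^ n * _) (by positivity)
  calc 12 ^ n * (T * 2 ^ n) = T * (12 * 2) ^ n := by rw [mul_pow]; ring
    _ = T * 24 ^ n := by norm_num
    _ ≤ T * m ^ d := Nat.mul_le_mul_left _ h7
    _ ≤ _ := h6
    _ ≤ _ := Nat.mul_le_mul_right _ h8

open Classical in
/-- Random conjugates rarely preserve a common partition into many blocks of equal size. -/
lemma card_perm_common_blocks_le {α : Type*} [Fintype α] [DecidableEq α] (A B : Equiv.Perm α)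
    (hN : 8 * (Fintype.card (Quotient (Equiv.Perm.SameCycle.setoid A)) +
      Fintype.card (Quotient (Equiv.Perm.SameCycle.setoid B))) ≤ 7 * Fintype.card α) :
    (Finset.univ.filter fun τ : Equiv.Perm α => ∃ b m : ℕ, 2 ≤ b ∧ 24 ^ 16 ≤ m ∧
        b * m = Fintype.card α ∧ ∃ r : Setoid α,
        (∀ x, (Finset.univ.filter fun y => r x y).card = b) ∧
        (∀ x y, r x y → r (A x) (A y)) ∧
        ∀ x y, r x y → r ((τ * B * τ⁻¹) x) ((τ * B * τ⁻¹) y)).card * 2 ^ Fintype.card α ≤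
      (Fintype.card α + 1) * (Fintype.card α).factorial := by
  set n := Fintype.card α
  set N := Fintype.card (Quotient (Equiv.Perm.SameCycle.setoid A))
  set N' := Fintype.card (Quotient (Equiv.Perm.SameCycle.setoid B))
  let S : ℕ → Finset (Equiv.Perm α) := fun b => Finset.univ.filter fun τ => ∃ m : ℕ, 2 ≤ b ∧
    24 ^ 16 ≤ m ∧ b * m = n ∧ ∃ r : Setoid α,
        (∀ x, (Finset.univ.filter fun y => r x y).card = b) ∧
        (∀ x y, r x y → r (A x) (A y)) ∧
        ∀ x y, r x y → r ((τ * B * τ⁻¹) x) ((τ * B * τ⁻¹) y)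
  have hS : ∀ b, (S b).card * 2 ^ n ≤ n.factorial := by
    intro b
    by_cases hbm : ∃ m, 2 ≤ b ∧ 24 ^ 16 ≤ m ∧ b * m = n
    · obtain ⟨m, hb, hm, hbm⟩ := hbm
      have hb0 : 0 < b := by omega
      have hm0 : 0 < m := by omega
      have hceil : ∀ N : ℕ, (∀ D, N ≤ b * D → (N + b - 1) / b ≤ D) ∧ (N + b - 1) / b ≤ N ∧
          N ≤ b * ((N + b - 1) / b) := by
        intro N
        refine ⟨fun D hD => ?_, ?_, ?_⟩
        · rw [Nat.div_le_iff_le_mul_add_pred hb0]; omega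
        · rw [Nat.div_le_iff_le_mul_add_pred hb0]
          have : N ≤ b * N := Nat.le_mul_of_pos_left _ hb0
          omega
        · have := Nat.div_add_mod (N + b - 1) b
          have := Nat.mod_lt (N + b - 1) hb0
          omega
      obtain ⟨a1, a2, a3⟩ := hceil N
      obtain ⟨b1, b2, b3⟩ := hceil N'
      set q := (N + b - 1) / b
      set q' := (N' + b - 1) / b
      refine block_count_arith (e := (N - q) + (N' - q')) hb hm hbm ?_ ?_
      · obtain ⟨e1, he1⟩ : ∃ e, N = q + e := ⟨N - q, by omega⟩
        obtain ⟨e2, he2⟩ : ∃ e, N' = q' + e := ⟨N' - q', by omega⟩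
        rw [show N - q = e1 by omega, show N' - q' = e2 by omega]
        have h16 : b * (16 * (e1 + e2 + m)) ≤ b * (15 * n) := by
          have hn : n = b * m := hbm.symm
          obtain ⟨c, rfl⟩ : ∃ c, b = c + 2 := ⟨b - 2, by omega⟩
          nlinarith
        exact Nat.le_of_mul_le_mul_left h16 hb0
      · have h0 : (S b).card ≤ (Finset.univ.filter fun τ : Equiv.Perm α => ∃ r : Setoid α,
            (∀ x, (Finset.univ.filter fun y => r x y).card = b) ∧
            (∀ x y, r x y → r (A x) (A y)) ∧
            ∀ x y, r x y → r ((τ * B * τ⁻¹) x) ((τ * B * τ⁻¹) y)).card := by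
          refine Finset.card_le_card fun τ hτ => ?_
          obtain ⟨_, _, _, _, hr⟩ := (Finset.mem_filter.1 hτ).2
          exact Finset.mem_filter.2 ⟨Finset.mem_univ _, hr⟩
        refine (Nat.mul_le_mul_right _ h0).trans
          ((card_perm_common_blocks_mul_le A B hb0 hbm).trans ?_)
        have hA := card_block_labellings_le A (b := b) a1 hm0 a2
        have hB := card_block_labellings_le B (b := b) b1 hm0 b2
        refine (Nat.mul_le_mul_right _ (Nat.mul_le_mul hA hB)).trans (le_of_eq ?_)
        rw [pow_add]; ring
    · have : S b = ∅ := by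
        refine Finset.filter_eq_empty_iff.2 fun τ _ h => hbm ?_
        obtain ⟨m, h1, h2, h3, _⟩ := h
        exact ⟨m, h1, h2, h3⟩
      rw [this]; simp
  have hsub : (Finset.univ.filter fun τ : Equiv.Perm α => ∃ b m : ℕ, 2 ≤ b ∧ 24 ^ 16 ≤ m ∧
        b * m = n ∧ ∃ r : Setoid α,
        (∀ x, (Finset.univ.filter fun y => r x y).card = b) ∧
        (∀ x y, r x y → r (A x) (A y)) ∧
        ∀ x y, r x y → r ((τ * B * τ⁻¹) x) ((τ * B * τ⁻¹) y)).card ≤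
      ∑ b ∈ Finset.range (n + 1), (S b).card := by
    refine le_trans (Finset.card_le_card fun τ hτ => ?_) Finset.card_biUnion_le
    obtain ⟨b, m, h1, h2, h3, h4⟩ := (Finset.mem_filter.1 hτ).2
    refine Finset.mem_biUnion.2 ⟨b, ?_, Finset.mem_filter.2 ⟨Finset.mem_univ _, m, h1, h2, h3, h4⟩⟩
    rw [Finset.mem_range, ← h3]
    have : b ≤ b * m := Nat.le_mul_of_pos_right _ (by omega)
    omega
  refine (Nat.mul_le_mul_right _ hsub).trans ?_
  rw [Finset.sum_mul]
  refine (Finset.sum_le_card_nsmul _ _ _ fun b _ => hS b).trans ?_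
  simp

/-! ### Alternating walks -/

open Classical in
/-- Double counting along the map `τ ↦ swap (z τ) p * τ`. -/
lemma sum_le_of_swap_mul {α : Type*} [Fintype α] [DecidableEq α]
    (z : Equiv.Perm α → α) (K T : Equiv.Perm α → Finset α) (M M' : Finset (Equiv.Perm α))
    (w : Equiv.Perm α → ℝ) (hw : ∀ τ, 0 ≤ w τ) {c k : ℝ}
    (h : ∀ τ ∈ M', ∀ p ∉ K τ, Equiv.swap (z τ) p * τ ∈ M ∧ z (Equiv.swap (z τ) p * τ) = z τ ∧
      p ∈ T (Equiv.swap (z τ) p * τ) ∧ w τ ≤ w (Equiv.swap (z τ) p * τ))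
    (hT : ∀ τ ∈ M, ((T τ).card : ℝ) ≤ c) (hK : ∀ τ ∈ M', ((K τ).card : ℝ) ≤ k) :
    ((Fintype.card α : ℝ) - k) * ∑ τ ∈ M', w τ ≤ c * ∑ τ ∈ M, w τ := by
  calc ((Fintype.card α : ℝ) - k) * ∑ τ ∈ M', w τ
      ≤ ∑ τ ∈ M', ∑ p ∈ (K τ)ᶜ, w τ := by
        rw [Finset.mul_sum]
        refine Finset.sum_le_sum fun τ hτ => ?_
        rw [Finset.sum_const, nsmul_eq_mul, Finset.card_compl,
          Nat.cast_sub (Finset.card_le_univ _)]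
        exact mul_le_mul_of_nonneg_right (by linarith [hK τ hτ]) (hw τ)
    _ = ∑ x ∈ M'.sigma fun τ => (K τ)ᶜ, w x.1 := by rw [Finset.sum_sigma]
    _ ≤ ∑ x ∈ M'.sigma fun τ => (K τ)ᶜ, w (Equiv.swap (z x.1) x.2 * x.1) := by
        refine Finset.sum_le_sum fun x hx => ?_
        rw [Finset.mem_sigma, Finset.mem_compl] at hx
        exact (h _ hx.1 _ hx.2).2.2.2
    _ = ∑ y ∈ (M'.sigma fun τ => (K τ)ᶜ).image
          (fun x => (⟨Equiv.swap (z x.1) x.2 * x.1, x.2⟩ : (_ : Equiv.Perm α) × α)), w y.1 := by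
        rw [Finset.sum_image]
        rintro ⟨τ, p⟩ hx ⟨τ', p'⟩ hx' heq
        simp only [Finset.coe_sigma, Set.mem_sigma_iff, Finset.mem_coe, Finset.mem_compl] at hx hx'
        simp only [Sigma.mk.injEq, heq_eq_eq] at heq
        obtain ⟨h1, rfl⟩ := heq
        have h2 : z τ = z τ' := by
          rw [← (h _ hx.1 _ hx.2).2.1, ← (h _ hx'.1 _ hx'.2).2.1, h1]
        rw [h2] at h1
        rw [mul_left_cancel h1]
    _ ≤ ∑ y ∈ M.sigma T, w y.1 := by
        refine Finset.sum_le_sum_of_subset_of_nonneg ?_ fun _ _ _ => hw _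
        intro y hy
        obtain ⟨x, hx, rfl⟩ := Finset.mem_image.1 hy
        rw [Finset.mem_sigma, Finset.mem_compl] at hx
        have := h _ hx.1 _ hx.2
        exact Finset.mem_sigma.2 ⟨this.1, this.2.2.1⟩
    _ = ∑ τ ∈ M, ((T τ).card : ℝ) * w τ := by
        rw [Finset.sum_sigma]
        simp
    _ ≤ _ := by
        rw [Finset.mul_sum]
        exact Finset.sum_le_sum fun τ hτ => mul_le_mul_of_nonneg_right (hT τ hτ) (hw τ)

namespace AltWalk

variable {α : Type*}

/-- `B` or its inverse, according to a sign. -/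
def sgnPow (B : Equiv.Perm α) (e : Bool) : Equiv.Perm α := if e then B else B⁻¹

/-- Position of the walk before its `j`-th pair of steps; each pair applies `B^{±1}`, then `A`. -/
def ev (A B : Equiv.Perm α) (s : ℕ → Bool) : ℕ → α → α
  | 0, u => u
  | j + 1, u => A (sgnPow B (s j) (ev A B s j u))

/-- Position of the walk in the middle of its `j`-th pair of steps. -/
def od (A B : Equiv.Perm α) (s : ℕ → Bool) (j : ℕ) (u : α) : α :=
  sgnPow B (s j) (ev A B s j u)

/-- The point two `B`-steps away from `ev j`. -/
def nx (A B : Equiv.Perm α) (s : ℕ → Bool) (j : ℕ) (u : α) : α :=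
  sgnPow B (s j) (od A B s j u)

lemma ev_succ (A B : Equiv.Perm α) (s : ℕ → Bool) (j : ℕ) (u : α) :
    ev A B s (j + 1) u = A (od A B s j u) := rfl

lemma sgnPow_not_apply (B : Equiv.Perm α) (e : Bool) (x : α) :
    sgnPow B (!e) (sgnPow B e x) = x := by
  cases e <;> simp [sgnPow]

lemma sgnPow_conj (B σ : Equiv.Perm α) (e : Bool) (x : α) :
    sgnPow (σ * B * σ⁻¹) e (σ x) = σ (sgnPow B e x) := by
  cases e <;> simp [sgnPow, mul_assoc]

lemma sgnPow_eq_self_iff (B : Equiv.Perm α) (e : Bool) (x : α) : sgnPow B e x = x ↔ B x = x := by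
  cases e
  · simp only [sgnPow, Bool.false_eq_true, if_false]
    rw [Equiv.Perm.inv_eq_iff_eq, eq_comm]
  · simp [sgnPow]

lemma sgnPow_sgnPow_eq_self_iff (B : Equiv.Perm α) (e : Bool) (x : α) :
    sgnPow B e (sgnPow B e x) = x ↔ B (B x) = x := by
  cases e
  · simp only [sgnPow, Bool.false_eq_true, if_false]
    rw [Equiv.Perm.inv_eq_iff_eq, Equiv.Perm.inv_eq_iff_eq, eq_comm]
  · simp [sgnPow]

lemma ev_injective (A B : Equiv.Perm α) (s : ℕ → Bool) (j : ℕ) :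
    Function.Injective (ev A B s j) := by
  induction j with
  | zero => exact fun _ _ h => h
  | succ j ih => exact fun x y h => ih ((sgnPow B (s j)).injective (A.injective h))

lemma od_injective (A B : Equiv.Perm α) (s : ℕ → Bool) (j : ℕ) :
    Function.Injective (od A B s j) :=
  (sgnPow B (s j)).injective.comp (ev_injective A B s j)

lemma exists_mem_ev_eq (G : Subgroup (Equiv.Perm α)) {A B : Equiv.Perm α} (hA : A ∈ G)
    (hB : B ∈ G) (s : ℕ → Bool) (j : ℕ) : ∃ g ∈ G, ∀ u, ev A B s j u = g u := by
  induction j with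
  | zero => exact ⟨1, G.one_mem, fun u => rfl⟩
  | succ j ih =>
    obtain ⟨g, hg, h⟩ := ih
    refine ⟨A * (sgnPow B (s j) * g), G.mul_mem hA (G.mul_mem ?_ hg), fun u => ?_⟩
    · cases s j
      · exact G.inv_mem hB
      · exact hB
    · simp [ev, h]

lemma eq_conj_iff {σ : Equiv.Perm α} {x y : α} (hy : σ y = y) : σ x = y ↔ x = y :=
  ⟨fun h => σ.injective (h.trans hy.symm), fun h => by rw [h, hy]⟩

lemma mem_conj_iff {σ : Equiv.Perm α} {F : Finset α} (hσ : ∀ y ∈ F, σ y = y) {x : α} :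
    σ x ∈ F ↔ x ∈ F :=
  ⟨fun h => by rwa [σ.injective (hσ _ h)] at h, fun h => by rwa [hσ _ h]⟩

variable [DecidableEq α]

/-- The points visited strictly before `ev j`. -/
def hist (A B : Equiv.Perm α) (s : ℕ → Bool) (j : ℕ) (u : α) : Finset α :=
  (Finset.range j).image (fun i => ev A B s i u) ∪ (Finset.range j).image (fun i => od A B s i u)

lemma mem_hist {A B : Equiv.Perm α} {s : ℕ → Bool} {j : ℕ} {u y : α} :
    y ∈ hist A B s j u ↔ ∃ i < j, ev A B s i u = y ∨ od A B s i u = y := by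
  simp only [hist, Finset.mem_union, Finset.mem_image, Finset.mem_range]
  constructor
  · rintro (⟨i, hi, h⟩ | ⟨i, hi, h⟩)
    · exact ⟨i, hi, Or.inl h⟩
    · exact ⟨i, hi, Or.inr h⟩
  · rintro ⟨i, hi, h | h⟩
    · exact Or.inl ⟨i, hi, h⟩
    · exact Or.inr ⟨i, hi, h⟩

lemma hist_mono (A B : Equiv.Perm α) (s : ℕ → Bool) {i j : ℕ} (h : i ≤ j) (u : α) :
    hist A B s i u ⊆ hist A B s j u := by
  intro y hy
  obtain ⟨k, hk, h'⟩ := mem_hist.1 hy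
  exact mem_hist.2 ⟨k, hk.trans_le h, h'⟩

lemma card_hist_le (A B : Equiv.Perm α) (s : ℕ → Bool) (j : ℕ) (u : α) :
    (hist A B s j u).card ≤ 2 * j := by
  refine (Finset.card_union_le _ _).trans ?_
  have h1 := Finset.card_image_le (s := Finset.range j) (f := fun i => ev A B s i u)
  have h2 := Finset.card_image_le (s := Finset.range j) (f := fun i => od A B s i u)
  rw [Finset.card_range] at h1 h2
  omega

/-- The first `j` pairs of steps are taken without meeting visited points. -/
def clean (A B : Equiv.Perm α) (s : ℕ → Bool) : ℕ → α → Prop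
  | 0, _ => True
  | j + 1, u => clean A B s j u ∧
      (od A B s j u ∉ hist A B s j u ∧ od A B s j u ≠ ev A B s j u) ∧
      (ev A B s (j + 1) u ∉ hist A B s j u ∧ ev A B s (j + 1) u ≠ ev A B s j u ∧
        ev A B s (j + 1) u ≠ od A B s j u) ∧
      (∀ i < j, nx A B s i u ≠ ev A B s j u ∧ nx A B s i u ≠ od A B s j u) ∧
      nx A B s j u ∉ hist A B s j u

open Classical in
/-- The number of steps that stay inside a cycle of `B` of length at most `2`. -/
noncomputable def numShort (A B : Equiv.Perm α) (s : ℕ → Bool) (j : ℕ) (u : α) : ℕ :=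
  ((Finset.range j).filter fun i => nx A B s i u = ev A B s i u).card

/-- The walk from `u` avoids the points visited by the walk from `v`. -/
def cross (A B : Equiv.Perm α) (s : ℕ → Bool) (l : ℕ) (u v : α) : Prop :=
  ∀ d < l, ev A B s d u ∉ hist A B s l v ∧ nx A B s d u ∉ hist A B s l v

variable {A B : Equiv.Perm α} {s : ℕ → Bool}

lemma clean.mono {i j : ℕ} (h : i ≤ j) {u : α} (hc : clean A B s j u) : clean A B s i u := by
  induction j with
  | zero => rw [Nat.le_zero.1 h]; exact hc
  | succ j ih =>
    rcases Nat.lt_or_ge j i with h1 | h1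
    · rw [show i = j + 1 by omega]; exact hc
    · exact ih h1 hc.1

lemma clean.ev_notMem_hist {j : ℕ} {u : α} (hc : clean A B s j u) :
    ev A B s j u ∉ hist A B s j u := by
  cases j with
  | zero => simp [hist]
  | succ j =>
    obtain ⟨-, -, ⟨h1, h2, h3⟩, -⟩ := hc
    intro hm
    obtain ⟨i, hi, h⟩ := mem_hist.1 hm
    rcases Nat.lt_succ_iff_lt_or_eq.1 hi with hi | rfl
    · exact h1 (mem_hist.2 ⟨i, hi, h⟩)
    · rcases h with h | h
      · exact h2 h.symm
      · exact h3 h.symm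

lemma clean.nx_notMem_hist {j d : ℕ} {u : α} (hc : clean A B s j u) (hd : d < j)
    (hne : nx A B s d u ≠ ev A B s d u) : nx A B s d u ∉ hist A B s j u := by
  induction j with
  | zero => omega
  | succ j ih =>
    intro hm
    obtain ⟨i, hi, h⟩ := mem_hist.1 hm
    obtain ⟨hc', ⟨-, h2⟩, -, h4, h5⟩ := hc
    have hnod : nx A B s j u ≠ od A B s j u := fun h' =>
      h2 ((sgnPow B (s j)).injective h')
    rcases Nat.lt_succ_iff_lt_or_eq.1 hi with hi | rfl
    · rcases Nat.lt_succ_iff_lt_or_eq.1 hd with hd | rfl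
      · exact ih hc' hd (mem_hist.2 ⟨i, hi, h⟩)
      · exact h5 (mem_hist.2 ⟨i, hi, h⟩)
    · rcases Nat.lt_succ_iff_lt_or_eq.1 hd with hd | rfl
      · rcases h with h | h
        · exact (h4 d hd).1 h.symm
        · exact (h4 d hd).2 h.symm
      · rcases h with h | h
        · exact hne h.symm
        · exact hnod h.symm

section swap

variable {σ : Equiv.Perm α} {j : ℕ} {u : α}

/-- Conjugating `B` by a permutation fixing the visited points does not change the walk. -/
lemma ev_conj (hσ : ∀ y ∈ hist A B s j u, σ y = y) :
    ∀ i ≤ j, ev A (σ * B * σ⁻¹) s i u = ev A B s i u := by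
  intro i
  induction i with
  | zero => exact fun _ => rfl
  | succ i ih =>
    intro hi
    have h1 : σ (ev A B s i u) = ev A B s i u := hσ _ (mem_hist.2 ⟨i, hi, Or.inl rfl⟩)
    have h2 : σ (od A B s i u) = od A B s i u := hσ _ (mem_hist.2 ⟨i, hi, Or.inr rfl⟩)
    rw [ev_succ, ev_succ, od, ih (by omega)]
    conv_lhs => rw [← h1, sgnPow_conj]
    exact congrArg A h2

lemma od_conj (hσ : ∀ y ∈ hist A B s j u, σ y = y) :
    ∀ i < j, od A (σ * B * σ⁻¹) s i u = od A B s i u := fun i hi =>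
  A.injective (by rw [← ev_succ, ← ev_succ]; exact ev_conj hσ (i + 1) hi)

lemma nx_conj (hσ : ∀ y ∈ hist A B s j u, σ y = y) :
    ∀ i < j, nx A (σ * B * σ⁻¹) s i u = σ (nx A B s i u) := fun i hi => by
  rw [nx, od_conj hσ i hi, nx, ← sgnPow_conj, hσ _ (mem_hist.2 ⟨i, hi, Or.inr rfl⟩)]

lemma hist_conj (hσ : ∀ y ∈ hist A B s j u, σ y = y) {i : ℕ} (hi : i ≤ j) :
    hist A (σ * B * σ⁻¹) s i u = hist A B s i u := by
  ext y
  rw [mem_hist, mem_hist]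
  refine exists_congr fun k => and_congr_right fun hk => ?_
  rw [ev_conj hσ k (by omega), od_conj hσ k (by omega)]

lemma clean_conj (hσ : ∀ y ∈ hist A B s j u, σ y = y) :
    ∀ i ≤ j, (clean A (σ * B * σ⁻¹) s i u ↔ clean A B s i u) := by
  intro i
  induction i with
  | zero => exact fun _ => Iff.rfl
  | succ i ih =>
    intro hi
    have hσi : ∀ y ∈ hist A B s i u, σ y = y :=
      fun y hy => hσ y (hist_mono A B s (by omega) u hy)
    simp only [clean]
    rw [ih (by omega), hist_conj hσ (by omega), ev_conj hσ _ hi, ev_conj hσ i (by omega),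
      od_conj hσ i hi, nx_conj hσ i hi, mem_conj_iff hσi]
    refine and_congr_right fun _ => and_congr_right fun _ => and_congr_right fun _ =>
      and_congr_left fun _ => forall_congr' fun k => ?_
    refine forall_congr' fun hk => ?_
    rw [nx_conj hσ k (by omega)]
    simp only [ne_eq]
    rw [eq_conj_iff (hσ _ (mem_hist.2 ⟨i, hi, Or.inl rfl⟩)),
      eq_conj_iff (hσ _ (mem_hist.2 ⟨i, hi, Or.inr rfl⟩))]

lemma nx_eq_ev_conj_iff (hσ : ∀ y ∈ hist A B s j u, σ y = y) {i : ℕ} (hi : i < j) :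
    nx A (σ * B * σ⁻¹) s i u = ev A (σ * B * σ⁻¹) s i u ↔ nx A B s i u = ev A B s i u := by
  rw [nx_conj hσ i hi, ev_conj hσ i hi.le, eq_conj_iff (hσ _ (mem_hist.2 ⟨i, hi, Or.inl rfl⟩))]

lemma numShort_conj (hσ : ∀ y ∈ hist A B s j u, σ y = y) :
    numShort A (σ * B * σ⁻¹) s j u = numShort A B s j u := by
  unfold numShort
  congr 1
  exact Finset.filter_congr fun i hi => nx_eq_ev_conj_iff hσ (Finset.mem_range.1 hi)

lemma cross_conj {v : α} (hσ : ∀ y ∈ hist A B s j u, σ y = y)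
    (hσ' : ∀ y ∈ hist A B s j v, σ y = y) :
    cross A (σ * B * σ⁻¹) s j u v ↔ cross A B s j u v := by
  refine forall_congr' fun d => forall_congr' fun hd => ?_
  rw [ev_conj hσ d hd.le, hist_conj hσ' le_rfl, nx_conj hσ d hd, mem_conj_iff hσ']

end swap

end AltWalk

namespace AltWalk

variable {α : Type*}

lemma ev_eq_of_ev_succ_eq {A B : Equiv.Perm α} {s t : ℕ → Bool} {m : ℕ} {u : α}
    (h : ev A B s (m + 1) u = ev A B t (m + 1) u) :
    (s m ≠ t m → ev A B t m u = nx A B s m u) ∧ (s m = t m → ev A B s m u = ev A B t m u) := by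
  have h1 : od A B s m u = od A B t m u := A.injective h
  constructor
  · intro hne
    have h2 : s m = !(t m) := by revert hne; cases s m <;> cases t m <;> simp
    rw [nx, h1, h2, od, sgnPow_not_apply]
  · intro he
    rw [od, od, he] at h1
    exact (sgnPow B (t m)).injective h1

/-- Two walks that end at the same point determine each other backwards. -/
lemma ev_eq_nx_of_match {A B : Equiv.Perm α} {s t : ℕ → Bool} {d l : ℕ} {u : α} (hd : d < l)
    (h : ev A B s l u = ev A B t l u)
    (hQ : ∀ m, d < m → m < l → s m ≠ t m → nx A B s m u = ev A B s m u) (hs : s d ≠ t d) :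
    ev A B t d u = nx A B s d u := by
  have key : ∀ k m, m + k = l → d < m → ev A B s m u = ev A B t m u := by
    intro k
    induction k with
    | zero => intro m hm _; rw [show m = l by omega]; exact h
    | succ k ih =>
      intro m hm hdm
      have h1 := ev_eq_of_ev_succ_eq (ih (m + 1) (by omega) (by omega))
      by_cases he : s m = t m
      · exact h1.2 he
      · rw [h1.1 he, hQ m hdm (by omega) he]
  exact (ev_eq_of_ev_succ_eq (key (l - (d + 1)) (d + 1) (by omega) (by omega))).1 hs

variable [DecidableEq α]

/-- The walks along `s` from all `x i` are clean and disjoint, those along `t` from the `x i` with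
`i ∈ I` are too, and for `i ∈ I` both walks end at the same point, although the signs differ at
some step inside a long cycle of `B`. -/
def Matching {ι : Type*} (A B : Equiv.Perm α) (s t : ℕ → Bool) (l : ℕ) (x : ι → α)
    (I : Finset ι) : Prop :=
  (∀ i, clean A B s l (x i)) ∧ (∀ i k, i ≠ k → cross A B s l (x i) (x k)) ∧
  (∀ i ∈ I, clean A B t l (x i)) ∧ (∀ i ∈ I, ∀ k ∈ I, i ≠ k → cross A B t l (x i) (x k)) ∧
  ∀ i ∈ I, ev A B s l (x i) = ev A B t l (x i) ∧
    ∃ d < l, s d ≠ t d ∧ nx A B s d (x i) ≠ ev A B s d (x i)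

lemma swap_apply_of_notMem {F : Finset α} {p q : α} (hp : p ∉ F) (hq : q ∉ F) :
    ∀ y ∈ F, Equiv.swap p q y = y := fun _ hy =>
  Equiv.swap_apply_of_ne_of_ne (ne_of_mem_of_not_mem hy hp) (ne_of_mem_of_not_mem hy hq)

lemma conj_mul_eq {G : Type*} [Group G] (σ τ B : G) :
    (σ * τ) * B * (σ * τ)⁻¹ = σ * (τ * B * τ⁻¹) * σ⁻¹ := by group

open Classical in
lemma Matching.swap {ι : Type*} {A B : Equiv.Perm α} {s t : ℕ → Bool} {l : ℕ} {x : ι → α}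
    {I : Finset ι} {k : ι} (hk : k ∉ I) (h : Matching A B s t l x (insert k I)) {d : ℕ}
    (hd : d = Nat.findGreatest (fun m => m < l ∧ s m ≠ t m ∧ nx A B s m (x k) ≠ ev A B s m (x k)) l)
    {p : α} (hps : ∀ i, p ∉ hist A B s l (x i)) (hpt : ∀ i, p ∉ hist A B t l (x i))
    {B' : Equiv.Perm α} (hB' : B' = Equiv.swap (ev A B t d (x k)) p * B *
      (Equiv.swap (ev A B t d (x k)) p)⁻¹) :
    Matching A B' s t l x I ∧
      d = Nat.findGreatest
        (fun m => m < l ∧ s m ≠ t m ∧ nx A B' s m (x k) ≠ ev A B' s m (x k)) l ∧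
      ev A B' t d (x k) = ev A B t d (x k) ∧ nx A B' s d (x k) = p := by
  obtain ⟨h1, h2, h3, h4, h5⟩ := h
  have hkI : k ∈ insert k I := Finset.mem_insert_self _ _
  obtain ⟨hm, d', hd'l, hd'⟩ := h5 k hkI
  have hdspec : d < l ∧ s d ≠ t d ∧ nx A B s d (x k) ≠ ev A B s d (x k) := by
    rw [hd]
    exact Nat.findGreatest_spec (P := fun m => m < l ∧ s m ≠ t m ∧
      nx A B s m (x k) ≠ ev A B s m (x k)) hd'l.le ⟨hd'l, hd'⟩
  have hQ : ∀ m, d < m → m < l → s m ≠ t m → nx A B s m (x k) = ev A B s m (x k) := by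
    intro m hdm hml hne
    by_contra hcon
    rw [hd] at hdm
    exact Nat.findGreatest_is_greatest hdm hml.le ⟨hml, hne, hcon⟩
  obtain ⟨hdl, hdne, hdnx⟩ := hdspec
  have hz := ev_eq_nx_of_match hdl hm hQ hdne
  set z := ev A B t d (x k) with hzdef
  set σ := Equiv.swap z p
  have hzs : ∀ i, z ∉ hist A B s l (x i) := by
    intro i
    rw [hz]
    rcases eq_or_ne k i with rfl | hne
    · exact (h1 k).nx_notMem_hist hdl hdnx
    · exact (h2 k i hne d hdl).2
  have hzt : ∀ i ∈ I, z ∉ hist A B t l (x i) := by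
    intro i hi
    have hne : k ≠ i := fun h => hk (h ▸ hi)
    exact (h4 k hkI i (Finset.mem_insert_of_mem hi) hne d hdl).1
  have hσs : ∀ i, ∀ y ∈ hist A B s l (x i), σ y = y := fun i =>
    swap_apply_of_notMem (hzs i) (hps i)
  have hσt : ∀ i ∈ I, ∀ y ∈ hist A B t l (x i), σ y = y := fun i hi =>
    swap_apply_of_notMem (hzt i hi) (hpt i)
  have hσk : ∀ y ∈ hist A B t d (x k), σ y = y :=
    swap_apply_of_notMem ((h3 k hkI).mono hdl.le).ev_notMem_hist
      fun h => hpt k (hist_mono _ _ _ hdl.le _ h)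
  subst hB'
  refine ⟨⟨fun i => ?_, fun i j hij => ?_, fun i hi => ?_, fun i hi j hj hij => ?_,
    fun i hi => ⟨?_, ?_⟩⟩, ?_, ?_, ?_⟩
  · exact (clean_conj (hσs i) l le_rfl).2 (h1 i)
  · exact (cross_conj (hσs i) (hσs j)).2 (h2 i j hij)
  · exact (clean_conj (hσt i hi) l le_rfl).2 (h3 i (Finset.mem_insert_of_mem hi))
  · exact (cross_conj (hσt i hi) (hσt j hj)).2
      (h4 i (Finset.mem_insert_of_mem hi) j (Finset.mem_insert_of_mem hj) hij)
  · rw [ev_conj (hσs i) l le_rfl, ev_conj (hσt i hi) l le_rfl]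
    exact (h5 i (Finset.mem_insert_of_mem hi)).1
  · obtain ⟨e, hel, hne, hnx⟩ := (h5 i (Finset.mem_insert_of_mem hi)).2
    exact ⟨e, hel, hne, fun h => hnx ((nx_eq_ev_conj_iff (hσs i) hel).1 h)⟩
  · rw [hd]
    congr 1
    funext m
    refine propext (and_congr_right fun hml => and_congr_right fun _ => not_congr ?_)
    exact (nx_eq_ev_conj_iff (hσs k) hml).symm
  · exact ev_conj hσk d le_rfl
  · rw [nx_conj (hσs k) d hdl, ← hz]
    exact Equiv.swap_apply_left _ _

open Classical in
lemma card_matching_insert_le {ι : Type*} [Fintype ι] [Fintype α] (A B : Equiv.Perm α)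
    (s t : ℕ → Bool) (l : ℕ) (x : ι → α) {I : Finset ι} {k : ι} (hk : k ∉ I) :
    ((Fintype.card α : ℝ) - 4 * Fintype.card ι * l) *
      ((Finset.univ.filter fun τ : Equiv.Perm α =>
        Matching A (τ * B * τ⁻¹) s t l x (insert k I)).card : ℝ) ≤
      ((Finset.univ.filter fun τ : Equiv.Perm α =>
        Matching A (τ * B * τ⁻¹) s t l x I).card : ℝ) := by
  let D : Equiv.Perm α → ℕ := fun τ => Nat.findGreatest (fun m => m < l ∧ s m ≠ t m ∧
    nx A (τ * B * τ⁻¹) s m (x k) ≠ ev A (τ * B * τ⁻¹) s m (x k)) l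
  let z : Equiv.Perm α → α := fun τ => ev A (τ * B * τ⁻¹) t (D τ) (x k)
  let K : Equiv.Perm α → Finset α := fun τ =>
    (Finset.univ.biUnion fun i => hist A (τ * B * τ⁻¹) s l (x i)) ∪
      (Finset.univ.biUnion fun i => hist A (τ * B * τ⁻¹) t l (x i))
  have := sum_le_of_swap_mul z K (fun τ => {nx A (τ * B * τ⁻¹) s (D τ) (x k)})
    (Finset.univ.filter fun τ : Equiv.Perm α => Matching A (τ * B * τ⁻¹) s t l x I)
    (Finset.univ.filter fun τ : Equiv.Perm α => Matching A (τ * B * τ⁻¹) s t l x (insert k I))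
    (fun _ => 1) (fun _ => zero_le_one) (c := 1) (k := 4 * Fintype.card ι * l) ?_ ?_ ?_
  · simpa using this
  · intro τ hτ p hp
    simp only [K, Finset.mem_union, Finset.mem_biUnion, Finset.mem_univ, true_and, not_or,
      not_exists] at hp
    obtain ⟨a, b, c, d⟩ := Matching.swap hk (Finset.mem_filter.1 hτ).2 (d := D τ) rfl hp.1 hp.2 rfl
    rw [← conj_mul_eq] at a b c d
    have hD : D (Equiv.swap (z τ) p * τ) = D τ := b.symm
    refine ⟨Finset.mem_filter.2 ⟨Finset.mem_univ _, a⟩, ?_, ?_, le_rfl⟩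
    · change ev A _ t (D (Equiv.swap (z τ) p * τ)) (x k) = _
      rw [hD]; exact c
    · rw [Finset.mem_singleton, hD]; exact d.symm
  · intro τ _; simp
  · intro τ _
    have h1 : ∀ r : ℕ → Bool, (Finset.univ.biUnion fun i => hist A (τ * B * τ⁻¹) r l (x i)).card ≤
        Fintype.card ι * (2 * l) := fun r =>
      Finset.card_biUnion_le_card_mul _ _ _ fun i _ => card_hist_le _ _ _ _ _
    have h2 : (K τ).card ≤ 4 * Fintype.card ι * l := by
      refine (Finset.card_union_le _ _).trans ?_
      have := h1 s
      have := h1 t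
      nlinarith
    exact_mod_cast h2

open Classical in
lemma card_matching_univ_le {ι : Type*} [Fintype ι] [Fintype α] (A B : Equiv.Perm α)
    (s t : ℕ → Bool) (l : ℕ) (x : ι → α) (hn : 4 * Fintype.card ι * l ≤ Fintype.card α) :
    ((Fintype.card α : ℝ) - 4 * Fintype.card ι * l) ^ Fintype.card ι *
      ((Finset.univ.filter fun τ : Equiv.Perm α =>
        Matching A (τ * B * τ⁻¹) s t l x Finset.univ).card : ℝ) ≤
      (Fintype.card α).factorial := by
  have hn' : (0 : ℝ) ≤ (Fintype.card α : ℝ) - 4 * Fintype.card ι * l := by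
    rw [sub_nonneg]; exact_mod_cast hn
  have key : ∀ I : Finset ι, ((Fintype.card α : ℝ) - 4 * Fintype.card ι * l) ^ I.card *
      ((Finset.univ.filter fun τ : Equiv.Perm α =>
        Matching A (τ * B * τ⁻¹) s t l x I).card : ℝ) ≤ (Fintype.card α).factorial := by
    intro I
    induction I using Finset.induction_on with
    | empty =>
      rw [Finset.card_empty, pow_zero, one_mul, ← Fintype.card_perm, ← Finset.card_univ]
      exact_mod_cast Finset.card_le_card (Finset.filter_subset _ _)
    | insert k I hk ih =>
      rw [Finset.card_insert_of_notMem hk, pow_succ, mul_assoc]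
      exact (mul_le_mul_of_nonneg_left (card_matching_insert_le A B s t l x hk)
        (pow_nonneg hn' _)).trans ih
  exact key Finset.univ

end AltWalk

lemma card_filter_perm_mem_le {α : Type*} [Fintype α] [DecidableEq α] (g : Equiv.Perm α)
    (H : Finset α) : (Finset.univ.filter fun x => g x ∈ H).card ≤ H.card :=
  Finset.card_le_card_of_injOn g (fun x hx => by simpa using hx) g.injective.injOn

lemma card_fixed_conj {α : Type*} [Fintype α] [DecidableEq α] (B τ : Equiv.Perm α) :
    (Finset.univ.filter fun x => (τ * B * τ⁻¹) x = x).card =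
      (Finset.univ.filter fun x => B x = x).card := by
  symm
  refine Finset.card_bij (fun x _ => τ x) ?_ (fun _ _ _ _ h => τ.injective h) ?_
  · intro x hx
    simp only [Finset.mem_filter, Finset.mem_univ, true_and] at hx ⊢
    simp [hx]
  · intro y hy
    refine ⟨τ⁻¹ y, ?_, by simp⟩
    rw [Finset.mem_filter] at hy ⊢
    have hy := hy.2
    rw [Equiv.Perm.mul_apply, Equiv.Perm.mul_apply] at hy
    refine ⟨Finset.mem_univ _, ?_⟩
    rw [Equiv.Perm.eq_inv_iff_eq, hy]

lemma card_fixed_sq_conj {α : Type*} [Fintype α] [DecidableEq α] (B τ : Equiv.Perm α) :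
    (Finset.univ.filter fun x => (τ * B * τ⁻¹) ((τ * B * τ⁻¹) x) = x).card =
      (Finset.univ.filter fun x => B (B x) = x).card := by
  have := card_fixed_conj (B * B) τ
  rw [show τ * (B * B) * τ⁻¹ = (τ * B * τ⁻¹) * (τ * B * τ⁻¹) by group] at this
  exact this

namespace AltWalk

variable {α : Type*} [DecidableEq α]

lemma numShort_succ (A B : Equiv.Perm α) (s : ℕ → Bool) (j : ℕ) (u : α) [Decidable
    (nx A B s j u = ev A B s j u)] :
    numShort A B s (j + 1) u =
      numShort A B s j u + if nx A B s j u = ev A B s j u then 1 else 0 := by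
  unfold numShort
  rw [Finset.range_add_one, Finset.filter_insert]
  split_ifs
  · rw [Finset.card_insert_of_notMem (by simp)]
  · simp

variable [Fintype α]

/-- The points `w` such that a step of `A` from `w` would meet a visited point. -/
def trap (A B : Equiv.Perm α) (s : ℕ → Bool) (j : ℕ) (u : α) : Finset α :=
  Finset.univ.filter fun w => A w ∈ hist A B s j u ∨ A w = ev A B s j u ∨ A w = w

lemma card_trap_le (A B : Equiv.Perm α) (s : ℕ → Bool) (j : ℕ) (u : α) :
    (trap A B s j u).card ≤ 2 * j + 1 + (Finset.univ.filter fun x => A x = x).card := by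
  have h1 := (card_filter_perm_mem_le A (hist A B s j u)).trans (card_hist_le A B s j u)
  have h2 := card_filter_perm_mem_le A {ev A B s j u}
  simp only [Finset.mem_singleton, Finset.card_singleton] at h2
  have h3 : trap A B s j u = ((Finset.univ.filter fun x => A x ∈ hist A B s j u) ∪
      (Finset.univ.filter fun x => A x = ev A B s j u)) ∪
      (Finset.univ.filter fun x => A x = x) := by
    ext; simp [trap]
  rw [h3]
  have h4 := Finset.card_union_le ((Finset.univ.filter fun x => A x ∈ hist A B s j u) ∪
      (Finset.univ.filter fun x => A x = ev A B s j u)) (Finset.univ.filter fun x => A x = x)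
  have h5 := Finset.card_union_le (Finset.univ.filter fun x => A x ∈ hist A B s j u)
      (Finset.univ.filter fun x => A x = ev A B s j u)
  omega

open Classical in
/-- The positions from which the next pair of steps may fail to be clean. -/
noncomputable def bad (A B : Equiv.Perm α) (s : ℕ → Bool) (j : ℕ) (u : α) : Finset α :=
  Finset.univ.filter fun p => B p = p ∨ (∃ e, sgnPow B e p ∈ hist A B s j u) ∨
    sgnPow B (s j) p ∈ trap A B s j u ∨
    ∃ e, sgnPow B e (sgnPow B (s j) p) ∈ hist A B s j u

lemma card_bad_le (A B : Equiv.Perm α) (s : ℕ → Bool) (j : ℕ) (u : α) :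
    (bad A B s j u).card ≤ 10 * j + 1 + (Finset.univ.filter fun x => A x = x).card +
      (Finset.univ.filter fun x => B x = x).card := by
  have hH := card_hist_le A B s j u
  have h1 := fun e => (card_filter_perm_mem_le (sgnPow B e) (hist A B s j u)).trans hH
  have h2 := (card_filter_perm_mem_le (sgnPow B (s j)) (trap A B s j u)).trans
    (card_trap_le A B s j u)
  have h3 : ∀ e, (Finset.univ.filter fun x =>
      sgnPow B e (sgnPow B (s j) x) ∈ hist A B s j u).card ≤ 2 * j := fun e =>
    (card_filter_perm_mem_le (sgnPow B e * sgnPow B (s j)) (hist A B s j u)).trans hH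
  have h4 : bad A B s j u ⊆ (Finset.univ.filter fun x => B x = x) ∪
      ((Finset.univ.filter fun x => sgnPow B true x ∈ hist A B s j u) ∪
      ((Finset.univ.filter fun x => sgnPow B false x ∈ hist A B s j u) ∪
      ((Finset.univ.filter fun x => sgnPow B (s j) x ∈ trap A B s j u) ∪
      ((Finset.univ.filter fun x => sgnPow B true (sgnPow B (s j) x) ∈ hist A B s j u) ∪
      (Finset.univ.filter fun x => sgnPow B false (sgnPow B (s j) x) ∈ hist A B s j u))))) := by
    intro p hp
    simp only [bad, Bool.exists_bool, Finset.mem_filter, Finset.mem_univ, true_and,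
      Finset.mem_union] at hp ⊢
    tauto
  refine (Finset.card_le_card h4).trans ?_
  refine (Finset.card_union_le _ _).trans ?_
  have e1 := Finset.card_union_le
    (Finset.univ.filter fun x => sgnPow B true x ∈ hist A B s j u)
      ((Finset.univ.filter fun x => sgnPow B false x ∈ hist A B s j u) ∪
      ((Finset.univ.filter fun x => sgnPow B (s j) x ∈ trap A B s j u) ∪
      ((Finset.univ.filter fun x => sgnPow B true (sgnPow B (s j) x) ∈ hist A B s j u) ∪
      (Finset.univ.filter fun x => sgnPow B false (sgnPow B (s j) x) ∈ hist A B s j u))))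
  have e2 := Finset.card_union_le
      (Finset.univ.filter fun x => sgnPow B false x ∈ hist A B s j u)
      ((Finset.univ.filter fun x => sgnPow B (s j) x ∈ trap A B s j u) ∪
      ((Finset.univ.filter fun x => sgnPow B true (sgnPow B (s j) x) ∈ hist A B s j u) ∪
      (Finset.univ.filter fun x => sgnPow B false (sgnPow B (s j) x) ∈ hist A B s j u)))
  have e3 := Finset.card_union_le
      (Finset.univ.filter fun x => sgnPow B (s j) x ∈ trap A B s j u)
      ((Finset.univ.filter fun x => sgnPow B true (sgnPow B (s j) x) ∈ hist A B s j u) ∪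
      (Finset.univ.filter fun x => sgnPow B false (sgnPow B (s j) x) ∈ hist A B s j u))
  have e4 := Finset.card_union_le
      (Finset.univ.filter fun x => sgnPow B true (sgnPow B (s j) x) ∈ hist A B s j u)
      (Finset.univ.filter fun x => sgnPow B false (sgnPow B (s j) x) ∈ hist A B s j u)
  have := h1 true
  have := h1 false
  have := h3 true
  have := h3 false
  omega

lemma ev_mem_bad {A B : Equiv.Perm α} {s : ℕ → Bool} {j : ℕ} {u : α} (hc : clean A B s j u)
    (hn : ¬ clean A B s (j + 1) u) : ev A B s j u ∈ bad A B s j u := by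
  by_contra hb
  simp only [bad, Finset.mem_filter, Finset.mem_univ, true_and, not_or, not_exists, trap] at hb
  obtain ⟨b1, b2, ⟨b3, b4, b5⟩, b6⟩ := hb
  refine hn ⟨hc, ⟨b2 (s j), fun h => b1 ((sgnPow_eq_self_iff _ _ _).1 h)⟩, ⟨b3, b4, b5⟩,
    fun i hi => ⟨fun h => b2 (!(s i)) ?_, fun h => b6 (!(s i)) ?_⟩, b6 (s j)⟩
  · rw [← h, nx, sgnPow_not_apply]
    exact mem_hist.2 ⟨i, hi, Or.inr rfl⟩
  · change nx A B s i u = sgnPow B (s j) (ev A B s j u) at h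
    rw [← h, nx, sgnPow_not_apply]
    exact mem_hist.2 ⟨i, hi, Or.inr rfl⟩

lemma mem_bad_swap {A B : Equiv.Perm α} {s : ℕ → Bool} {j : ℕ} {u : α} (hc : clean A B s j u)
    (hb : ev A B s j u ∈ bad A B s j u) {p : α} (hp : p ∉ hist A B s j u)
    (hpt : p ∉ trap A B s j u) {B' : Equiv.Perm α} (hB' : B' = Equiv.swap (ev A B s j u) p * B *
      (Equiv.swap (ev A B s j u) p)⁻¹) : p ∈ bad A B' s j u := by
  set z := ev A B s j u with hz
  set σ := Equiv.swap z p
  have hσ : ∀ y ∈ hist A B s j u, σ y = y := swap_apply_of_notMem hc.ev_notMem_hist hp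
  have hσz : σ z = p := Equiv.swap_apply_left _ _
  have hsgn : ∀ e, sgnPow B' e p = σ (sgnPow B e z) := fun e => by rw [hB', ← hσz, sgnPow_conj]
  have hfix : B z = z → B' p = p := fun h => by
    have h1 := hsgn true
    simp only [sgnPow, if_true] at h1
    rw [h1, h, hσz]
  have hH : hist A B' s j u = hist A B s j u := by rw [hB']; exact hist_conj hσ le_rfl
  have hE : ev A B' s j u = z := by rw [hB', ev_conj hσ j le_rfl]
  have hT : trap A B' s j u = trap A B s j u := by
    unfold trap; rw [hH, hE]
  simp only [bad, Finset.mem_filter, Finset.mem_univ, true_and] at hb ⊢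
  rw [hH, hT]
  rcases hb with h | ⟨e, h⟩ | h | ⟨e, h⟩
  · exact Or.inl (hfix h)
  · refine Or.inr (Or.inl ⟨e, ?_⟩)
    rw [hsgn, mem_conj_iff hσ]; exact h
  · by_cases h1 : sgnPow B (s j) z = z
    · exact Or.inl (hfix ((sgnPow_eq_self_iff _ _ _).1 h1))
    · refine Or.inr (Or.inr (Or.inl ?_))
      rw [hsgn, Equiv.swap_apply_of_ne_of_ne h1 (fun h2 : sgnPow B (s j) z = p => hpt (h2 ▸ h))]
      exact h
  · refine Or.inr (Or.inr (Or.inr ⟨e, ?_⟩))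
    rw [hsgn, hB', sgnPow_conj, mem_conj_iff hσ]; exact h

open Classical in
lemma card_clean_fail_le (A B : Equiv.Perm α) (s : ℕ → Bool) (j : ℕ) (u : α) :
    ((Fintype.card α : ℝ) - (4 * j + 1 + (Finset.univ.filter fun x => A x = x).card)) *
      ((Finset.univ.filter fun τ : Equiv.Perm α =>
        clean A (τ * B * τ⁻¹) s j u ∧ ¬ clean A (τ * B * τ⁻¹) s (j + 1) u).card : ℝ) ≤
      (10 * j + 1 + (Finset.univ.filter fun x => A x = x).card +
        (Finset.univ.filter fun x => B x = x).card) * (Fintype.card α).factorial := by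
  have := sum_le_of_swap_mul (fun τ => ev A (τ * B * τ⁻¹) s j u)
    (fun τ => hist A (τ * B * τ⁻¹) s j u ∪ trap A (τ * B * τ⁻¹) s j u)
    (fun τ => bad A (τ * B * τ⁻¹) s j u) Finset.univ
    (Finset.univ.filter fun τ : Equiv.Perm α =>
        clean A (τ * B * τ⁻¹) s j u ∧ ¬ clean A (τ * B * τ⁻¹) s (j + 1) u)
    (fun _ => 1) (fun _ => zero_le_one)
    (c := 10 * j + 1 + (Finset.univ.filter fun x => A x = x).card +
        (Finset.univ.filter fun x => B x = x).card)
    (k := 4 * j + 1 + (Finset.univ.filter fun x => A x = x).card) ?_ ?_ ?_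
  · simpa [Fintype.card_perm] using this
  · intro τ hτ p hp
    obtain ⟨hc, hn⟩ := (Finset.mem_filter.1 hτ).2
    rw [Finset.mem_union, not_or] at hp
    rw [conj_mul_eq]
    refine ⟨Finset.mem_univ _, ?_, mem_bad_swap hc (ev_mem_bad hc hn) hp.1 hp.2 rfl, le_rfl⟩
    exact congrFun (congrFun (congrFun (rfl : @ev _ = @ev _) A) _) s ▸
      ev_conj (swap_apply_of_notMem hc.ev_notMem_hist hp.1) j le_rfl
  · intro τ _
    have := card_bad_le A (τ * B * τ⁻¹) s j u
    rw [card_fixed_conj] at this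
    exact_mod_cast this
  · intro τ _
    have h1 := Finset.card_union_le (hist A (τ * B * τ⁻¹) s j u) (trap A (τ * B * τ⁻¹) s j u)
    have h2 := card_hist_le A (τ * B * τ⁻¹) s j u
    have h3 := card_trap_le A (τ * B * τ⁻¹) s j u
    have h4 : (hist A (τ * B * τ⁻¹) s j u ∪ trap A (τ * B * τ⁻¹) s j u).card ≤
      4 * j + 1 + (Finset.univ.filter fun x => A x = x).card := by omega
    exact_mod_cast h4

open Classical in
lemma sum_clean_short_le (A B : Equiv.Perm α) (s : ℕ → Bool) (j : ℕ) (u : α) :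
    ((Fintype.card α : ℝ) - 2 * j) *
      ∑ τ ∈ Finset.univ.filter (fun τ : Equiv.Perm α => clean A (τ * B * τ⁻¹) s j u ∧
        nx A (τ * B * τ⁻¹) s j u = ev A (τ * B * τ⁻¹) s j u),
        (16 : ℝ) ^ numShort A (τ * B * τ⁻¹) s j u ≤
      (Finset.univ.filter fun x => B (B x) = x).card *
      ∑ τ ∈ Finset.univ.filter (fun τ : Equiv.Perm α => clean A (τ * B * τ⁻¹) s j u),
        (16 : ℝ) ^ numShort A (τ * B * τ⁻¹) s j u := by
  refine sum_le_of_swap_mul (fun τ => ev A (τ * B * τ⁻¹) s j u)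
    (fun τ => hist A (τ * B * τ⁻¹) s j u)
    (fun τ => Finset.univ.filter fun x => (τ * B * τ⁻¹) ((τ * B * τ⁻¹) x) = x) _ _
    (fun τ => (16 : ℝ) ^ numShort A (τ * B * τ⁻¹) s j u) (fun _ => by positivity) ?_ ?_ ?_
  · intro τ hτ p hp
    obtain ⟨hc, hn⟩ := (Finset.mem_filter.1 hτ).2
    rw [Finset.mem_filter]
    simp only [conj_mul_eq]
    have hσ := swap_apply_of_notMem hc.ev_notMem_hist hp
    refine ⟨⟨Finset.mem_univ _, (clean_conj hσ j le_rfl).2 hc⟩, ev_conj hσ j le_rfl, ?_, ?_⟩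
    · have hn := (sgnPow_sgnPow_eq_self_iff _ _ _).1 hn
      set z := ev A (τ * B * τ⁻¹) s j u
      rw [Finset.mem_filter]
      refine ⟨Finset.mem_univ _, ?_⟩
      simp only [Equiv.Perm.mul_apply, Equiv.swap_inv, Equiv.swap_apply_right,
        Equiv.swap_apply_self] at hn ⊢
      rw [hn, Equiv.swap_apply_left]
    · rw [numShort_conj hσ]
  · intro τ _
    rw [card_fixed_sq_conj]
  · intro τ _
    exact_mod_cast card_hist_le A (τ * B * τ⁻¹) s j u

open Classical in
lemma sum_clean_le (A B : Equiv.Perm α) (s : ℕ → Bool) {l : ℕ} (u : α)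
    (hB : 15 * (Finset.univ.filter fun x => B (B x) = x).card + 2 * l < Fintype.card α) :
    ∀ j ≤ l, ∑ τ ∈ Finset.univ.filter (fun τ : Equiv.Perm α => clean A (τ * B * τ⁻¹) s j u),
        (16 : ℝ) ^ numShort A (τ * B * τ⁻¹) s j u ≤ 2 ^ j * (Fintype.card α).factorial := by
  intro j
  induction j with
  | zero => 
    intro _
    rw [Finset.filter_true_of_mem
      (p := fun τ : Equiv.Perm α => clean A (τ * B * τ⁻¹) s 0 u) (fun _ _ => trivial)]
    simp [numShort, Fintype.card_perm]
  | succ j ih =>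
    intro hj
    set X := ∑ τ ∈ Finset.univ.filter (fun τ : Equiv.Perm α => clean A (τ * B * τ⁻¹) s j u),
        (16 : ℝ) ^ numShort A (τ * B * τ⁻¹) s j u
    set Y := ∑ τ ∈ Finset.univ.filter (fun τ : Equiv.Perm α => clean A (τ * B * τ⁻¹) s j u ∧
        nx A (τ * B * τ⁻¹) s j u = ev A (τ * B * τ⁻¹) s j u),
        (16 : ℝ) ^ numShort A (τ * B * τ⁻¹) s j u
    have h1 := sum_clean_short_le A B s j u
    have hX : 0 ≤ X := Finset.sum_nonneg fun _ _ => by positivity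
    have h2 : 15 * Y ≤ X := by
      have h3 : (15 * ((Finset.univ.filter fun x => B (B x) = x).card : ℝ)) <
          (Fintype.card α : ℝ) - 2 * j := by
        have : 15 * (Finset.univ.filter fun x => B (B x) = x).card + 2 * j < Fintype.card α := by
          omega
        rw [lt_sub_iff_add_lt]
        exact_mod_cast this
      have h0 : (0 : ℝ) ≤ 15 * ((Finset.univ.filter fun x => B (B x) = x).card : ℝ) := by positivity
      refine le_of_mul_le_mul_left ?_ (h0.trans_lt h3)
      calc ((Fintype.card α : ℝ) - 2 * j) * (15 * Y)
          = 15 * (((Fintype.card α : ℝ) - 2 * j) * Y) := by ring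
        _ ≤ 15 * (((Finset.univ.filter fun x => B (B x) = x).card : ℝ) * X) := by gcongr
        _ = (15 * ((Finset.univ.filter fun x => B (B x) = x).card : ℝ)) * X := by ring
        _ ≤ _ := by gcongr
    have h4 : ∑ τ ∈ Finset.univ.filter (fun τ : Equiv.Perm α =>
          clean A (τ * B * τ⁻¹) s (j + 1) u),
        (16 : ℝ) ^ numShort A (τ * B * τ⁻¹) s (j + 1) u ≤ X + 15 * Y := by
      calc _ ≤ ∑ τ ∈ Finset.univ.filter (fun τ : Equiv.Perm α => clean A (τ * B * τ⁻¹) s j u),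
            (16 : ℝ) ^ numShort A (τ * B * τ⁻¹) s (j + 1) u := by
            refine Finset.sum_le_sum_of_subset_of_nonneg ?_ fun _ _ _ => by positivity
            exact Finset.monotone_filter_right _ fun τ _ h => h.1
        _ = ∑ τ ∈ Finset.univ.filter (fun τ : Equiv.Perm α => clean A (τ * B * τ⁻¹) s j u),
            ((16 : ℝ) ^ numShort A (τ * B * τ⁻¹) s j u + 15 *
              if nx A (τ * B * τ⁻¹) s j u = ev A (τ * B * τ⁻¹) s j u then
              (16 : ℝ) ^ numShort A (τ * B * τ⁻¹) s j u else 0) := by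
            refine Finset.sum_congr rfl fun τ _ => ?_
            rw [numShort_succ]
            split_ifs
            · rw [pow_succ]; ring
            · simp
        _ = X + 15 * Y := by
            rw [Finset.sum_add_distrib, ← Finset.mul_sum, ← Finset.sum_filter,
              Finset.filter_filter]
    have h5 := ih (by omega)
    rw [pow_succ]
    linarith

/-- The walk of length `l` from `u` is clean and makes few steps in short cycles of `B`. -/
def Good (A B : Equiv.Perm α) (s : ℕ → Bool) (l : ℕ) (u : α) : Prop :=
  clean A B s l u ∧ 2 * numShort A B s l u ≤ l

open Classical in
lemma card_not_good_le (A B : Equiv.Perm α) (s : ℕ → Bool) {l : ℕ} (u : α)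
    (hA : 4 * l + 1 + (Finset.univ.filter fun x => A x = x).card < Fintype.card α)
    (hB : 15 * (Finset.univ.filter fun x => B (B x) = x).card + 2 * l < Fintype.card α) :
    ((Finset.univ.filter fun τ : Equiv.Perm α => ¬ Good A (τ * B * τ⁻¹) s l u).card : ℝ) ≤
      (l * (10 * l + 1 + (Finset.univ.filter fun x => A x = x).card +
        (Finset.univ.filter fun x => B x = x).card) /
        ((Fintype.card α : ℝ) - (4 * l + 1 + (Finset.univ.filter fun x => A x = x).card)) +
        1 / 2 ^ l) * (Fintype.card α).factorial := by
  set fA := (Finset.univ.filter fun x => A x = x).card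
  set fB := (Finset.univ.filter fun x => B x = x).card
  set n := Fintype.card α
  have hpos : (0 : ℝ) < (n : ℝ) - (4 * l + 1 + fA) := by
    rw [sub_pos]; exact_mod_cast hA
  let F : ℕ → Finset (Equiv.Perm α) := fun j => Finset.univ.filter fun τ =>
    clean A (τ * B * τ⁻¹) s j u ∧ ¬ clean A (τ * B * τ⁻¹) s (j + 1) u
  let W : Finset (Equiv.Perm α) := Finset.univ.filter fun τ =>
    clean A (τ * B * τ⁻¹) s l u ∧ l < 2 * numShort A (τ * B * τ⁻¹) s l u
  have hF : ∀ j ∈ Finset.range l, ((F j).card : ℝ) ≤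
      (10 * l + 1 + fA + fB) / ((n : ℝ) - (4 * l + 1 + fA)) * n.factorial := by
    intro j hj
    have hjl : (j : ℝ) ≤ l := by exact_mod_cast (Finset.mem_range.1 hj).le
    have h1 := card_clean_fail_le A B s j u
    rw [div_mul_eq_mul_div, le_div_iff₀ hpos, mul_comm]
    calc ((n : ℝ) - (4 * l + 1 + fA)) * (F j).card
        ≤ ((n : ℝ) - (4 * j + 1 + fA)) * (F j).card := by gcongr
      _ ≤ (10 * j + 1 + fA + fB) * n.factorial := h1
      _ ≤ _ := by gcongr
  have hW : (W.card : ℝ) ≤ 1 / 2 ^ l * n.factorial := by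
    have h1 : (4 : ℝ) ^ l * W.card ≤ 2 ^ l * n.factorial := by
      calc (4 : ℝ) ^ l * W.card = ∑ τ ∈ W, (4 : ℝ) ^ l := by
            rw [Finset.sum_const, nsmul_eq_mul, mul_comm]
        _ ≤ ∑ τ ∈ W, (16 : ℝ) ^ numShort A (τ * B * τ⁻¹) s l u := by
            refine Finset.sum_le_sum fun τ hτ => ?_
            have h2 := (Finset.mem_filter.1 hτ).2.2
            calc (4 : ℝ) ^ l ≤ 4 ^ (2 * numShort A (τ * B * τ⁻¹) s l u) :=
                  pow_le_pow_right₀ (by norm_num) h2.le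
              _ = _ := by rw [pow_mul]; norm_num
        _ ≤ ∑ τ ∈ Finset.univ.filter (fun τ : Equiv.Perm α => clean A (τ * B * τ⁻¹) s l u),
            (16 : ℝ) ^ numShort A (τ * B * τ⁻¹) s l u :=
            Finset.sum_le_sum_of_subset_of_nonneg
              (Finset.monotone_filter_right _ fun τ _ h => h.1) fun _ _ _ => by positivity
        _ ≤ _ := sum_clean_le A B s u hB l le_rfl
    rw [show (4 : ℝ) ^ l = 2 ^ l * 2 ^ l by rw [← mul_pow]; norm_num, mul_assoc] at h1
    have h2 := le_of_mul_le_mul_left h1 (by positivity)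
    rw [one_div_mul_eq_div, le_div_iff₀ (by positivity), mul_comm]
    exact h2
  have hsub : (Finset.univ.filter fun τ : Equiv.Perm α => ¬ Good A (τ * B * τ⁻¹) s l u) ⊆
      ((Finset.range l).biUnion F) ∪ W := by
    intro τ hτ
    have hτ := (Finset.mem_filter.1 hτ).2
    rw [Finset.mem_union]
    by_cases hc : clean A (τ * B * τ⁻¹) s l u
    · refine Or.inr (Finset.mem_filter.2 ⟨Finset.mem_univ _, hc, ?_⟩)
      by_contra h
      exact hτ ⟨hc, by omega⟩
    · left
      have hex : ∃ j, ¬ clean A (τ * B * τ⁻¹) s j u := ⟨l, hc⟩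
      obtain ⟨k, hk⟩ : ∃ k, Nat.find hex = k + 1 :=
        Nat.exists_eq_succ_of_ne_zero fun h0 => Nat.find_spec hex (by rw [h0]; trivial)
      have hkl : Nat.find hex ≤ l := Nat.find_min' hex hc
      refine Finset.mem_biUnion.2 ⟨k, Finset.mem_range.2 (by omega),
        Finset.mem_filter.2 ⟨Finset.mem_univ _, ?_, ?_⟩⟩
      · exact not_not.1 (Nat.find_min hex (m := k) (by omega))
      · rw [← hk]; exact Nat.find_spec hex
  have hcard : (((Finset.univ.filter fun τ : Equiv.Perm α =>
      ¬ Good A (τ * B * τ⁻¹) s l u).card : ℕ) : ℝ) ≤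
      ∑ j ∈ Finset.range l, ((F j).card : ℝ) + W.card := by
    exact_mod_cast (Finset.card_le_card hsub).trans ((Finset.card_union_le _ _).trans
      (Nat.add_le_add_right Finset.card_biUnion_le _))
  refine hcard.trans ?_
  rw [add_mul]
  refine add_le_add ((Finset.sum_le_sum hF).trans (le_of_eq ?_)) hW
  rw [Finset.sum_const, Finset.card_range, nsmul_eq_mul]
  ring

end AltWalk

open Classical in
lemma card_filter_pair_le {ι α : Type*} [Fintype ι] [Fintype α] (R : α → α → Prop) {c : ℕ}
    (hR : ∀ u, (Finset.univ.filter fun v => R u v).card ≤ c) {i k : ι} (hik : i ≠ k) :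
    Fintype.card α * (Finset.univ.filter fun x : ι → α => R (x i) (x k)).card ≤
      c * Fintype.card (ι → α) := by
  have h1 := Finset.card_le_mul_card_image_of_maps_to
    (s := Finset.univ.filter fun x : ι → α => R (x i) (x k))
    (f := fun x (j : {j // j ≠ k}) => x j) (t := Finset.univ) (fun _ _ => Finset.mem_univ _) c ?_
  · have h2 : Fintype.card (ι → α) = Fintype.card α * Fintype.card ({j // j ≠ k} → α) := by
      rw [← Fintype.card_prod]
      exact Fintype.card_congr (Equiv.funSplitAt k α)
    rw [h2, Finset.card_univ] at *
    nlinarith [Nat.mul_le_mul_left (Fintype.card α) h1]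
  · intro y _
    refine le_trans (Finset.card_le_card_of_injOn (fun x => x k) ?_ ?_) (hR (y ⟨i, hik⟩))
    · intro x hx
      simp only [Finset.coe_filter, Finset.mem_filter, Finset.mem_univ, true_and,
        Set.mem_ofPred_eq] at hx ⊢
      rw [← hx.2]; exact hx.1
    · intro x hx x' hx' h
      simp only [Finset.coe_filter, Finset.mem_filter, Finset.mem_univ, true_and,
        Set.mem_ofPred_eq] at hx hx'
      funext j
      by_cases hj : j = k
      · rw [hj]; exact h
      · exact (congrFun hx.2 ⟨j, hj⟩).trans (congrFun hx'.2 ⟨j, hj⟩).symm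

namespace AltWalk

/-- Extension of a finite sequence of signs. -/
def word {l : ℕ} (w : Fin l → Bool) : ℕ → Bool := fun i => if h : i < l then w ⟨i, h⟩ else false

variable {α : Type*} [DecidableEq α]

/-- All walks from the `x i` are good, and they avoid each other. -/
def Nice {ι : Type*} (A B : Equiv.Perm α) (s : ℕ → Bool) (l : ℕ) (x : ι → α) : Prop :=
  (∀ i, Good A B s l (x i)) ∧ ∀ i k, i ≠ k → cross A B s l (x i) (x k)

open Classical in
lemma card_word_agree_le (A B : Equiv.Perm α) {l : ℕ} (w : Fin l → Bool) {u : α}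
    (hg : Good A B (word w) l u) :
    (Finset.univ.filter fun t : Fin l → Bool => ∀ d < l, word w d ≠ word t d →
      nx A B (word w) d u = ev A B (word w) d u).card ≤ 2 ^ (l / 2) := by
  let F := (Finset.range l).filter fun i => nx A B (word w) i u = ev A B (word w) i u
  have hF : F.card ≤ l / 2 := by
    have := hg.2
    have h2 : numShort A B (word w) l u = F.card := rfl
    omega
  calc _ ≤ (Finset.univ : Finset (F → Bool)).card := by
        refine Finset.card_le_card_of_injOn (fun t i => word t i) (fun _ _ => Finset.mem_univ _) ?_
        intro t ht t' ht' h
        simp only [Finset.coe_filter, Finset.mem_univ, true_and, Set.mem_ofPred_eq] at ht ht'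
        have hval : ∀ (v : Fin l → Bool) (i : Fin l), word v i = v i := fun v i => by
          simp [word]
        funext i
        rw [← hval t, ← hval t']
        by_cases hi : nx A B (word w) i u = ev A B (word w) i u
        · exact congrFun h ⟨i, Finset.mem_filter.2 ⟨Finset.mem_range.2 i.2, hi⟩⟩
        · have h1 : word w i = word t i := by
            by_contra hne; exact hi (ht i i.2 hne)
          have h2 : word w i = word t' i := by
            by_contra hne; exact hi (ht' i i.2 hne)
          rw [← h1, ← h2]
    _ = 2 ^ F.card := by
        rw [Finset.card_univ, Fintype.card_fun, Fintype.card_bool, Fintype.card_coe]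
    _ ≤ _ := Nat.pow_le_pow_right (by norm_num) hF

variable [Fintype α]

open Classical in
/-- The number of pairs of a word and a tuple that are not nice. -/
noncomputable def badCount (A B : Equiv.Perm α) (l : ℕ) (ι : Type*) [Fintype ι] : ℕ :=
  (Finset.univ.filter fun p : (Fin l → Bool) × (ι → α) => ¬ Nice A B (word p.1) l p.2).card

open Classical in
/-- The number of coincidences between the nice walks along two words from the same tuple. -/
noncomputable def collCount (A B : Equiv.Perm α) (l : ℕ) (ι : Type*) [Fintype ι] : ℕ :=
  (Finset.univ.filter fun p : (ι → α) × (Fin l → Bool) × (Fin l → Bool) =>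
    Nice A B (word p.2.1) l p.1 ∧ Nice A B (word p.2.2) l p.1 ∧
      ∀ i, ev A B (word p.2.1) l (p.1 i) = ev A B (word p.2.2) l (p.1 i)).card

open Classical in
lemma card_mem_hist_le (A B : Equiv.Perm α) (s : ℕ → Bool) (l : ℕ) (y : α) :
    (Finset.univ.filter fun v => y ∈ hist A B s l v).card ≤ 2 * l := by
  have h1 : (Finset.univ.filter fun v => y ∈ hist A B s l v) ⊆
      (Finset.range l).biUnion fun i => (Finset.univ.filter fun v => ev A B s i v = y) ∪
        (Finset.univ.filter fun v => od A B s i v = y) := by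
    intro v hv
    obtain ⟨i, hi, h⟩ := mem_hist.1 (Finset.mem_filter.1 hv).2
    refine Finset.mem_biUnion.2 ⟨i, Finset.mem_range.2 hi, ?_⟩
    simpa using h
  refine (Finset.card_le_card h1).trans ?_
  refine (Finset.card_biUnion_le_card_mul _ _ 2 fun i _ => ?_).trans (by simp [mul_comm])
  have key : ∀ f : α → α, Function.Injective f →
      (Finset.univ.filter fun v => f v = y).card ≤ 1 := fun f hf =>
    Finset.card_le_one.2 fun a ha b hb => hf (by simp at ha hb; rw [ha, hb])
  exact (Finset.card_union_le _ _).trans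
    (add_le_add (key _ (ev_injective A B s i)) (key _ (od_injective A B s i)))

open Classical in
lemma card_not_cross_le (A B : Equiv.Perm α) (s : ℕ → Bool) (l : ℕ) (u : α) :
    (Finset.univ.filter fun v => ¬ cross A B s l u v).card ≤ 4 * l ^ 2 := by
  have h1 : (Finset.univ.filter fun v => ¬ cross A B s l u v) ⊆
      (Finset.range l).biUnion fun d =>
        (Finset.univ.filter fun v => ev A B s d u ∈ hist A B s l v) ∪
        (Finset.univ.filter fun v => nx A B s d u ∈ hist A B s l v) := by
    intro v hv
    have hv := (Finset.mem_filter.1 hv).2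
    simp only [cross] at hv
    push Not at hv
    obtain ⟨d, hd, h⟩ := hv
    refine Finset.mem_biUnion.2 ⟨d, Finset.mem_range.2 hd, ?_⟩
    simp only [Finset.mem_union, Finset.mem_filter, Finset.mem_univ, true_and]
    tauto
  refine (Finset.card_le_card h1).trans ?_
  refine (Finset.card_biUnion_le_card_mul _ _ (4 * l) fun d _ => ?_).trans
    (by rw [Finset.card_range]; nlinarith)
  refine (Finset.card_union_le _ _).trans ?_
  have := card_mem_hist_le A B s l (ev A B s d u)
  have := card_mem_hist_le A B s l (nx A B s d u)
  omega

open Classical in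
lemma sum_badCount_le (A B : Equiv.Perm α) (l : ℕ) (ι : Type*) [Fintype ι] {ν : ℝ}
    (hα : 0 < Fintype.card α)
    (hν : ∀ s u, ((Finset.univ.filter fun τ : Equiv.Perm α =>
      ¬ Good A (τ * B * τ⁻¹) s l u).card : ℝ) ≤ ν * (Fintype.card α).factorial) :
    ∑ τ : Equiv.Perm α, (badCount A (τ * B * τ⁻¹) l ι : ℝ) ≤
      (Fintype.card ι * ν + Fintype.card ι ^ 2 * (4 * l ^ 2) / Fintype.card α) *
        (2 ^ l * (Fintype.card α : ℝ) ^ Fintype.card ι) * (Fintype.card α).factorial := by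
  set n := Fintype.card α
  set r := Fintype.card ι
  have hX : (Fintype.card (ι → α) : ℝ) = (n : ℝ) ^ r := by
    rw [Fintype.card_fun]; push_cast; rfl
  have h1 : ∀ τ : Equiv.Perm α, (badCount A (τ * B * τ⁻¹) l ι : ℝ) ≤
      ∑ w : Fin l → Bool, (∑ i : ι, ((Finset.univ.filter fun x : ι → α =>
        ¬ Good A (τ * B * τ⁻¹) (word w) l (x i)).card : ℝ) +
        r ^ 2 * (4 * l ^ 2) / n * (n : ℝ) ^ r) := by
    intro τ
    have h2 : badCount A (τ * B * τ⁻¹) l ι = ∑ w : Fin l → Bool,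
        (Finset.univ.filter fun x : ι → α => ¬ Nice A (τ * B * τ⁻¹) (word w) l x).card := by
      unfold badCount
      simp_rw [Finset.card_filter]
      rw [Fintype.sum_prod_type]
    rw [h2]
    push_cast
    refine Finset.sum_le_sum fun w _ => ?_
    have h3 : (Finset.univ.filter fun x : ι → α => ¬ Nice A (τ * B * τ⁻¹) (word w) l x) ⊆
        (Finset.univ.biUnion fun i => Finset.univ.filter fun x : ι → α =>
          ¬ Good A (τ * B * τ⁻¹) (word w) l (x i)) ∪
        (Finset.univ.biUnion fun p : ι × ι => if p.1 = p.2 then ∅ else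
          Finset.univ.filter fun x : ι → α =>
            ¬ cross A (τ * B * τ⁻¹) (word w) l (x p.1) (x p.2)) := by
      intro x hx
      have hx := (Finset.mem_filter.1 hx).2
      rw [Finset.mem_union]
      by_cases hg : ∀ i, Good A (τ * B * τ⁻¹) (word w) l (x i)
      · right
        simp only [Nice, hg, implies_true, true_and] at hx
        push Not at hx
        obtain ⟨i, k, hik, hc⟩ := hx
        refine Finset.mem_biUnion.2 ⟨(i, k), Finset.mem_univ _, ?_⟩
        rw [if_neg hik]
        simpa using hc
      · left
        push Not at hg
        obtain ⟨i, hi⟩ := hg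
        exact Finset.mem_biUnion.2 ⟨i, Finset.mem_univ _, by simpa using hi⟩
    have h4 : ∀ p : ι × ι, (((if p.1 = p.2 then ∅ else Finset.univ.filter fun x : ι → α =>
          ¬ cross A (τ * B * τ⁻¹) (word w) l (x p.1) (x p.2)) : Finset (ι → α)).card : ℝ) ≤
          (4 * l ^ 2) / n * (n : ℝ) ^ r := by
      intro p
      split_ifs with hp
      · simp; positivity
      · have : n * (Finset.univ.filter fun x : ι → α =>
            ¬ cross A (τ * B * τ⁻¹) (word w) l (x p.1) (x p.2)).card ≤
            4 * l ^ 2 * Fintype.card (ι → α) := by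
          convert card_filter_pair_le (c := 4 * l ^ 2)
            (fun u v => ¬ cross A (τ * B * τ⁻¹) (word w) l u v)
            (fun u => by convert card_not_cross_le A (τ * B * τ⁻¹) (word w) l u) hp
        rw [div_mul_eq_mul_div, le_div_iff₀ (by exact_mod_cast hα), ← hX, mul_comm]
        exact_mod_cast this
    have h5 : ((Finset.univ.filter fun x : ι → α =>
        ¬ Nice A (τ * B * τ⁻¹) (word w) l x).card : ℝ) ≤
        ((Finset.univ.biUnion fun i => Finset.univ.filter fun x : ι → α =>
          ¬ Good A (τ * B * τ⁻¹) (word w) l (x i)).card : ℝ) +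
        ((Finset.univ.biUnion fun p : ι × ι => if p.1 = p.2 then ∅ else
          Finset.univ.filter fun x : ι → α =>
            ¬ cross A (τ * B * τ⁻¹) (word w) l (x p.1) (x p.2)).card : ℝ) := by
      exact_mod_cast (Finset.card_le_card h3).trans (Finset.card_union_le _ _)
    refine h5.trans (add_le_add ?_ ?_)
    · exact_mod_cast Finset.card_biUnion_le
    · refine (Nat.cast_le.2 Finset.card_biUnion_le).trans ?_
      push_cast
      refine (Finset.sum_le_sum fun p _ => h4 p).trans (le_of_eq ?_)
      rw [Finset.sum_const, Finset.card_univ, Fintype.card_prod, nsmul_eq_mul]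
      push_cast
      ring
  refine (Finset.sum_le_sum fun τ _ => h1 τ).trans ?_
  have h6 : ∀ (w : Fin l → Bool) (i : ι), ∑ τ : Equiv.Perm α,
      ((Finset.univ.filter fun x : ι → α =>
        ¬ Good A (τ * B * τ⁻¹) (word w) l (x i)).card : ℝ) ≤ (n : ℝ) ^ r * (ν * n.factorial) := by
    intro w i
    have : ∑ τ : Equiv.Perm α, ((Finset.univ.filter fun x : ι → α =>
        ¬ Good A (τ * B * τ⁻¹) (word w) l (x i)).card : ℝ) = ∑ x : ι → α,
        ((Finset.univ.filter fun τ : Equiv.Perm α =>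
        ¬ Good A (τ * B * τ⁻¹) (word w) l (x i)).card : ℝ) := by
      simp_rw [Finset.card_filter]
      push_cast
      rw [Finset.sum_comm]
    rw [this]
    refine (Finset.sum_le_sum fun x _ => hν (word w) (x i)).trans (le_of_eq ?_)
    rw [Finset.sum_const, Finset.card_univ, nsmul_eq_mul, hX]
  rw [Finset.sum_comm]
  calc _ ≤ ∑ w : Fin l → Bool, (r * ((n : ℝ) ^ r * (ν * n.factorial)) +
        n.factorial * (r ^ 2 * (4 * l ^ 2) / n * (n : ℝ) ^ r)) := by
        refine Finset.sum_le_sum fun w _ => ?_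
        rw [Finset.sum_add_distrib, Finset.sum_comm]
        refine add_le_add ((Finset.sum_le_sum fun i _ => h6 w i).trans (le_of_eq ?_))
          (le_of_eq ?_)
        · rw [Finset.sum_const, Finset.card_univ, nsmul_eq_mul]
        · rw [Finset.sum_const, Finset.card_univ, Fintype.card_perm, nsmul_eq_mul]
    _ = _ := by
        rw [Finset.sum_const, Finset.card_univ, Fintype.card_fun, Fintype.card_bool,
          Fintype.card_fin, nsmul_eq_mul]
        push_cast
        ring

open Classical in
lemma sum_collCount_le (A B : Equiv.Perm α) (l : ℕ) (ι : Type*) [Fintype ι]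
    (hn : 4 * Fintype.card ι * l < Fintype.card α) :
    ∑ τ : Equiv.Perm α, (collCount A (τ * B * τ⁻¹) l ι : ℝ) ≤
      ((Fintype.card α : ℝ) ^ Fintype.card ι /
          ((Fintype.card α : ℝ) - 4 * Fintype.card ι * l) ^ Fintype.card ι * (2 ^ l) ^ 2 +
        Fintype.card ι * 2 ^ (l / 2) * (2 ^ l * (Fintype.card α : ℝ) ^ Fintype.card ι)) *
        (Fintype.card α).factorial := by
  set n := Fintype.card α
  set r := Fintype.card ι
  have hX : (Fintype.card (ι → α) : ℝ) = (n : ℝ) ^ r := by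
    rw [Fintype.card_fun]; push_cast; rfl
  have hS : (Fintype.card (Fin l → Bool) : ℝ) = 2 ^ l := by
    rw [Fintype.card_fun, Fintype.card_bool, Fintype.card_fin]; push_cast; rfl
  have hpos : (0 : ℝ) < (n : ℝ) - 4 * r * l := by
    rw [sub_pos]; exact_mod_cast hn
  let P : Equiv.Perm α → (ι → α) × (Fin l → Bool) × (Fin l → Bool) → Prop := fun τ p =>
    Matching A (τ * B * τ⁻¹) (word p.2.1) (word p.2.2) l p.1 Finset.univ
  let Q : Equiv.Perm α → (ι → α) → (Fin l → Bool) → ι → (Fin l → Bool) → Prop :=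
    fun τ x w i t => Good A (τ * B * τ⁻¹) (word w) l (x i) ∧
      ∀ d < l, word w d ≠ word t d →
      nx A (τ * B * τ⁻¹) (word w) d (x i) = ev A (τ * B * τ⁻¹) (word w) d (x i)
  have hQ : ∀ τ x w i, (Finset.univ.filter fun t => Q τ x w i t).card ≤ 2 ^ (l / 2) := by
    intro τ x w i
    by_cases hg : Good A (τ * B * τ⁻¹) (word w) l (x i)
    · refine le_trans (Finset.card_le_card ?_) (card_word_agree_le A (τ * B * τ⁻¹) w hg)
      exact Finset.monotone_filter_right _ fun t _ h => h.2
    · rw [Finset.filter_false_of_mem fun t _ h => hg h.1]; simp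
  have h1 : ∀ τ : Equiv.Perm α, (collCount A (τ * B * τ⁻¹) l ι : ℝ) ≤
      ((Finset.univ.filter fun p => P τ p).card : ℝ) +
        r * 2 ^ (l / 2) * (2 ^ l * (n : ℝ) ^ r) := by
    intro τ
    have h2 : collCount A (τ * B * τ⁻¹) l ι ≤ (Finset.univ.filter fun p => P τ p).card +
        (Finset.univ.filter fun p : (ι → α) × (Fin l → Bool) × (Fin l → Bool) =>
          ∃ i, Q τ p.1 p.2.1 i p.2.2).card := by
      refine le_trans (Finset.card_le_card ?_) (Finset.card_union_le _ _)
      intro p hp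
      obtain ⟨ha, hb, hc⟩ := (Finset.mem_filter.1 hp).2
      rw [Finset.mem_union, Finset.mem_filter, Finset.mem_filter]
      by_cases hq : ∃ i, Q τ p.1 p.2.1 i p.2.2
      · exact Or.inr ⟨Finset.mem_univ _, hq⟩
      · refine Or.inl ⟨Finset.mem_univ _, fun i => (ha.1 i).1, ha.2, fun i _ => (hb.1 i).1,
          fun i _ k _ => hb.2 i k, fun i _ => ⟨hc i, ?_⟩⟩
        by_contra hcon
        push Not at hcon
        exact hq ⟨i, ha.1 i, hcon⟩
    have h3 : (Finset.univ.filter fun p : (ι → α) × (Fin l → Bool) × (Fin l → Bool) =>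
          ∃ i, Q τ p.1 p.2.1 i p.2.2).card ≤
        Fintype.card (ι → α) * (Fintype.card (Fin l → Bool) * (r * 2 ^ (l / 2))) := by
      have h3' : (Finset.univ.filter fun p : (ι → α) × (Fin l → Bool) × (Fin l → Bool) =>
          ∃ i, Q τ p.1 p.2.1 i p.2.2).card = ∑ x, ∑ w, (Finset.univ.filter fun t =>
            ∃ i, Q τ x w i t).card := by
        rw [Finset.card_filter, Fintype.sum_prod_type]
        refine Finset.sum_congr rfl fun x _ => ?_
        rw [Fintype.sum_prod_type]
        exact Finset.sum_congr rfl fun w _ => (Finset.card_filter _ _).symm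
      rw [h3']
      have h4 : ∀ x w, (Finset.univ.filter fun t => ∃ i, Q τ x w i t).card ≤ r * 2 ^ (l / 2) := by
        intro x w
        have : (Finset.univ.filter fun t => ∃ i, Q τ x w i t) ⊆
            Finset.univ.biUnion fun i => Finset.univ.filter fun t => Q τ x w i t := by
          intro t ht
          simpa using ht
        exact (Finset.card_le_card this).trans
          (Finset.card_biUnion_le_card_mul _ _ _ fun i _ => hQ τ x w i)
      refine (Finset.sum_le_card_nsmul _ _ _ fun x _ =>
        Finset.sum_le_card_nsmul _ _ _ fun w _ => h4 x w).trans (le_of_eq ?_)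
      simp only [Finset.card_univ, smul_eq_mul]
    have h5 : (collCount A (τ * B * τ⁻¹) l ι : ℝ) ≤ ((Finset.univ.filter fun p => P τ p).card : ℝ) +
        Fintype.card (ι → α) * (Fintype.card (Fin l → Bool) * (r * 2 ^ (l / 2))) := by
      exact_mod_cast h2.trans (Nat.add_le_add_left h3 _)
    rw [hX, hS] at h5
    refine h5.trans (le_of_eq ?_)
    ring
  refine (Finset.sum_le_sum fun τ _ => h1 τ).trans ?_
  rw [Finset.sum_add_distrib, Finset.sum_const, Finset.card_univ, Fintype.card_perm, add_mul,
    nsmul_eq_mul]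
  refine add_le_add ?_ (le_of_eq (by ring))
  have h6 : ∑ τ : Equiv.Perm α, ((Finset.univ.filter fun p => P τ p).card : ℝ) =
      ∑ p, ((Finset.univ.filter fun τ => P τ p).card : ℝ) := by
    simp_rw [Finset.card_filter]
    push_cast
    rw [Finset.sum_comm]
  rw [h6]
  have h7 : ∀ p ∈ Finset.univ, ((Finset.univ.filter fun τ => P τ p).card : ℝ) ≤
      n.factorial / ((n : ℝ) - 4 * r * l) ^ r := by
    intro p _
    rw [le_div_iff₀ (pow_pos hpos _), mul_comm]
    exact card_matching_univ_le A B (word p.2.1) (word p.2.2) l p.1 hn.le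
  refine (Finset.sum_le_card_nsmul _ _ _ h7).trans (le_of_eq ?_)
  rw [Finset.card_univ, Fintype.card_prod, Fintype.card_prod, nsmul_eq_mul]
  rw [Nat.cast_mul, Nat.cast_mul, hX, hS]
  ring

end AltWalk

open Classical in
/-- Cauchy–Schwarz for the endpoints of random walks that stay in `O`. -/
lemma sq_sum_card_le_card_sq_mul {X S : Type*} [Fintype S] (act : S → X → X)
    (J : S → X → Prop) (O : Finset X) (hO : ∀ s, ∀ x ∈ O, act s x ∈ O) :
    (∑ x ∈ O, (Finset.univ.filter fun s => J s x).card) ^ 2 ≤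
      O.card ^ 2 * ∑ x ∈ O, (Finset.univ.filter fun p : S × S =>
        J p.1 x ∧ J p.2 x ∧ act p.1 x = act p.2 x).card := by
  have h1 : ∀ x ∈ O, (Finset.univ.filter fun s => J s x).card ^ 2 ≤
      O.card * (Finset.univ.filter fun p : S × S =>
        J p.1 x ∧ J p.2 x ∧ act p.1 x = act p.2 x).card := by
    intro x hx
    have h2 : (Finset.univ.filter fun s => J s x).card =
        ∑ y ∈ O, (Finset.univ.filter fun s => J s x ∧ act s x = y).card := by
      rw [Finset.card_eq_sum_card_fiberwise (f := fun s => act s x) (t := O)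
        fun s _ => hO s x hx]
      simp_rw [Finset.filter_filter]
    have h3 : (Finset.univ.filter fun p : S × S =>
        J p.1 x ∧ J p.2 x ∧ act p.1 x = act p.2 x).card =
        ∑ y ∈ O, (Finset.univ.filter fun s => J s x ∧ act s x = y).card ^ 2 := by
      rw [Finset.card_eq_sum_card_fiberwise (f := fun p : S × S => act p.1 x) (t := O)
        fun p _ => hO p.1 x hx]
      refine Finset.sum_congr rfl fun y _ => ?_
      rw [sq, ← Finset.card_product]
      congr 1
      ext p
      simp only [Finset.mem_filter, Finset.mem_univ, true_and, Finset.mem_product]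
      constructor
      · rintro ⟨⟨a, b, c⟩, d⟩
        exact ⟨⟨a, d⟩, b, c ▸ d⟩
      · rintro ⟨⟨a, d⟩, b, e⟩
        exact ⟨⟨a, b, d.trans e.symm⟩, d⟩
    rw [h2, h3]
    exact sq_sum_le_card_mul_sum_sq
  calc _ ≤ O.card * ∑ x ∈ O, (Finset.univ.filter fun s => J s x).card ^ 2 :=
        sq_sum_le_card_mul_sum_sq
    _ ≤ O.card * ∑ x ∈ O, O.card * (Finset.univ.filter fun p : S × S =>
        J p.1 x ∧ J p.2 x ∧ act p.1 x = act p.2 x).card :=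
        Nat.mul_le_mul_left _ (Finset.sum_le_sum h1)
    _ = _ := by rw [← Finset.mul_sum]; ring

open Classical in
lemma card_coll_eq_sum {X S : Type*} [Fintype S] [Fintype X] (act : S → X → X)
    (J : S → X → Prop) :
    (Finset.univ.filter fun p : X × S × S =>
      J p.2.1 p.1 ∧ J p.2.2 p.1 ∧ act p.2.1 p.1 = act p.2.2 p.1).card =
    ∑ x, (Finset.univ.filter fun p : S × S =>
        J p.1 x ∧ J p.2 x ∧ act p.1 x = act p.2 x).card := by
  rw [Finset.card_filter, Fintype.sum_prod_type]
  exact Finset.sum_congr rfl fun x _ => (Finset.card_filter _ _).symm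

open Classical in
lemma sq_add_sq_le_of_disjoint {X S : Type*} [Fintype S] [Fintype X] (act : S → X → X)
    (J : S → X → Prop) {O O' : Finset X} (hd : Disjoint O O') (hO : ∀ s, ∀ x ∈ O, act s x ∈ O)
    (hO' : ∀ s, ∀ x ∈ O', act s x ∈ O') (hne : O.Nonempty) (hne' : O'.Nonempty) {a b : ℝ}
    (ha : 0 ≤ a) (hb : 0 ≤ b)
    (hOa : a * O.card ≤ ∑ x ∈ O, ((Finset.univ.filter fun s => J s x).card : ℝ))
    (hOb : b * O'.card ≤ ∑ x ∈ O', ((Finset.univ.filter fun s => J s x).card : ℝ)) :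
    a ^ 2 + b ^ 2 ≤ ((Finset.univ.filter fun p : X × S × S =>
      J p.2.1 p.1 ∧ J p.2.2 p.1 ∧ act p.2.1 p.1 = act p.2.2 p.1).card : ℝ) := by
  have key : ∀ (O : Finset X) (a : ℝ), (∀ s, ∀ x ∈ O, act s x ∈ O) → O.Nonempty → 0 ≤ a →
      a * O.card ≤ ∑ x ∈ O, ((Finset.univ.filter fun s => J s x).card : ℝ) →
      a ^ 2 ≤ ((∑ x ∈ O, (Finset.univ.filter fun p : S × S =>
        J p.1 x ∧ J p.2 x ∧ act p.1 x = act p.2 x).card : ℕ) : ℝ) := by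
    intro O a hO hne ha h
    have h1 := (Nat.cast_le (α := ℝ)).2 (sq_sum_card_le_card_sq_mul act J O hO)
    have hpos : (0 : ℝ) < O.card := by exact_mod_cast hne.card_pos
    rw [Nat.cast_mul, Nat.cast_pow, Nat.cast_pow, Nat.cast_sum] at h1
    have h2 : (a * O.card) ^ 2 ≤ _ := (pow_le_pow_left₀ (by positivity) h 2).trans h1
    rw [mul_pow, mul_comm] at h2
    exact le_of_mul_le_mul_left h2 (by positivity)
  refine (add_le_add (key O a hO hne ha hOa) (key O' b hO' hne' hb hOb)).trans ?_
  rw [card_coll_eq_sum]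
  rw [← Nat.cast_add, ← Finset.sum_union hd]
  exact_mod_cast Finset.sum_le_sum_of_subset (Finset.subset_univ _)

open Classical in
lemma card_bad_add_sum_card {X S : Type*} [Fintype S] [Fintype X] (J : S → X → Prop) :
    ((Finset.univ.filter fun p : S × X => ¬ J p.1 p.2).card : ℝ) +
      ∑ x, ((Finset.univ.filter fun s => J s x).card : ℝ) = Fintype.card S * Fintype.card X := by
  have h1 : (Finset.univ.filter fun p : S × X => ¬ J p.1 p.2).card =
      ∑ x, (Finset.univ.filter fun s => ¬ J s x).card := by
    rw [Finset.card_filter, Fintype.sum_prod_type, Finset.sum_comm]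
    exact Finset.sum_congr rfl fun x _ => (Finset.card_filter _ _).symm
  rw [h1]
  push_cast
  rw [← Finset.sum_add_distrib, Finset.sum_congr rfl fun x _ => ?_, Finset.sum_const,
    Finset.card_univ, nsmul_eq_mul, mul_comm]
  rw [← Nat.cast_add, add_comm, Finset.card_filter_add_card_filter_not, Finset.card_univ]

open Classical in
/-- If random walks are mostly good and collide rarely more often than they must, then some
invariant class contains nearly everything. -/
lemma exists_giant_class {X S : Type*} [Fintype S] [Fintype X] [Nonempty S] [Nonempty X]
    (act : S → X → X) (J : S → X → Prop) (R : Setoid X) (hR : ∀ s x, R x (act s x))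
    {κ : ℝ} (hκ : κ ≤ 1 / 12)
    (hbad : ((Finset.univ.filter fun p : S × X => ¬ J p.1 p.2).card : ℝ) ≤
      κ * (Fintype.card S * Fintype.card X))
    (hcoll : ((Finset.univ.filter fun p : X × S × S =>
      J p.2.1 p.1 ∧ J p.2.2 p.1 ∧ act p.2.1 p.1 = act p.2.2 p.1).card : ℝ) ≤
      (1 + κ) * (Fintype.card S : ℝ) ^ 2) :
    ∃ x₀, (1 - 2 * κ) * Fintype.card X ≤ ((Finset.univ.filter fun x => R x₀ x).card : ℝ) := by
  set k : X → ℝ := fun x => ((Finset.univ.filter fun s => J s x).card : ℝ) with hk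
  set s : ℝ := (Fintype.card S : ℝ) with hs
  have hs0 : 0 < s := by rw [hs]; exact_mod_cast Fintype.card_pos
  have hX0 : (0 : ℝ) < Fintype.card X := by exact_mod_cast Fintype.card_pos
  have hκ0 : 0 ≤ κ := by
    by_contra h
    push Not at h
    have : κ * (s * Fintype.card X) < 0 := mul_neg_of_neg_of_pos h (by positivity)
    exact absurd (hbad.trans_lt this) (not_lt.2 (by positivity))
  have hsum := card_bad_add_sum_card J
  have hks : ∀ x, k x ≤ s := fun x => by
    simp only [hk, hs]
    exact_mod_cast Finset.card_le_univ _
  obtain ⟨x₀, hx₀⟩ : ∃ x₀, 0 ≤ ∑ x ∈ Finset.univ.filter (fun x => R x₀ x),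
      (k x - (1 - κ) * s) := by
    by_contra hcon
    push Not at hcon
    have h1 : ∑ x, (k x - (1 - κ) * s) = ∑ q : Quotient R,
        ∑ x ∈ Finset.univ.filter (fun x => Quotient.mk R x = q), (k x - (1 - κ) * s) :=
      (Finset.sum_fiberwise _ _ _).symm
    have h2 : ∑ x, (k x - (1 - κ) * s) < 0 := by
      rw [h1]
      have : Nonempty (Quotient R) := ⟨Quotient.mk R (Classical.arbitrary X)⟩
      refine Finset.sum_neg (fun q _ => ?_) Finset.univ_nonempty
      obtain ⟨y, rfl⟩ := Quotient.exists_rep q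
      refine lt_of_eq_of_lt (Finset.sum_congr (Finset.filter_congr fun x _ => ?_)
        fun _ _ => rfl) (hcon y)
      rw [Quotient.eq]
      exact ⟨R.symm', R.symm'⟩
    rw [Finset.sum_sub_distrib, Finset.sum_const, Finset.card_univ, nsmul_eq_mul] at h2
    have : ∑ x, k x = s * Fintype.card X - _ := eq_sub_of_add_eq' hsum
    nlinarith
  refine ⟨x₀, ?_⟩
  set O := Finset.univ.filter (fun x => R x₀ x) with hO
  rw [Finset.sum_sub_distrib, Finset.sum_const, nsmul_eq_mul] at hx₀
  have hcl : ∀ t, ∀ x ∈ O, act t x ∈ O := fun t x hx => by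
    rw [hO, Finset.mem_filter] at hx ⊢
    exact ⟨Finset.mem_univ _, R.trans' hx.2 (hR t x)⟩
  have hcl' : ∀ t, ∀ x ∈ Oᶜ, act t x ∈ Oᶜ := fun t x hx => by
    simp only [hO, Finset.mem_compl, Finset.mem_filter, Finset.mem_univ, true_and] at hx ⊢
    exact fun h => hx (R.trans' h (R.symm' (hR t x)))
  have hcompl : (Oᶜ.card : ℝ) = Fintype.card X - O.card := by
    rw [eq_sub_iff_add_eq, add_comm]
    exact_mod_cast Finset.card_add_card_compl O
  by_cases hne : Oᶜ.Nonempty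
  swap
  · rw [Finset.not_nonempty_iff_eq_empty] at hne
    rw [hne] at hcompl
    simp only [Finset.card_empty, Nat.cast_zero] at hcompl
    nlinarith
  have hneO : O.Nonempty := ⟨x₀, by
    rw [hO, Finset.mem_filter]; exact ⟨Finset.mem_univ _, R.refl' _⟩⟩
  have hc0 : (0 : ℝ) < Oᶜ.card := by exact_mod_cast hne.card_pos
  set b := (∑ x ∈ Oᶜ, k x) / Oᶜ.card with hb
  have hb0 : 0 ≤ b := div_nonneg (Finset.sum_nonneg fun x _ => by positivity) hc0.le
  have h3 := sq_add_sq_le_of_disjoint act J disjoint_compl_right hcl hcl' hneO hne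
    (a := (1 - κ) * s) (b := b) (by nlinarith) hb0 (by linarith)
    (by rw [hb, div_mul_cancel₀ _ hc0.ne'])
  have h4 : b ≤ s / 2 := by
    refine abs_le_of_sq_le_sq' ?_ (by linarith) |>.2
    have : b ^ 2 ≤ (3 * κ - κ ^ 2) * s ^ 2 := by nlinarith
    nlinarith [mul_nonneg (sub_nonneg.2 hκ) (sq_nonneg s), mul_nonneg (sq_nonneg κ) (sq_nonneg s)]
  have h5 : ∑ x ∈ Oᶜ, k x ≤ s / 2 * Oᶜ.card := by
    rw [hb, div_le_iff₀ hc0] at h4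
    exact h4
  have h6 : ∑ x ∈ O, k x ≤ s * O.card := by
    refine (Finset.sum_le_card_nsmul _ _ _ fun x _ => hks x).trans (le_of_eq ?_)
    rw [nsmul_eq_mul, mul_comm]
  have h7 : ∑ x, k x = ∑ x ∈ O, k x + ∑ x ∈ Oᶜ, k x := (Finset.sum_add_sum_compl _ _).symm
  have h8 : s * (1 / 2 * Oᶜ.card) ≤ s * (κ * Fintype.card X) := by
    have : ∑ x, k x = s * Fintype.card X - _ := eq_sub_of_add_eq' hsum
    nlinarith
  have h9 := le_of_mul_le_mul_left h8 hs0
  nlinarith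

namespace AltWalk

variable {α : Type*} [DecidableEq α] [Fintype α]

/-- The walks of length `l` from tuples indexed by `ι` are mostly nice and rarely collide. -/
def Regular (A B : Equiv.Perm α) (l : ℕ) (ι : Type*) [Fintype ι] (κ : ℝ) : Prop :=
  (badCount A B l ι : ℝ) ≤ κ * (2 ^ l * (Fintype.card α : ℝ) ^ Fintype.card ι) ∧
    (collCount A B l ι : ℝ) ≤ (1 + κ) * (2 ^ l) ^ 2

open Classical in
lemma collCount_eq (A B : Equiv.Perm α) (l : ℕ) (ι : Type*) [Fintype ι]
    [DecidablePred fun p : (ι → α) × (Fin l → Bool) × (Fin l → Bool) =>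
      Nice A B (word p.2.1) l p.1 ∧ Nice A B (word p.2.2) l p.1 ∧
      (fun i => ev A B (word p.2.1) l (p.1 i)) = fun i => ev A B (word p.2.2) l (p.1 i)] :
    collCount A B l ι = (Finset.univ.filter fun p : (ι → α) × (Fin l → Bool) × (Fin l → Bool) =>
      Nice A B (word p.2.1) l p.1 ∧ Nice A B (word p.2.2) l p.1 ∧
      (fun i => ev A B (word p.2.1) l (p.1 i)) = fun i => ev A B (word p.2.2) l (p.1 i)).card := by
  unfold collCount
  congr 1
  ext p
  simp only [Finset.mem_filter, funext_iff]

lemma cast_card_fun (ι α : Type*) [Fintype ι] [DecidableEq ι] [Fintype α] :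
    (Fintype.card (ι → α) : ℝ) = (Fintype.card α : ℝ) ^ Fintype.card ι := by
  rw [Fintype.card_fun]; push_cast; rfl

lemma cast_card_word (l : ℕ) : (Fintype.card (Fin l → Bool) : ℝ) = 2 ^ l := by
  rw [Fintype.card_fun, Fintype.card_bool, Fintype.card_fin]; push_cast; rfl

open Classical in
lemma Regular.exists_giant_orbit {A B : Equiv.Perm α} {l : ℕ} {ι : Type*} [Fintype ι] {κ : ℝ}
    [Nonempty α] (h : Regular A B l ι κ) (hκ : κ ≤ 1 / 12) :
    ∃ x₀ : ι → α, (1 - 2 * κ) * (Fintype.card α : ℝ) ^ Fintype.card ι ≤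
      ((Finset.univ.filter fun x : ι → α =>
        ∃ g ∈ Subgroup.closure {A, B}, ∀ i, g (x₀ i) = x i).card : ℝ) := by
  let R : Setoid (ι → α) := ⟨fun x y => ∃ g ∈ Subgroup.closure {A, B}, ∀ i, g (x i) = y i,
    ⟨fun x => ⟨1, one_mem _, fun i => rfl⟩,
      fun {x y} ⟨g, hg, hgx⟩ => ⟨g⁻¹, inv_mem hg, fun i => by rw [← hgx i]; simp⟩,
      fun {x y z} ⟨g, hg, hgx⟩ ⟨g', hg', hgy⟩ => ⟨g' * g, mul_mem hg' hg, fun i => by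
        rw [Equiv.Perm.mul_apply, hgx, hgy]⟩⟩⟩
  have := exists_giant_class (S := Fin l → Bool)
    (fun w (x : ι → α) i => ev A B (word w) l (x i)) (fun w x => Nice A B (word w) l x) R
    (fun w x => ?_) hκ ?_ ?_
  · rw [cast_card_fun] at this
    obtain ⟨x₀, h⟩ := this
    exact ⟨x₀, h.trans (le_of_eq (by congr))⟩
  · obtain ⟨g, hg, h⟩ := exists_mem_ev_eq (Subgroup.closure {A, B}) (A := A) (B := B)
      (Subgroup.subset_closure (by simp)) (Subgroup.subset_closure (by simp)) (word w) l
    exact ⟨g, hg, fun i => (h _).symm⟩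
  · rw [cast_card_word, cast_card_fun]
    exact h.1
  · rw [cast_card_word, ← collCount_eq]
    exact h.2

open Classical in
lemma one_sub_le_collCount (A B : Equiv.Perm α) (l : ℕ) (ι : Type*) [Fintype ι] [Nonempty α] :
    (2 ^ l) ^ 2 - 2 * 2 ^ l * ((badCount A B l ι : ℝ) / (Fintype.card α : ℝ) ^ Fintype.card ι) ≤
      collCount A B l ι := by
  have h1 := sq_sum_card_le_card_sq_mul (S := Fin l → Bool)
    (fun w (x : ι → α) i => ev A B (word w) l (x i)) (fun w x => Nice A B (word w) l x)
    Finset.univ (fun _ _ _ => Finset.mem_univ _)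
  rw [← card_coll_eq_sum (S := Fin l → Bool)
    (fun w (x : ι → α) i => ev A B (word w) l (x i)) (fun w x => Nice A B (word w) l x),
    ← collCount_eq, Finset.card_univ] at h1
  have h2 := card_bad_add_sum_card (S := Fin l → Bool) (X := ι → α)
    (fun w x => Nice A B (word w) l x)
  have h3 : (0 : ℝ) < (Fintype.card α : ℝ) ^ Fintype.card ι := by
    have : 0 < Fintype.card α := Fintype.card_pos
    positivity
  have h4 := (Nat.cast_le (α := ℝ)).2 h1
  push_cast at h4
  rw [cast_card_word, cast_card_fun] at h2
  rw [Fintype.card_fun] at h4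
  push_cast at h4
  set N := (Fintype.card α : ℝ) ^ Fintype.card ι
  change (badCount A B l ι : ℝ) + _ = _ at h2
  rw [eq_sub_of_add_eq' h2] at h4
  set b : ℝ := (badCount A B l ι : ℝ)
  have h5 : (2 : ℝ) ^ l * N - b = N * (2 ^ l - b / N) := by field_simp
  rw [h5, mul_pow] at h4
  have h6 := le_of_mul_le_mul_left h4 (by positivity)
  nlinarith [sq_nonneg (b / N)]

lemma markov_count {T : Type*} [Fintype T] (f : T → ℝ) (hf : ∀ t, 0 ≤ f t) {κ M : ℝ}
    (hκ : 0 < κ) (hM : ∑ t, f t ≤ M) (P : T → Prop) [DecidablePred P] (hP : ∀ t, P t → κ ≤ f t) :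
    ((Finset.univ.filter fun t => P t).card : ℝ) ≤ M / κ := by
  rw [le_div_iff₀ hκ]
  calc _ = ∑ t ∈ Finset.univ.filter fun t => P t, κ := by rw [Finset.sum_const, nsmul_eq_mul]
    _ ≤ ∑ t ∈ Finset.univ.filter fun t => P t, f t :=
        Finset.sum_le_sum fun t ht => hP t (Finset.mem_filter.1 ht).2
    _ ≤ ∑ t, f t := Finset.sum_le_sum_of_subset_of_nonneg (Finset.subset_univ _) fun t _ _ => hf t
    _ ≤ M := hM

open Classical in
lemma card_not_regular_le (A B : Equiv.Perm α) (l : ℕ) (ι : Type*) [Fintype ι] [Nonempty α]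
    {ν κ ε : ℝ} (hκ : 0 < κ)
    (hν : ∀ s u, ((Finset.univ.filter fun τ : Equiv.Perm α =>
      ¬ Good A (τ * B * τ⁻¹) s l u).card : ℝ) ≤ ν * (Fintype.card α).factorial)
    (hn : 4 * Fintype.card ι * l < Fintype.card α)
    (h1 : Fintype.card ι * ν + Fintype.card ι ^ 2 * (4 * l ^ 2) / Fintype.card α ≤ ε)
    (h2 : (Fintype.card α : ℝ) ^ Fintype.card ι /
          ((Fintype.card α : ℝ) - 4 * Fintype.card ι * l) ^ Fintype.card ι * (2 ^ l) ^ 2 +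
        Fintype.card ι * 2 ^ (l / 2) * (2 ^ l * (Fintype.card α : ℝ) ^ Fintype.card ι) ≤
        (1 + ε) * (2 ^ l) ^ 2) :
    ((Finset.univ.filter fun τ : Equiv.Perm α => ¬ Regular A (τ * B * τ⁻¹) l ι κ).card : ℝ) ≤
      4 * ε / κ * (Fintype.card α).factorial := by
  have hs1 := sum_badCount_le A B l ι Fintype.card_pos hν
  have hs2 := sum_collCount_le A B l ι hn
  set n := Fintype.card α
  set r := Fintype.card ι
  set N : ℝ := (n : ℝ) ^ r with hN
  have hN0 : 0 < N := by
    have : 0 < n := Fintype.card_pos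
    positivity
  set S : ℝ := 2 ^ l with hS
  have hS0 : 0 < S := by positivity
  set X : Equiv.Perm α → ℝ := fun τ => (badCount A (τ * B * τ⁻¹) l ι : ℝ) / (S * N) with hX
  set Y : Equiv.Perm α → ℝ := fun τ => (collCount A (τ * B * τ⁻¹) l ι : ℝ) / S ^ 2 with hY
  have hX0 : ∀ τ, 0 ≤ X τ := fun τ => by positivity
  have hfac : (0 : ℝ) ≤ n.factorial := by positivity
  have hXs : ∑ τ, X τ ≤ ε * n.factorial := by
    rw [hX, ← Finset.sum_div, div_le_iff₀ (by positivity)]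
    refine hs1.trans ?_
    calc _ = (r * ν + r ^ 2 * (4 * l ^ 2) / n) * (S * N * n.factorial) := by ring
      _ ≤ ε * (S * N * n.factorial) := mul_le_mul_of_nonneg_right h1 (by positivity)
      _ = _ := by ring
  have hYs : ∑ τ, Y τ ≤ (1 + ε) * n.factorial := by
    rw [hY, ← Finset.sum_div, div_le_iff₀ (by positivity)]
    refine hs2.trans ?_
    calc _ ≤ (1 + ε) * S ^ 2 * n.factorial := mul_le_mul_of_nonneg_right h2 hfac
      _ = _ := by ring
  have hXY : ∀ τ, 0 ≤ Y τ - 1 + 2 * X τ := by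
    intro τ
    have h := one_sub_le_collCount A (τ * B * τ⁻¹) l ι
    have h3 : Y τ - 1 + 2 * X τ = (collCount A (τ * B * τ⁻¹) l ι - (S ^ 2 -
        2 * S * ((badCount A (τ * B * τ⁻¹) l ι : ℝ) / N))) / S ^ 2 := by
      simp only [hX, hY]
      field_simp
      ring
    rw [h3]
    exact div_nonneg (sub_nonneg.2 h) (by positivity)
  have hm1 := markov_count X hX0 hκ hXs (fun τ => κ < X τ) fun τ h => h.le
  have hm2 := markov_count (fun τ => Y τ - 1 + 2 * X τ) hXY hκ (M := 3 * ε * n.factorial) (by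
      rw [Finset.sum_add_distrib, Finset.sum_sub_distrib, ← Finset.mul_sum, Finset.sum_const,
        Finset.card_univ, Fintype.card_perm, nsmul_eq_mul]
      have : n = Fintype.card α := rfl
      rw [← this]
      linarith) (fun τ => κ < Y τ - 1 + 2 * X τ) fun τ h => h.le
  have hsub : (Finset.univ.filter fun τ : Equiv.Perm α => ¬ Regular A (τ * B * τ⁻¹) l ι κ) ⊆
      (Finset.univ.filter fun τ => κ < X τ) ∪
      (Finset.univ.filter fun τ => κ < Y τ - 1 + 2 * X τ) := by
    intro τ hτ
    have hτ := (Finset.mem_filter.1 hτ).2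
    by_contra hcon
    simp only [Finset.mem_union, Finset.mem_filter, Finset.mem_univ, true_and, not_or,
      not_lt] at hcon
    refine hτ ⟨?_, ?_⟩
    · have := hcon.1
      rwa [hX, div_le_iff₀ (by positivity)] at this
    · have h5 : Y τ ≤ 1 + κ := by linarith [hcon.2, hX0 τ]
      rwa [hY, div_le_iff₀ (by positivity)] at h5
  have h6 : ((Finset.univ.filter fun τ : Equiv.Perm α => ¬ Regular A (τ * B * τ⁻¹) l ι κ).card : ℝ)
      ≤ (Finset.univ.filter fun τ => κ < X τ).card +
        (Finset.univ.filter fun τ => κ < Y τ - 1 + 2 * X τ).card := by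
    exact_mod_cast (Finset.card_le_card hsub).trans (Finset.card_union_le _ _)
  refine (h6.trans (add_le_add hm1 hm2)).trans (le_of_eq ?_)
  ring

end AltWalk

lemma pow_div_sub_pow_le {n K ε : ℝ} {r : ℕ} (hK : 0 ≤ K) (hn : 0 < n) (hε : ε ≤ 1)
    (h : 2 * (r * K) ≤ ε * n) (hKn : 2 * K ≤ n) : n ^ r / (n - K) ^ r ≤ 1 + ε := by
  have h0 : 0 < n - K := by linarith
  have h1 : 1 - ε / 2 ≤ ((n - K) / n) ^ r := by
    have hb := one_add_mul_le_pow (a := -(K / n)) (by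
      rw [neg_le_neg_iff, div_le_iff₀ hn]; linarith) r
    have h2 : (n - K) / n = 1 + -(K / n) := by field_simp; ring
    rw [h2]
    refine le_trans ?_ hb
    have h3 : (r : ℝ) * (K / n) ≤ ε / 2 := by
      rw [← mul_div_assoc, div_le_iff₀ hn]; linarith
    linarith
  have hε0 : 0 ≤ ε := by
    by_contra hcon
    push Not at hcon
    have : ε * n < 0 := mul_neg_of_neg_of_pos hcon hn
    have : (0 : ℝ) ≤ 2 * (r * K) := by positivity
    linarith
  rw [div_pow] at h1
  rw [div_le_iff₀ (pow_pos h0 r)]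
  rw [le_div_iff₀ (pow_pos hn r)] at h1
  have h4 : 0 < n ^ r := pow_pos hn r
  have h5 : (1 : ℝ) ≤ (1 + ε) * (1 - ε / 2) := by nlinarith
  calc n ^ r ≤ (1 + ε) * (1 - ε / 2) * n ^ r := le_mul_of_one_le_left h4.le h5
    _ = (1 + ε) * ((1 - ε / 2) * n ^ r) := by ring
    _ ≤ _ := mul_le_mul_of_nonneg_left h1 (by linarith)

lemma bad_bound_le {n q L l r f ε a z : ℝ} (hL : 1 ≤ L) (hq : 1 ≤ q) (hn : 0 < n) (hl0 : 0 ≤ l)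
    (hl : l ≤ 8 * L ^ 5) (hr0 : 0 ≤ r) (hr : r ≤ L ^ 4) (hf : f ≤ 2 * q) (ha : a ≤ q) (hε : ε ≤ 1)
    (hz : z ≤ 1 / n) (h : 2000 * (L ^ 18 * q) ≤ ε * n) :
    r * (l * (10 * l + 1 + f) / (n - (4 * l + 1 + a)) + z) + r ^ 2 * (4 * l ^ 2) / n ≤ ε := by
  have hp : ∀ k m : ℕ, k ≤ m → L ^ k ≤ L ^ m := fun k m hkm => pow_le_pow_right₀ hL hkm
  have h5 : 1 ≤ L ^ 5 := one_le_pow₀ hL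
  have hεn : ε * n ≤ n := by nlinarith
  have hq5 : L ^ 5 ≤ L ^ 5 * q := le_mul_of_one_le_right (by positivity) hq
  have hq5' : q ≤ L ^ 5 * q := le_mul_of_one_le_left (by positivity) h5
  have hq18 : L ^ 5 * q ≤ L ^ 18 * q :=
    mul_le_mul_of_nonneg_right (hp 5 18 (by norm_num)) (by positivity)
  have hden : n / 2 ≤ n - (4 * l + 1 + a) := by linarith
  have hnum : l * (10 * l + 1 + f) ≤ 664 * (L ^ 10 * q) := by
    calc l * (10 * l + 1 + f) ≤ l * (83 * (L ^ 5 * q)) :=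
          mul_le_mul_of_nonneg_left (by linarith) hl0
      _ ≤ (8 * L ^ 5) * (83 * (L ^ 5 * q)) := mul_le_mul_of_nonneg_right hl (by positivity)
      _ = _ := by ring
  have h1 : l * (10 * l + 1 + f) / (n - (4 * l + 1 + a)) ≤ 1328 * (L ^ 10 * q) / n := by
    calc _ ≤ 664 * (L ^ 10 * q) / (n - (4 * l + 1 + a)) :=
          div_le_div_of_nonneg_right hnum (by linarith)
      _ ≤ 664 * (L ^ 10 * q) / (n / 2) :=
          div_le_div_of_nonneg_left (by positivity) (by linarith) hden
      _ = _ := by field_simp; norm_num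
  have h2 : r * (l * (10 * l + 1 + f) / (n - (4 * l + 1 + a)) + z) ≤
      1329 * (L ^ 18 * q) / n := by
    calc _ ≤ r * (1328 * (L ^ 10 * q) / n + 1 / n) := mul_le_mul_of_nonneg_left (by linarith) hr0
      _ ≤ L ^ 4 * (1328 * (L ^ 10 * q) / n + 1 / n) :=
          mul_le_mul_of_nonneg_right hr (by positivity)
      _ = (1328 * (L ^ 14 * q) + L ^ 4) / n := by field_simp
      _ ≤ _ := by
          refine div_le_div_of_nonneg_right ?_ hn.le
          have := mul_le_mul_of_nonneg_right (hp 14 18 (by norm_num)) (zero_le_one.trans hq)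
          have h6 := hp 4 18 (by norm_num)
          have h7 : L ^ 18 ≤ L ^ 18 * q := le_mul_of_one_le_right (by positivity) hq
          linarith
  have h3 : r ^ 2 * (4 * l ^ 2) / n ≤ 256 * (L ^ 18 * q) / n := by
    refine div_le_div_of_nonneg_right ?_ hn.le
    have a1 : r ^ 2 ≤ (L ^ 4) ^ 2 := pow_le_pow_left₀ hr0 hr 2
    have a2 : l ^ 2 ≤ (8 * L ^ 5) ^ 2 := pow_le_pow_left₀ hl0 hl 2
    calc r ^ 2 * (4 * l ^ 2) ≤ (L ^ 4) ^ 2 * (4 * (8 * L ^ 5) ^ 2) :=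
          mul_le_mul a1 (by linarith) (by positivity) (by positivity)
      _ = 256 * L ^ 18 := by ring
      _ ≤ _ := by
          have h7 : L ^ 18 ≤ L ^ 18 * q := le_mul_of_one_le_right (by positivity) hq
          linarith
  calc _ ≤ 1329 * (L ^ 18 * q) / n + 256 * (L ^ 18 * q) / n := add_le_add h2 h3
    _ = 1585 * (L ^ 18 * q) / n := by ring
    _ ≤ ε := by
      rw [div_le_iff₀ hn]
      have : 0 ≤ L ^ 18 * q := by positivity
      linarith

lemma coll_bound_le {n K ε h : ℝ} {r : ℕ} (hK : 0 ≤ K) (hn : 0 < n) (hε0 : 0 ≤ ε) (hε : ε ≤ 1)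
    (h1 : 4 * (r * K) ≤ ε * n) (hKn : 2 * K ≤ n) (hr : 2 * r ≤ ε * n) (hh : n ^ (r + 1) ≤ h) :
    n ^ r / (n - K) ^ r * (h ^ 2) ^ 2 + r * h * (h ^ 2 * n ^ r) ≤ (1 + ε) * (h ^ 2) ^ 2 := by
  have h2 := pow_div_sub_pow_le (r := r) (ε := ε / 2) hK hn (by linarith) (by linarith) hKn
  have h3 : r * n ^ r ≤ ε / 2 * h := by
    calc (r : ℝ) * n ^ r ≤ ε * n / 2 * n ^ r :=
          mul_le_mul_of_nonneg_right (by linarith) (by positivity)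
      _ = ε / 2 * n ^ (r + 1) := by ring
      _ ≤ _ := mul_le_mul_of_nonneg_left hh (by positivity)
  have hh0 : 0 ≤ h := le_trans (by positivity) hh
  calc _ ≤ (1 + ε / 2) * (h ^ 2) ^ 2 + h ^ 3 * (r * n ^ r) := by
        refine add_le_add (mul_le_mul_of_nonneg_right h2 (by positivity)) (le_of_eq (by ring))
    _ ≤ (1 + ε / 2) * (h ^ 2) ^ 2 + h ^ 3 * (ε / 2 * h) := by
        gcongr
    _ = _ := by ring

namespace AltWalk

open Classical in
lemma card_not_regular_le_of_log {α : Type*} [DecidableEq α] [Fintype α] [Nonempty α]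
    (A B : Equiv.Perm α) (ι : Type*) [Fintype ι] {r' L l : ℕ} {κ ε q : ℝ}
    (hκ : 0 < κ) (hε0 : 0 ≤ ε) (hε : ε ≤ 1) (hq : 1 ≤ q) (hL : 1 ≤ L)
    (hnL : Fintype.card α ≤ 2 ^ L)
    (hr : Fintype.card ι ≤ r') (hr' : r' ≤ L ^ 4) (hl : l = 4 * (r' + 1) * L)
    (hfA : ((Finset.univ.filter fun x => A x = x).card : ℝ) ≤ q)
    (hfB : ((Finset.univ.filter fun x => B x = x).card : ℝ) ≤ q)
    (hB : 30 * (Finset.univ.filter fun x => B (B x) = x).card ≤ Fintype.card α)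
    (h : 2000 * ((L : ℝ) ^ 18 * q) ≤ ε * Fintype.card α) :
    ((Finset.univ.filter fun τ : Equiv.Perm α => ¬ Regular A (τ * B * τ⁻¹) l ι κ).card : ℝ) ≤
      4 * ε / κ * (Fintype.card α).factorial := by
  set n := Fintype.card α with hn
  have hn0 : (0 : ℝ) < n := by exact_mod_cast (Fintype.card_pos : 0 < Fintype.card α)
  have hL' : (1 : ℝ) ≤ L := by exact_mod_cast hL
  have hp : ∀ k m : ℕ, k ≤ m → (L : ℝ) ^ k ≤ (L : ℝ) ^ m :=
    fun k m hkm => pow_le_pow_right₀ hL' hkm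
  have hεn : ε * n ≤ n := by nlinarith
  have hrL : (Fintype.card ι : ℝ) ≤ (L : ℝ) ^ 4 := by exact_mod_cast hr.trans hr'
  have hlL : (l : ℝ) ≤ 8 * (L : ℝ) ^ 5 := by
    have h1 : (r' : ℝ) ≤ (L : ℝ) ^ 4 := by exact_mod_cast hr'
    have h2 : (1 : ℝ) ≤ (L : ℝ) ^ 4 := one_le_pow₀ hL'
    rw [hl]
    push_cast
    calc 4 * ((r' : ℝ) + 1) * L ≤ 4 * ((L : ℝ) ^ 4 + (L : ℝ) ^ 4) * L := by gcongr
      _ = _ := by ring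
  have hLq : ∀ k ≤ 18, (L : ℝ) ^ k ≤ (L : ℝ) ^ 18 * q := fun k hk =>
    (hp k 18 hk).trans (le_mul_of_one_le_right (by positivity) hq)
  have hqq : q ≤ (L : ℝ) ^ 18 * q := le_mul_of_one_le_left (by positivity) (one_le_pow₀ hL')
  have hone : (1 : ℝ) ≤ (L : ℝ) ^ 18 * q := hq.trans hqq
  have h5 := hLq 5 (by norm_num)
  have h4 := hLq 4 (by norm_num)
  have h13 := hLq 13 (by norm_num)
  have hrl : (Fintype.card ι : ℝ) * l ≤ 8 * (L : ℝ) ^ 9 := by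
    calc (Fintype.card ι : ℝ) * l ≤ (L : ℝ) ^ 4 * (8 * (L : ℝ) ^ 5) := by gcongr
      _ = _ := by ring
  have hrrl : (Fintype.card ι : ℝ) * (4 * Fintype.card ι * l) ≤ 32 * (L : ℝ) ^ 13 := by
    calc (Fintype.card ι : ℝ) * (4 * Fintype.card ι * l) =
          4 * (Fintype.card ι * (Fintype.card ι * l)) := by ring
      _ ≤ 4 * ((L : ℝ) ^ 4 * (8 * (L : ℝ) ^ 9)) := by gcongr
      _ = _ := by ring
  have h9 := hLq 9 (by norm_num)
  have hn2 : (n : ℝ) ≤ 2 ^ L := by exact_mod_cast hnL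
  have hLl : L ≤ l := by rw [hl]; nlinarith
  refine card_not_regular_le A B l ι hκ (fun s u => card_not_good_le A B s u ?_ ?_) ?_ ?_ ?_
  · have : (4 * l + 1 + (Finset.univ.filter fun x => A x = x).card : ℝ) < n := by linarith
    exact_mod_cast this
  · have h1 : (30 * (Finset.univ.filter fun x => B (B x) = x).card : ℝ) ≤ n := by
      exact_mod_cast hB
    have : (15 * (Finset.univ.filter fun x => B (B x) = x).card + 2 * l : ℝ) < n := by linarith
    exact_mod_cast this
  · have : (4 * Fintype.card ι * l : ℝ) < n := by linarith
    exact_mod_cast this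
  · have := bad_bound_le (n := n) (L := L) (l := l) (r := Fintype.card ι) (ε := ε)
      (q := q) (a := (Finset.univ.filter fun x => A x = x).card)
      (f := (Finset.univ.filter fun x => A x = x).card +
        (Finset.univ.filter fun x => B x = x).card) (z := 1 / 2 ^ l) hL' hq hn0 (by positivity) hlL
      (by positivity) hrL (by linarith) hfA hε ?_ h
    · refine le_trans (le_of_eq ?_) this
      ring
    · refine one_div_le_one_div_of_le hn0 (hn2.trans ?_)
      exact pow_le_pow_right₀ (by norm_num) hLl
  · have h2l : (2 : ℝ) ^ l = (2 ^ (l / 2)) ^ 2 := by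
      rw [← pow_mul]; congr 1; rw [hl]
      have : 4 * (r' + 1) * L = 2 * (2 * ((r' + 1) * L)) := by ring
      omega
    rw [h2l]
    refine coll_bound_le (by positivity) hn0 hε0 hε (by linarith) (by linarith) (by linarith) ?_
    have h1 : l / 2 = L * (2 * (r' + 1)) := by
      rw [hl]
      have : 4 * (r' + 1) * L = 2 * (L * (2 * (r' + 1))) := by ring
      omega
    rw [h1, pow_mul]
    refine (pow_le_pow_left₀ hn0.le hn2 _).trans (pow_le_pow_right₀ ?_ (by omega))
    exact one_le_pow₀ (by norm_num)

end AltWalk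

open Classical in
/-- `G` has an orbit on `ι`-tuples that misses a proportion of at most `κ`. -/
def HasGiantOrbit {α : Type*} [Fintype α] (G : Subgroup (Equiv.Perm α)) (ι : Type*) [Fintype ι]
    (κ : ℝ) : Prop :=
  ∃ x₀ : ι → α, (1 - κ) * (Fintype.card α : ℝ) ^ Fintype.card ι ≤
    ((Finset.univ.filter fun x : ι → α => ∃ g ∈ G, ∀ i, g (x₀ i) = x i).card : ℝ)

open Classical in
lemma HasGiantOrbit.card_le {α ι : Type*} [Fintype α] [Fintype ι] {G : Subgroup (Equiv.Perm α)}
    {κ : ℝ} (h : HasGiantOrbit G ι κ) (P : (ι → α) → Prop)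
    (hP : ∀ g ∈ G, ∀ x, P x → P fun i => g (x i)) {k : ℕ}
    (hk : (Finset.univ.filter fun x => P x).card = k) :
    (k : ℝ) ≤ κ * (Fintype.card α : ℝ) ^ Fintype.card ι ∨
      (1 - κ) * (Fintype.card α : ℝ) ^ Fintype.card ι ≤ k := by
  rw [← hk]
  obtain ⟨x₀, h⟩ := h
  by_cases hx : P x₀
  · right
    refine h.trans ?_
    rw [Nat.cast_le]
    refine Finset.card_le_card fun x hx' => ?_
    obtain ⟨g, hg, hgx⟩ := (Finset.mem_filter.1 hx').2
    have : (fun i => g (x₀ i)) = x := funext hgx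
    exact Finset.mem_filter.2 ⟨Finset.mem_univ _, this ▸ hP g hg x₀ hx⟩
  · left
    have h1 : (Finset.univ.filter fun x : ι → α => ∃ g ∈ G, ∀ i, g (x₀ i) = x i).card ≤
        (Finset.univ.filter fun x => ¬ P x).card := by
      refine Finset.card_le_card fun x hx' => ?_
      obtain ⟨g, hg, hgx⟩ := (Finset.mem_filter.1 hx').2
      refine Finset.mem_filter.2 ⟨Finset.mem_univ _, fun hPx => hx ?_⟩
      have := hP g⁻¹ (inv_mem hg) x hPx
      have h2 : (fun i => g⁻¹ (x i)) = x₀ := by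
        funext i; rw [← hgx i]; simp
      rwa [h2] at this
    have h2 := Finset.card_filter_add_card_filter_not (s := (Finset.univ : Finset (ι → α)))
      (fun x => P x)
    rw [Finset.card_univ] at h2
    have h3 : ((Finset.univ.filter fun x => P x).card : ℝ) +
        (Finset.univ.filter fun x => ¬ P x).card = (Fintype.card α : ℝ) ^ Fintype.card ι := by
      rw [← AltWalk.cast_card_fun]; exact_mod_cast h2
    have h4 := h.trans ((Nat.cast_le (α := ℝ)).2 h1)
    linarith

open Classical in
lemma card_filter_pair_eq_sum {α : Type*} [Fintype α] (R : α → α → Prop)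
    [DecidableRel R] :
    (Finset.univ.filter fun x : Fin 2 → α => R (x 0) (x 1)).card =
      ∑ u, (Finset.univ.filter fun v => R u v).card := by
  rw [Finset.card_filter, ← (finTwoArrowEquiv α).symm.sum_comp, Fintype.sum_prod_type]
  refine Finset.sum_congr rfl fun u _ => ?_
  rw [Finset.card_filter]
  exact Finset.sum_congr rfl fun v _ => by simp

open Classical in
lemma HasGiantOrbit.card_invariant_set {α : Type*} [Fintype α] [Nonempty α]
    {G : Subgroup (Equiv.Perm α)} {κ : ℝ} (h : HasGiantOrbit G (Fin 2) κ) (E : Finset α)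
    (hE : ∀ g ∈ G, ∀ x ∈ E, g x ∈ E) :
    (E.card : ℝ) ≤ κ * Fintype.card α ∨ (1 - κ) * Fintype.card α ≤ E.card := by
  have h2 : (Finset.univ.filter fun x : Fin 2 → α => x 0 ∈ E).card = E.card * Fintype.card α := by
    rw [card_filter_pair_eq_sum (fun u _ => u ∈ E)]
    have : ∀ u, (Finset.univ.filter fun _ : α => u ∈ E).card =
        if u ∈ E then Fintype.card α else 0 := fun u => by
      by_cases hu : u ∈ E <;> simp [hu]
    simp_rw [this]
    rw [Finset.sum_ite_mem, Finset.univ_inter, Finset.sum_const, smul_eq_mul]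
  have h1 := h.card_le (k := E.card * Fintype.card α) (fun x => x 0 ∈ E)
    (fun g hg x hx => hE g hg _ hx) (by convert h2)
  rw [Fintype.card_fin] at h1
  have hpos : (0 : ℝ) < Fintype.card α := by exact_mod_cast Fintype.card_pos
  push_cast at h1
  refine h1.imp (fun h => ?_) fun h => ?_
  · refine le_of_mul_le_mul_right ?_ hpos
    linarith
  · refine le_of_mul_le_mul_right ?_ hpos
    linarith

open Classical in
lemma HasGiantOrbit.card_invariant_setoid {α : Type*} [Fintype α] [Nonempty α]
    {G : Subgroup (Equiv.Perm α)} {κ : ℝ} (h : HasGiantOrbit G (Fin 2) κ) (r : Setoid α)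
    (hr : ∀ g ∈ G, ∀ x y, r x y → r (g x) (g y)) {b : ℕ}
    (hb : ∀ x, (Finset.univ.filter fun y => r x y).card = b) :
    (b : ℝ) ≤ κ * Fintype.card α ∨ (1 - κ) * Fintype.card α ≤ b := by
  have h2 := card_filter_pair_eq_sum (fun u v => r u v)
  simp_rw [hb] at h2
  rw [Finset.sum_const, Finset.card_univ, smul_eq_mul] at h2
  have h1 := h.card_le (k := Fintype.card α * b) (fun x => r (x 0) (x 1))
    (fun g hg x hx => hr g hg _ _ hx) (by convert h2)
  rw [Fintype.card_fin] at h1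
  have hpos : (0 : ℝ) < Fintype.card α := by exact_mod_cast Fintype.card_pos
  push_cast at h1
  refine h1.imp (fun h => ?_) fun h => ?_
  · refine le_of_mul_le_mul_left ?_ hpos
    linarith
  · refine le_of_mul_le_mul_left ?_ hpos
    linarith

open Classical in
lemma card_not_injective_le {α ι : Type*} [Fintype α] [Fintype ι] :
    Fintype.card α * (Finset.univ.filter fun x : ι → α => ¬ Function.Injective x).card ≤
      Fintype.card ι ^ 2 * Fintype.card (ι → α) := by
  have h1 : (Finset.univ.filter fun x : ι → α => ¬ Function.Injective x) ⊆
      (Finset.univ : Finset (ι × ι)).biUnion fun p => if p.1 = p.2 then ∅ else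
        Finset.univ.filter fun x : ι → α => x p.1 = x p.2 := by
    intro x hx
    have hx := (Finset.mem_filter.1 hx).2
    simp only [Function.Injective] at hx
    push Not at hx
    obtain ⟨i, k, h, hik⟩ := hx
    refine Finset.mem_biUnion.2 ⟨(i, k), Finset.mem_univ _, ?_⟩
    rw [if_neg hik]
    simpa using h
  have h2 := (Finset.card_le_card h1).trans Finset.card_biUnion_le
  refine (Nat.mul_le_mul_left _ h2).trans ?_
  rw [Finset.mul_sum]
  refine (Finset.sum_le_card_nsmul _ _ (Fintype.card (ι → α)) fun p _ => ?_).trans (le_of_eq ?_)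
  · split_ifs with hp
    · simp
    · have := card_filter_pair_le (c := 1) (fun u v : α => u = v) (fun u => by
        rw [Finset.card_le_one]
        intro a ha b hb
        simp only [Finset.mem_filter, Finset.mem_univ, true_and] at ha hb
        rw [← ha, hb]) hp
      rw [one_mul] at this
      convert this
  · rw [Finset.card_univ, Fintype.card_prod, smul_eq_mul, sq]

open Classical in
/-- A group with a giant orbit on tuples induces every permutation of some injective tuple. -/
lemma HasGiantOrbit.exists_comp_eq {α ι : Type*} [Fintype α] [Nonempty α] [Fintype ι]
    {G : Subgroup (Equiv.Perm α)} {κ : ℝ} (h : HasGiantOrbit G ι κ) (hκ : κ ≤ 1 / 6)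
    (hι : 2 * Fintype.card ι ^ 2 ≤ Fintype.card α) (σ : Equiv.Perm ι) :
    ∃ x : ι → α, Function.Injective x ∧ ∃ g ∈ G, ∀ i, g (x i) = x (σ i) := by
  obtain ⟨x₀, h⟩ := h
  set O := Finset.univ.filter fun x : ι → α => ∃ g ∈ G, ∀ i, g (x₀ i) = x i with hO
  set O' := Finset.univ.filter fun x : ι → α => ∃ g ∈ G, ∀ i, g (x₀ i) = x (σ i) with hO'
  have h1 : O'.card = O.card := by
    refine Finset.card_bij (fun x _ => x ∘ σ) ?_ ?_ ?_
    · intro x hx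
      simpa [hO, hO'] using hx
    · intro x _ y _ hxy
      exact σ.surjective.injective_comp_right hxy
    · intro y hy
      refine ⟨y ∘ σ.symm, ?_, by ext; simp⟩
      simpa [hO, hO'] using hy
  have h2 := card_not_injective_le (α := α) (ι := ι)
  set I := Finset.univ.filter fun x : ι → α => ¬ Function.Injective x with hI
  have hpos : 0 < Fintype.card α := Fintype.card_pos
  have h3 : 2 * I.card ≤ Fintype.card (ι → α) := by
    refine Nat.le_of_mul_le_mul_left ?_ hpos
    nlinarith [Nat.mul_le_mul_right (Fintype.card (ι → α)) hι]
  rw [← AltWalk.cast_card_fun] at h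
  set N := Fintype.card (ι → α) with hN
  have hN0 : 0 < N := Fintype.card_pos
  have hN0' : (0 : ℝ) < N := by exact_mod_cast hN0
  have h4 : 5 * N ≤ 6 * O.card := by
    have : (5 * N : ℝ) ≤ 6 * O.card := by nlinarith
    exact_mod_cast this
  obtain ⟨x, hx⟩ : ((O ∩ O') \ I).Nonempty := by
    rw [← Finset.card_pos]
    have h5 := Finset.card_union_add_card_inter O O'
    have h6 := Finset.le_card_sdiff I (O ∩ O')
    have h7 := Finset.card_le_univ (O ∪ O')
    have h8 : Fintype.card (ι → α) = N := rfl
    omega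
  simp only [Finset.mem_sdiff, Finset.mem_inter, hI, hO, hO', Finset.mem_filter, Finset.mem_univ,
    true_and, not_not] at hx
  obtain ⟨⟨⟨g, hg, hgx⟩, g', hg', hgx'⟩, hinj⟩ := hx
  refine ⟨x, hinj, g' * g⁻¹, mul_mem hg' (inv_mem hg), fun i => ?_⟩
  rw [← hgx i, ← hgx' i]
  simp

open Classical in
lemma exists_card_eq_of_transitive {α : Type*} [Fintype α] [Nonempty α]
    {G : Subgroup (Equiv.Perm α)} (hG : ∀ x y, ∃ g ∈ G, g x = y) (O : α → α → Prop)
    (hO : ∀ g ∈ G, ∀ x y, O x y → O (g x) (g y)) :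
    ∃ d, (∀ x, (Finset.univ.filter fun y => O x y).card = d) ∧
      ∀ y, (Finset.univ.filter fun x => O x y).card = d := by
  have key : ∀ P : α → α → Prop, (∀ g ∈ G, ∀ x y, P x y → P (g x) (g y)) → ∀ x x',
      (Finset.univ.filter fun y => P x y).card = (Finset.univ.filter fun y => P x' y).card := by
    intro P hP
    have hle : ∀ x x', (Finset.univ.filter fun y => P x y).card ≤
        (Finset.univ.filter fun y => P x' y).card := by
      intro x x'
      obtain ⟨g, hg, hgx⟩ := hG x x'
      refine Finset.card_le_card_of_injOn g ?_ g.injective.injOn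
      intro y hy
      simp only [Finset.coe_filter, Finset.mem_univ, true_and, Set.mem_ofPred_eq] at hy ⊢
      exact hgx ▸ hP g hg x y hy
    exact fun x x' => le_antisymm (hle x x') (hle x' x)
  let a := Classical.arbitrary α
  have h1 := key O hO
  have h2 := key (fun x y => O y x) fun g hg x y => hO g hg y x
  have h3 : ∑ x, (Finset.univ.filter fun y => O x y).card =
      ∑ y, (Finset.univ.filter fun x => O x y).card :=
    Finset.sum_card_bipartiteAbove_eq_sum_card_bipartiteBelow _
  rw [Finset.sum_congr rfl fun x _ => h1 x a, Finset.sum_congr rfl fun x _ => h2 x a,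
    Finset.sum_const, Finset.sum_const, smul_eq_mul, smul_eq_mul] at h3
  have h4 := Nat.eq_of_mul_eq_mul_left (by rw [Finset.card_univ]; exact Fintype.card_pos) h3
  exact ⟨_, fun x => h1 x a, fun y => (h2 y a).trans h4.symm⟩

open Classical in
lemma sum_filter_pair {α : Type*} [Fintype α] (R : α → α → Prop) (f : α → α → ℕ) :
    ∑ x ∈ Finset.univ.filter (fun x : Fin 2 → α => R (x 0) (x 1)), f (x 0) (x 1) =
      ∑ u, ∑ v, if R u v then f u v else 0 := by
  rw [Finset.sum_filter, ← (finTwoArrowEquiv α).symm.sum_comp, Fintype.sum_prod_type]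
  refine Finset.sum_congr rfl fun u _ => Finset.sum_congr rfl fun v _ => ?_
  simp

namespace AltWalk

variable {α : Type*} [DecidableEq α] [Fintype α]

open Classical in
lemma badCount_unit (A B : Equiv.Perm α) (l : ℕ) :
    badCount A B l Unit =
      ∑ u, (Finset.univ.filter fun w : Fin l → Bool => ¬ Good A B (word w) l u).card := by
  have h : badCount A B l Unit = (Finset.univ.filter fun p : (Fin l → Bool) × α =>
      ¬ Good A B (word p.1) l p.2).card := by
    refine Finset.card_bij (fun p _ => (p.1, p.2 ())) (fun p hp => ?_) (fun p _ q _ h => ?_)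
      fun p hp => ⟨(p.1, fun _ => p.2), ?_, rfl⟩
    · have hp := (Finset.mem_filter.1 hp).2
      exact Finset.mem_filter.2 ⟨Finset.mem_univ _,
        fun h => hp ⟨fun _ => h, fun i k hik => (hik rfl).elim⟩⟩
    · simp only [Prod.mk.injEq] at h
      exact Prod.ext h.1 (funext fun _ => h.2)
    · simpa [Nice] using hp
  rw [h, Finset.card_filter, Fintype.sum_prod_type, Finset.sum_comm]
  exact Finset.sum_congr rfl fun u _ => (Finset.card_filter _ _).symm

open Classical in
lemma sum_card_not_nice_le (A B : Equiv.Perm α) (l : ℕ) (O : α → α → Prop) {d : ℕ}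
    (h₁ : ∀ x, (Finset.univ.filter fun y => O x y).card = d)
    (h₂ : ∀ y, (Finset.univ.filter fun x => O x y).card = d) :
    ∑ x ∈ Finset.univ.filter (fun x : Fin 2 → α => O (x 0) (x 1)),
      (Finset.univ.filter fun w : Fin l → Bool => ¬ Nice A B (word w) l x).card ≤
      2 * d * badCount A B l Unit + 2 * (Fintype.card α * (2 ^ l * (4 * l ^ 2))) := by
  set F : α → ℕ := fun u =>
    (Finset.univ.filter fun w : Fin l → Bool => ¬ Good A B (word w) l u).card
  set H : α → α → ℕ := fun u v =>
    (Finset.univ.filter fun w : Fin l → Bool => ¬ cross A B (word w) l u v).card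
  have hF : ∑ u, F u = badCount A B l Unit := (badCount_unit A B l).symm
  have hH : ∑ u, ∑ v, H u v ≤ Fintype.card α * (2 ^ l * (4 * l ^ 2)) := by
    rw [← smul_eq_mul, ← Finset.card_univ]
    refine Finset.sum_le_card_nsmul _ _ _ fun u _ => ?_
    have h3 : ∑ v, H u v = ∑ w : Fin l → Bool,
        (Finset.univ.filter fun v => ¬ cross A B (word w) l u v).card := by
      simp only [H]
      simp_rw [Finset.card_filter]
      rw [Finset.sum_comm]
    rw [h3]
    refine (Finset.sum_le_card_nsmul _ _ _ fun w _ =>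
      card_not_cross_le A B (word w) l u).trans (le_of_eq ?_)
    rw [Finset.card_univ, Fintype.card_fun, Fintype.card_bool, Fintype.card_fin, smul_eq_mul]
  have h3 : ∀ x : Fin 2 → α,
      (Finset.univ.filter fun w : Fin l → Bool => ¬ Nice A B (word w) l x).card ≤
      F (x 0) + F (x 1) + (H (x 0) (x 1) + H (x 1) (x 0)) := by
    intro x
    have : (Finset.univ.filter fun w : Fin l → Bool => ¬ Nice A B (word w) l x) ⊆
        ((Finset.univ.filter fun w : Fin l → Bool => ¬ Good A B (word w) l (x 0)) ∪
        (Finset.univ.filter fun w : Fin l → Bool => ¬ Good A B (word w) l (x 1))) ∪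
        ((Finset.univ.filter fun w : Fin l → Bool => ¬ cross A B (word w) l (x 0) (x 1)) ∪
        (Finset.univ.filter fun w : Fin l → Bool => ¬ cross A B (word w) l (x 1) (x 0))) := by
      intro w hw
      simp only [Finset.mem_union, Finset.mem_filter, Finset.mem_univ, true_and, Nice,
        Fin.forall_fin_two, Fin.isValue, ne_eq, zero_ne_one, not_false_eq_true,
        not_true_eq_false, one_ne_zero, false_implies, true_implies, true_and, and_true] at hw ⊢
      tauto
    refine (Finset.card_le_card this).trans ((Finset.card_union_le _ _).trans ?_)
    exact add_le_add (Finset.card_union_le _ _) (Finset.card_union_le _ _)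
  refine (Finset.sum_le_sum fun x _ => h3 x).trans ?_
  rw [sum_filter_pair O fun u v => F u + F v + (H u v + H v u)]
  have h4 : ∀ u v, (if O u v then F u + F v + (H u v + H v u) else 0) ≤
      (if O u v then F u else 0) + (if O u v then F v else 0) + (H u v + H v u) := by
    intro u v
    split_ifs <;> omega
  refine (Finset.sum_le_sum fun u _ => Finset.sum_le_sum fun v _ => h4 u v).trans ?_
  simp_rw [Finset.sum_add_distrib]
  have h5 : ∑ u, ∑ v, (if O u v then F u else 0) = d * badCount A B l Unit := by
    rw [← hF, Finset.mul_sum]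
    refine Finset.sum_congr rfl fun u _ => ?_
    rw [← Finset.sum_filter, Finset.sum_const, h₁, smul_eq_mul]
  have h6 : ∑ u, ∑ v, (if O u v then F v else 0) = d * badCount A B l Unit := by
    rw [← hF, Finset.mul_sum, Finset.sum_comm]
    refine Finset.sum_congr rfl fun u _ => ?_
    rw [← Finset.sum_filter, Finset.sum_const, h₂, smul_eq_mul]
  have h7 : ∑ u, ∑ v, H v u = ∑ u, ∑ v, H u v := Finset.sum_comm
  rw [h5, h6, h7]
  linarith

open Classical in
lemma mass_orbital_ge (A B : Equiv.Perm α) {l : ℕ} (O : α → α → Prop) {d : ℕ}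
    {T : Finset (Fin 2 → α)} (hT : ∀ x, x ∈ T ↔ O (x 0) (x 1))
    (h₁ : ∀ x, (Finset.univ.filter fun y => O x y).card = d)
    (h₂ : ∀ y, (Finset.univ.filter fun x => O x y).card = d) (hd : 80 * l ^ 2 ≤ d)
    (hbad : (20 * badCount A B l Unit : ℝ) ≤ 2 ^ l * Fintype.card α) :
    (4 / 5 * 2 ^ l : ℝ) * (T.card : ℝ) ≤ ∑ x ∈ T,
      ((Finset.univ.filter fun w : Fin l → Bool => Nice A B (word w) l x).card : ℝ) := by
  obtain rfl : T = Finset.univ.filter fun x : Fin 2 → α => O (x 0) (x 1) := by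
    ext x; simp [hT]
  have h3 := (Nat.cast_le (α := ℝ)).2 (sum_card_not_nice_le A B l O h₁ h₂)
  have h4 : ((Finset.univ.filter fun x : Fin 2 → α => O (x 0) (x 1)).card : ℝ) =
      Fintype.card α * d := by
    have := card_filter_pair_eq_sum O
    simp_rw [h₁] at this
    rw [Finset.sum_const, Finset.card_univ, smul_eq_mul] at this
    rw [← Nat.cast_mul, ← this]
  set T := Finset.univ.filter fun x : Fin 2 → α => O (x 0) (x 1) with hT
  have h5 : ∑ x ∈ T, ((Finset.univ.filter fun w : Fin l → Bool => Nice A B (word w) l x).card : ℝ)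
      + ∑ x ∈ T, ((Finset.univ.filter fun w : Fin l → Bool => ¬ Nice A B (word w) l x).card : ℝ)
      = 2 ^ l * T.card := by
    rw [← Finset.sum_add_distrib, Finset.sum_congr rfl fun x _ => ?_, Finset.sum_const,
      nsmul_eq_mul, mul_comm]
    rw [← Nat.cast_add, Finset.card_filter_add_card_filter_not, Finset.card_univ, cast_card_word]
  push_cast at h3
  have hd' : (80 * (l : ℝ) ^ 2) ≤ d := by exact_mod_cast hd
  have h6 : (d : ℝ) * (20 * badCount A B l Unit) ≤ d * (2 ^ l * Fintype.card α) :=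
    mul_le_mul_of_nonneg_left hbad (by positivity)
  have h7 : ((Fintype.card α : ℝ) * 2 ^ l) * (80 * (l : ℝ) ^ 2) ≤ (Fintype.card α * 2 ^ l) * d :=
    mul_le_mul_of_nonneg_left hd' (by positivity)
  rw [h4] at h5 ⊢
  nlinarith

open Classical in
/-- If walks are well spread, a transitive group has at most one orbital of large valency. -/
lemma Regular.exists_small_orbital {A B : Equiv.Perm α} {l : ℕ} [Nonempty α] {κ : ℝ}
    (h : Regular A B l (Fin 2) κ) (hκ : κ ≤ 1 / 12)
    (hbad : (20 * badCount A B l Unit : ℝ) ≤ 2 ^ l * Fintype.card α)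
    (hG : ∀ x y, ∃ g ∈ Subgroup.closure {A, B}, g x = y) {a b c d : α} (hab : a ≠ b) (hcd : c ≠ d)
    (hno : ¬ ∃ g ∈ Subgroup.closure {A, B}, g a = c ∧ g b = d) :
    ∃ (O : α → α → Prop) (x₀ y₀ : α),
      (∀ g ∈ Subgroup.closure {A, B}, ∀ x y, O x y → O (g x) (g y)) ∧ O x₀ y₀ ∧ x₀ ≠ y₀ ∧
      (∀ x, (Finset.univ.filter fun y => O x y).card < 80 * l ^ 2) ∧
      ∀ y, (Finset.univ.filter fun x => O x y).card < 80 * l ^ 2 := by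
  let Q : α → α → α → α → Prop := fun a b x y => ∃ g ∈ Subgroup.closure {A, B}, g a = x ∧ g b = y
  have hQ : ∀ a b, ∀ g ∈ Subgroup.closure {A, B}, ∀ x y, Q a b x y → Q a b (g x) (g y) := by
    rintro a b g hg x y ⟨k, hk, rfl, rfl⟩
    exact ⟨g * k, mul_mem hg hk, rfl, rfl⟩
  have hQ0 : ∀ a b, Q a b a b := fun a b => ⟨1, one_mem _, rfl, rfl⟩
  obtain ⟨d₁, hd₁, hd₁'⟩ := exists_card_eq_of_transitive hG (Q a b) (hQ a b)
  obtain ⟨d₂, hd₂, hd₂'⟩ := exists_card_eq_of_transitive hG (Q c d) (hQ c d)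
  by_cases h1 : d₁ < 80 * l ^ 2
  · exact ⟨Q a b, a, b, hQ a b, hQ0 a b, hab, fun x => (hd₁ x).trans_lt h1,
      fun y => (hd₁' y).trans_lt h1⟩
  by_cases h2 : d₂ < 80 * l ^ 2
  · exact ⟨Q c d, c, d, hQ c d, hQ0 c d, hcd, fun x => (hd₂ x).trans_lt h2,
      fun y => (hd₂' y).trans_lt h2⟩
  exfalso
  push Not at h1 h2
  have hcl : ∀ a b, ∀ w : Fin l → Bool,
      ∀ x ∈ Finset.univ.filter (fun x : Fin 2 → α => Q a b (x 0) (x 1)),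
      (fun i => ev A B (word w) l (x i)) ∈
        Finset.univ.filter (fun x : Fin 2 → α => Q a b (x 0) (x 1)) := by
    intro a b w x hx
    simp only [Finset.mem_filter, Finset.mem_univ, true_and] at hx ⊢
    obtain ⟨g, hg, h⟩ := exists_mem_ev_eq (Subgroup.closure {A, B}) (A := A) (B := B)
      (Subgroup.subset_closure (by simp)) (Subgroup.subset_closure (by simp)) (word w) l
    rw [h, h]
    exact hQ a b g hg _ _ hx
  have hdis : Disjoint (Finset.univ.filter (fun x : Fin 2 → α => Q a b (x 0) (x 1)))
      (Finset.univ.filter (fun x : Fin 2 → α => Q c d (x 0) (x 1))) := by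
    rw [Finset.disjoint_left]
    intro x hx hx'
    obtain ⟨g, hg, hga, hgb⟩ := (Finset.mem_filter.1 hx).2
    obtain ⟨g', hg', hgc, hgd⟩ := (Finset.mem_filter.1 hx').2
    refine hno ⟨g'⁻¹ * g, mul_mem (inv_mem hg') hg, ?_, ?_⟩
    · rw [Equiv.Perm.mul_apply, hga, ← hgc]; simp
    · rw [Equiv.Perm.mul_apply, hgb, ← hgd]; simp
  have hne : ∀ a b, (Finset.univ.filter (fun x : Fin 2 → α => Q a b (x 0) (x 1))).Nonempty :=
    fun a b => ⟨![a, b], by simpa using hQ0 a b⟩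
  have h3 := sq_add_sq_le_of_disjoint (fun (w : Fin l → Bool) (x : Fin 2 → α) i =>
    ev A B (word w) l (x i)) (fun w x => Nice A B (word w) l x) hdis (hcl a b) (hcl c d) (hne a b)
    (hne c d) (a := 4 / 5 * 2 ^ l) (b := 4 / 5 * 2 ^ l) (by positivity) (by positivity)
    (mass_orbital_ge A B (Q a b) (by simp) hd₁ hd₁' h1 hbad) 
    (mass_orbital_ge A B (Q c d) (by simp) hd₂ hd₂' h2 hbad)
  have h4 : (4 / 5 * 2 ^ l) ^ 2 + (4 / 5 * 2 ^ l) ^ 2 ≤ (1 + κ) * (2 ^ l) ^ 2 := by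
    refine h3.trans ((le_of_eq ?_).trans h.2)
    rw [collCount_eq]
    congr!
  have h5 : (0 : ℝ) < (2 ^ l) ^ 2 := by positivity
  nlinarith

end AltWalk

lemma exists_finset_primes_card_eq {L : ℕ} (hL : 1000 ≤ L) :
    ∃ P : Finset ℕ, (∀ p ∈ P, p.Prime ∧ p ≤ L ^ 2) ∧ P.card = 5 * L := by
  have hpi := Chebyshev.pi_ge (L ^ 2)
  have hLr : (1000 : ℝ) ≤ L := by exact_mod_cast hL
  set w := Real.sqrt L with hw
  have hw2 : w ^ 2 = L := Real.sq_sqrt (by positivity)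
  have hw30 : 30 ≤ w := Real.le_sqrt_of_sq_le (by linarith)
  have hlog : Real.log L ≤ 2 * w := by
    rw [← hw2, Real.log_pow]
    push_cast
    linarith [Real.log_le_sub_one_of_pos (show 0 < w by linarith)]
  have hlog0 : 0 < Real.log L := Real.log_pos (by linarith)
  have hlog2 : Real.log ((L : ℝ) ^ 2 + 1) ≤ 1 + 4 * w := by
    have : Real.log ((L : ℝ) ^ 2 + 1) ≤ Real.log (2 * (L : ℝ) ^ 2) :=
      Real.log_le_log (by positivity) (by nlinarith)
    rw [Real.log_mul (by norm_num) (by positivity), Real.log_pow] at this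
    push_cast at this
    linarith [Real.log_two_lt_d9]
  have hcount : 5 * L ≤ Nat.primeCounting (L ^ 2) := by
    have h : (5 * L : ℝ) ≤ Nat.primeCounting (L ^ 2) := by
      refine le_trans ?_ hpi
      push_cast
      rw [Real.log_pow, le_div_iff₀ (by push_cast; linarith)]
      push_cast
      have h1 : 5 * (L : ℝ) * (2 * Real.log L) ≤ 5 * w ^ 2 * (2 * (2 * w)) := by
        rw [hw2]; gcongr
      have h2 : (L : ℝ) ^ 2 * Real.log 2 ≥ (w ^ 2) ^ 2 * (69 / 100) := by
        rw [hw2]; gcongr; linarith [Real.log_two_gt_d9]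
      nlinarith [mul_nonneg (sub_nonneg.2 hw30) (pow_nonneg (by linarith : (0:ℝ) ≤ w) 3)]
    exact_mod_cast h
  rw [← Nat.primesLE_card_eq_primeCounting] at hcount
  obtain ⟨P, hP, hcard⟩ := Finset.exists_subset_card_eq hcount
  exact ⟨P, fun p hp => by have := hP hp; simp [Nat.mem_primesLE] at this; tauto, hcard⟩

lemma minimalPeriod_eq_prime {α : Type*} {f : α → α} {p : ℕ} (hp : p.Prime) {x : α}
    (h : f^[p] x = x) (h1 : f x ≠ x) : Function.minimalPeriod f x = p := by
  have hd : Function.minimalPeriod f x ∣ p := Function.IsPeriodicPt.minimalPeriod_dvd h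
  rcases (Nat.dvd_prime hp).1 hd with h2 | h2
  · exact absurd (Function.minimalPeriod_eq_one_iff_isFixedPt.1 h2) h1
  · exact h2

lemma finRotate_pow_self (p : ℕ) : finRotate p ^ p = 1 := by
  rcases Nat.lt_or_ge p 2 with h | h
  · interval_cases p
    · rfl
    · exact Subsingleton.elim _ _
  · have := Equiv.Perm.lcm_cycleType (finRotate p)
    rw [cycleType_finRotate_of_le h] at this
    conv_lhs => rw [show finRotate p ^ p = finRotate p ^ orderOf (finRotate p) by
      rw [← this]; simp]
    exact pow_orderOf_eq_one _

lemma minimalPeriod_of_comp_eq_finRotate {α : Type*} {g : Equiv.Perm α} {p : ℕ} (hp : p.Prime)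
    {y : Fin p → α} (hy : Function.Injective y) (h : ∀ i, g (y i) = y (finRotate p i)) (i : Fin p) :
    Function.minimalPeriod g (y i) = p := by
  refine minimalPeriod_eq_prime hp ?_ ?_
  · have hit : ∀ k, g^[k] (y i) = y ((finRotate p)^[k] i) := by
      intro k
      induction k with
      | zero => rfl
      | succ k ih => rw [Function.iterate_succ_apply', ih, h, Function.iterate_succ_apply']
    rw [hit, ← Equiv.Perm.coe_pow, finRotate_pow_self]
    rfl
  · rw [h]
    intro h2
    have h3 : i ∈ (finRotate p).support := by
      rw [support_finRotate_of_le hp.two_le]; simp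
    exact Equiv.Perm.mem_support.1 h3 (hy h2)

open Classical in
lemma exists_mul_eq_card_of_setoid {α : Type*} [Fintype α] (r : Setoid α) {b : ℕ}
    (hb : ∀ x, (Finset.univ.filter fun y => r x y).card = b) :
    ∃ m, b * m = Fintype.card α := by
  refine ⟨Fintype.card (Quotient r), ?_⟩
  have h := Finset.card_eq_sum_card_fiberwise (s := (Finset.univ : Finset α))
    (t := (Finset.univ : Finset (Quotient r))) (f := fun x => Quotient.mk r x) (by simp)
  rw [Finset.card_univ] at h
  rw [h, Finset.sum_congr rfl (g := fun _ => b)]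
  · simp [mul_comm]
  · intro q _
    induction q using Quotient.inductionOn with
    | h x =>
      rw [← hb x]
      congr 1
      ext y
      simp only [Finset.mem_filter, Finset.mem_univ, true_and, Quotient.eq]
      exact ⟨fun h => r.symm h, fun h => r.symm h⟩

section

variable {α : Type*} [Fintype α] [Nonempty α] {G : Subgroup (Equiv.Perm α)} {κ : ℝ}

open Classical in
lemma HasGiantOrbit.transitive (h : HasGiantOrbit G (Fin 2) κ)
    (hE : ∀ E : Finset α, E.Nonempty → (∀ g ∈ G, ∀ x ∈ E, g x ∈ E) →
      ¬ (E.card : ℝ) ≤ κ * Fintype.card α) (x y : α) : ∃ g ∈ G, g x = y := by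
  by_contra hno
  let E := Finset.univ.filter fun y => ∃ g ∈ G, g x = y
  have hEi : ∀ g ∈ G, ∀ z ∈ E, g z ∈ E := by
    intro g hg z hz
    obtain ⟨k, hk, rfl⟩ := (Finset.mem_filter.1 hz).2
    exact Finset.mem_filter.2 ⟨Finset.mem_univ _, g * k, mul_mem hg hk, rfl⟩
  have hEc : ∀ g ∈ G, ∀ z ∈ Eᶜ, g z ∈ Eᶜ := by
    intro g hg z hz
    rw [Finset.mem_compl] at hz ⊢
    intro hgz
    exact hz (by simpa using hEi g⁻¹ (inv_mem hg) _ hgz)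
  have h1 := hE E ⟨x, Finset.mem_filter.2 ⟨Finset.mem_univ _, 1, one_mem _, rfl⟩⟩ hEi
  have h2 := hE Eᶜ ⟨y, by
    rw [Finset.mem_compl]
    exact fun h => hno (Finset.mem_filter.1 h).2⟩ hEc
  have h3 := (h.card_invariant_set E hEi).resolve_left h1
  have h4 : (E.card : ℝ) + Eᶜ.card = Fintype.card α := by
    exact_mod_cast Finset.card_add_card_compl E
  exact h2 (by linarith)

open Classical in
lemma HasGiantOrbit.primitive (h : HasGiantOrbit G (Fin 2) κ) {M : ℕ} (hM : κ * M < 1)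
    (hκ : κ < 1 / 2) (hG : ∀ x y, ∃ g ∈ G, g x = y)
    (hblock : ¬ ∃ b m, 2 ≤ b ∧ M ≤ m ∧ b * m = Fintype.card α ∧ ∃ r : Setoid α,
      (∀ x, (Finset.univ.filter fun y => r x y).card = b) ∧
      ∀ g ∈ G, ∀ x y, r x y → r (g x) (g y))
    (r : Setoid α) (hr : ∀ g ∈ G, ∀ x y, r x y → r (g x) (g y)) : r = ⊥ ∨ r = ⊤ := by
  obtain ⟨b, hb, -⟩ := exists_card_eq_of_transitive hG (fun x y => r x y) hr
  obtain ⟨m, hm⟩ := exists_mul_eq_card_of_setoid r hb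
  have hn : 0 < Fintype.card α := Fintype.card_pos
  have hb0 : 0 < b := Nat.pos_of_ne_zero fun h0 => by simp [h0] at hm; omega
  by_cases hb2 : b < 2
  · left
    have hb1 : b = 1 := by omega
    refine le_bot_iff.1 fun x y hxy => ?_
    obtain ⟨z, hz⟩ := Finset.card_eq_one.1 ((hb x).trans hb1)
    have hx : x ∈ ({z} : Finset α) := hz ▸ Finset.mem_filter.2 ⟨Finset.mem_univ _, r.refl x⟩
    have hy : y ∈ ({z} : Finset α) := hz ▸ Finset.mem_filter.2 ⟨Finset.mem_univ _, hxy⟩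
    rw [Finset.mem_singleton] at hx hy
    exact hx.trans hy.symm
  · right
    have hmM : m < M := by
      by_contra hmM
      exact hblock ⟨b, m, by omega, by omega, hm, r, hb, hr⟩
    have hnb : (Fintype.card α : ℝ) = b * m := by exact_mod_cast hm.symm
    have hbr : (0 : ℝ) < b := by exact_mod_cast hb0
    have hb3 : b = Fintype.card α := by
      rcases h.card_invariant_setoid r hr hb with h1 | h1
      · exfalso
        rw [hnb] at h1
        have hmr : (m : ℝ) ≤ M := by exact_mod_cast hmM.le
        rcases le_or_gt κ 0 with h0 | h0
        · nlinarith [mul_nonneg hbr.le (Nat.cast_nonneg (α := ℝ) m)]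
        · nlinarith [mul_le_mul_of_nonneg_left hmr h0.le]
      · have hm2 : m < 2 := by
          by_contra hm2
          have : (2 : ℝ) ≤ m := by exact_mod_cast not_lt.1 hm2
          rw [hnb] at h1
          nlinarith [mul_pos hbr (show (0:ℝ) < m by linarith)]
        have : m = 1 := by
          have : m ≠ 0 := fun h0 => by simp [h0] at hm; omega
          omega
        simpa [this] using hm
    refine top_le_iff.1 fun x y _ => ?_
    have h5 : (Finset.univ.filter fun y => r x y) = Finset.univ :=
      (Finset.card_eq_iff_eq_univ _).1 ((hb x).trans hb3)
    exact (Finset.mem_filter.1 (h5 ▸ Finset.mem_univ y)).2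

end

namespace AltWalk

variable {α : Type*} [Fintype α] [DecidableEq α] [Nonempty α]

lemma Regular.hasGiantOrbit {A B : Equiv.Perm α} {l : ℕ} {ι : Type*} [Fintype ι] {κ : ℝ}
    (h : Regular A B l ι κ) (hκ : κ ≤ 1 / 12) :
    HasGiantOrbit (Subgroup.closure {A, B}) ι (2 * κ) := by
  obtain ⟨x₀, hx⟩ := h.exists_giant_orbit hκ
  exact ⟨x₀, by convert hx⟩

open Classical in
/-- Deterministic conditions on two permutations which ensure that they generate a group containing
the alternating group. -/
theorem alternatingGroup_le_closure_of_regular {A B : Equiv.Perm α} {l l₁ l₂ p M : ℕ}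
    {P : Finset ℕ} {κ η : ℝ} (hn : 40 ≤ Fintype.card α)
    (hκ : κ ≤ 1 / 12) (hκη : 2 * κ ≤ η) (hκM : 2 * κ * M < 1)
    (hset : ¬ ∃ E : Finset α, E.Nonempty ∧ (E.card : ℝ) ≤ η * Fintype.card α ∧
      (∀ x, A x ∈ E ↔ x ∈ E) ∧ ∀ x, B x ∈ E ↔ x ∈ E)
    (hblock : ¬ ∃ b m, 2 ≤ b ∧ M ≤ m ∧ b * m = Fintype.card α ∧ ∃ r : Setoid α,
      (∀ x, (Finset.univ.filter fun y => r x y).card = b) ∧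
      (∀ x y, r x y → r (A x) (A y)) ∧ ∀ x y, r x y → r (B x) (B y))
    (hunit : Regular A B l Unit (1 / 20)) (hpair : Regular A B l (Fin 2) κ)
    (hp : p.Prime) (hlp : 80 * l ^ 2 ≤ p) (hpn : 2 * (p + 1) ^ 2 ≤ Fintype.card α)
    (hopt : Regular A B l₁ (Option (Fin p)) (1 / 12))
    (hP : ∀ q ∈ P, q.Prime) (hPn : 2 * (∑ q ∈ P, q) ^ 2 ≤ Fintype.card α)
    (hPcard : 5 * Nat.log 2 (Fintype.card α) < P.card)
    (hsig : Regular A B l₂ (Σ q : P, Fin q) (1 / 12)) :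
    alternatingGroup α ≤ Subgroup.closure {A, B} := by
  have hA : A ∈ Subgroup.closure {A, B} := Subgroup.subset_closure (by simp)
  have hB : B ∈ Subgroup.closure {A, B} := Subgroup.subset_closure (by simp)
  have hgo := hpair.hasGiantOrbit hκ
  have hn0 : (0 : ℝ) ≤ Fintype.card α := by positivity
  have htrans : ∀ x y, ∃ g ∈ Subgroup.closure {A, B}, g x = y := by
    refine hgo.transitive fun E hE hinv hcard => hset ⟨E, hE, hcard.trans (by gcongr), ?_, ?_⟩
    · exact fun x => ⟨fun h => by simpa using hinv _ (inv_mem hA) _ h, hinv _ hA x⟩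
    · exact fun x => ⟨fun h => by simpa using hinv _ (inv_mem hB) _ h, hinv _ hB x⟩
  have hprim := hgo.primitive hκM (by linarith) htrans (by
    rintro ⟨b, m, hb, hm, hbm, r, hr, hinv⟩
    exact hblock ⟨b, m, hb, hm, hbm, r, hr, hinv A hA, hinv B hB⟩)
  have h2 : ∀ a b c d : α, a ≠ b → c ≠ d → ∃ g ∈ Subgroup.closure {A, B}, g a = c ∧ g b = d := by
    intro a b c d hab hcd
    by_contra hno
    obtain ⟨O, x₀, y₀, hO, h₀, hne, hout, hin⟩ := hpair.exists_small_orbital hκ (by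
      have := hunit.1
      rw [Fintype.card_unit, pow_one] at this
      linarith) htrans hab hcd hno
    obtain ⟨x, hx, g, hg, hgx⟩ := (hopt.hasGiantOrbit le_rfl).exists_comp_eq (by norm_num)
      (by simpa using hpn) (Equiv.optionCongr (finRotate p))
    have hnone : g (x none) = x none := by rw [hgx]; simp
    refine minimalPeriod_ne_prime_of_small_orbital _ hprim O hO h₀ hne hp
      (fun x => ?_) (fun y => ?_) hg hnone (x (some ⟨0, hp.pos⟩)) ?_
    · convert (hout x).trans_le hlp
    · convert (hin y).trans_le hlp
    · exact minimalPeriod_of_comp_eq_finRotate hp (y := fun i => x (some i))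
        (fun i j h => Option.some_injective _ (hx h)) (fun i => by rw [hgx]; simp) _
  obtain ⟨x, hx, g, hg, hgx⟩ := (hsig.hasGiantOrbit le_rfl).exists_comp_eq (by norm_num)
    (by
      rw [Fintype.card_sigma]
      simpa [Finset.sum_attach P fun q => q] using hPn)
    (Equiv.sigmaCongrRight fun q : P => finRotate q)
  obtain ⟨k, hk1, hk⟩ := g.exists_pow_ne_one_card_support_le P hP (fun q hq =>
    ⟨x ⟨⟨q, hq⟩, ⟨0, (hP q hq).pos⟩⟩, minimalPeriod_of_comp_eq_finRotate (hP q hq)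
      (y := fun i => x ⟨⟨q, hq⟩, i⟩) (fun i j h => by simpa using hx h)
      (fun i => by rw [hgx]; rfl) _⟩) 5 hPcard
  exact alternatingGroup_le_of_two_transitive_of_card_support _ h2 (g ^ k) (pow_mem hg k) hk1
    (by omega) hn

end AltWalk

namespace AltWalk

variable {α : Type*} [Fintype α] [DecidableEq α] [Nonempty α]

lemma card_le_of_forall_mem_six {γ : Type*} (S S₁ S₂ S₃ S₄ S₅ S₆ : Finset γ)
    (h : ∀ x ∈ S, x ∈ S₁ ∨ x ∈ S₂ ∨ x ∈ S₃ ∨ x ∈ S₄ ∨ x ∈ S₅ ∨ x ∈ S₆)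
    {a₁ a₂ a₃ a₄ a₅ a₆ : ℝ} (h₁ : (S₁.card : ℝ) ≤ a₁) (h₂ : (S₂.card : ℝ) ≤ a₂)
    (h₃ : (S₃.card : ℝ) ≤ a₃) (h₄ : (S₄.card : ℝ) ≤ a₄) (h₅ : (S₅.card : ℝ) ≤ a₅)
    (h₆ : (S₆.card : ℝ) ≤ a₆) : (S.card : ℝ) ≤ a₁ + a₂ + a₃ + a₄ + a₅ + a₆ := by
  classical
  have hor : ∀ Q R : Finset γ, ((Q ∪ R).card : ℝ) ≤ Q.card + R.card := fun Q R => by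
    exact_mod_cast Finset.card_union_le _ _
  have h0 : (S.card : ℝ) ≤ (S₁ ∪ (S₂ ∪ (S₃ ∪ (S₄ ∪ (S₅ ∪ S₆))))).card := by
    exact_mod_cast Finset.card_le_card fun x hx => by simpa using h x hx
  linarith [hor S₁ (S₂ ∪ (S₃ ∪ (S₄ ∪ (S₅ ∪ S₆)))), hor S₂ (S₃ ∪ (S₄ ∪ (S₅ ∪ S₆))),
    hor S₃ (S₄ ∪ (S₅ ∪ S₆)), hor S₄ (S₅ ∪ S₆), hor S₅ S₆]

open Classical in
/-- Quantitative form of the main theorem, with explicit parameters. -/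
theorem card_not_generate_le (A B : Equiv.Perm α) {L : ℕ} {κ δ ε q v s s' : ℝ}
    (hκ0 : 0 < κ) (hκ : κ ≤ 1 / 12) (hκδ : 2 * κ ≤ δ ^ 6) (hκM : 2 * κ * (24 ^ 16 : ℕ) < 1)
    (hL : 1000 ≤ L) (hnL : Nat.log 2 (Fintype.card α) < L)
    (hδ : 0 < δ) (hδ1 : 24 * Real.exp 6 * δ ≤ 1) (hs : 0 ≤ s) (hs' : 0 ≤ s') (hv : 0 < v)
    (hvn : v ^ 6 = Fintype.card α)
    (hA : ((Finset.univ.filter fun x => A x = x).card : ℝ) ≤ δ * v ^ 4)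
    (hB : ((Finset.univ.filter fun x => B x = x).card : ℝ) ≤ δ * v ^ 4)
    (hsA : ((Finset.univ.filter fun x => A (A x) = x ∧ A x ≠ x).card : ℝ) ≤ 2 * s ^ 2)
    (hsB : ((Finset.univ.filter fun x => B (B x) = x ∧ B x ≠ x).card : ℝ) ≤ 2 * s' ^ 2)
    (hsv : s ≤ v ^ 3) (hsv' : s' ≤ v ^ 3)
    (hAB : (((Finset.univ.filter fun x => A x = x).card : ℝ) + s) *
      (((Finset.univ.filter fun x => B x = x).card : ℝ) + s') ≤ δ * v ^ 6)
    (hN : 8 * (Fintype.card (Quotient (Equiv.Perm.SameCycle.setoid A)) +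
      Fintype.card (Quotient (Equiv.Perm.SameCycle.setoid B))) ≤ 7 * Fintype.card α)
    (hε0 : 0 ≤ ε) (hε : ε ≤ 1) (hq : 1 ≤ q)
    (hqA : ((Finset.univ.filter fun x => A x = x).card : ℝ) ≤ q)
    (hqB : ((Finset.univ.filter fun x => B x = x).card : ℝ) ≤ q)
    (hB2 : 30 * (Finset.univ.filter fun x => B (B x) = x).card ≤ Fintype.card α)
    (h : 2000 * ((L : ℝ) ^ 18 * q) ≤ ε * Fintype.card α) :
    ((Finset.univ.filter fun τ : Equiv.Perm α =>
      ¬ alternatingGroup α ≤ Subgroup.closure {A, τ * B * τ⁻¹}).card : ℝ) ≤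
      (24 * Real.exp 6 * δ + (Fintype.card α + 1) / 2 ^ Fintype.card α + 176 * ε + 4 * ε / κ) *
        (Fintype.card α).factorial := by
  have hnL' : Fintype.card α ≤ 2 ^ L := (Nat.lt_pow_of_log_lt one_lt_two hnL).le
  have hbig : 2 * L ^ 18 ≤ Fintype.card α := by
    have hL0 : (0 : ℝ) ≤ (L : ℝ) ^ 18 := by positivity
    have : (2 * L ^ 18 : ℝ) ≤ Fintype.card α := by
      nlinarith [mul_nonneg hL0 (sub_nonneg.2 hq), Nat.cast_nonneg (α := ℝ) (Fintype.card α)]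
    exact_mod_cast this
  have hL8 : 2 * (L ^ 4) ^ 2 ≤ Fintype.card α := by
    refine le_trans ?_ hbig
    rw [← pow_mul]
    exact Nat.mul_le_mul_left 2 (Nat.pow_le_pow_right (by omega) (by norm_num))
  have h40 : 40 ≤ Fintype.card α := by
    have : 1000 ≤ L ^ 18 := hL.trans (Nat.le_self_pow (by norm_num) L)
    omega
  have hL1 : 1000 ≤ L ^ 2 := hL.trans (Nat.le_self_pow (by norm_num) L)
  have hL2 : 1000 * 1000 ≤ L ^ 2 := by nlinarith
  have hL4 : L ^ 4 = L ^ 2 * L ^ 2 := by ring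
  obtain ⟨p, hp, hlp, hpl⟩ := Nat.exists_prime_lt_and_le_two_mul (80 * (4 * (2 + 1) * L) ^ 2)
    (by positivity)
  have hp4 : p + 1 ≤ L ^ 4 := by
    have : 80 * (4 * (2 + 1) * L) ^ 2 = 11520 * L ^ 2 := by ring
    rw [hL4]
    nlinarith
  obtain ⟨P, hP, hPc⟩ := exists_finset_primes_card_eq hL
  have hP4 : ∑ q ∈ P, q ≤ L ^ 4 := by
    calc ∑ q ∈ P, q ≤ ∑ _q ∈ P, L ^ 2 := Finset.sum_le_sum fun q hq => (hP q hq).2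
      _ = 5 * L * L ^ 2 := by rw [Finset.sum_const, hPc, smul_eq_mul]
      _ ≤ L * L * L ^ 2 := by gcongr; omega
      _ = L ^ 4 := by ring
  have hreg := fun (ι : Type) [Fintype ι] (r' : ℕ) (κ : ℝ) (hκ : 0 < κ)
      (hr : Fintype.card ι ≤ r') (hr' : r' ≤ L ^ 4) =>
    card_not_regular_le_of_log A B ι hκ hε0 hε hq (by omega) hnL' hr hr' rfl hqA hqB hB2 h
  have hb := card_perm_common_blocks_le A B hN
  have hb' : ((Finset.univ.filter fun τ : Equiv.Perm α => ∃ b m, 2 ≤ b ∧ 24 ^ 16 ≤ m ∧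
      b * m = Fintype.card α ∧ ∃ r : Setoid α, (∀ x, (Finset.univ.filter fun y => r x y).card = b) ∧
      (∀ x y, r x y → r (A x) (A y)) ∧
      ∀ x y, r x y → r ((τ * B * τ⁻¹) x) ((τ * B * τ⁻¹) y)).card : ℝ) ≤
      (Fintype.card α + 1) / 2 ^ Fintype.card α * (Fintype.card α).factorial := by
    rw [div_mul_eq_mul_div, le_div_iff₀ (by positivity)]
    exact_mod_cast hb
  have hE := card_perm_small_common_invariant_le A B hδ hδ1 hs hs' hv hvn hA hB hsA hsB hsv hsv' hAB
  have hmain := card_le_of_forall_mem_six (Finset.univ.filter fun τ : Equiv.Perm α =>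
      ¬ alternatingGroup α ≤ Subgroup.closure {A, τ * B * τ⁻¹}) _ _ _ _ _ _ (fun τ hτ => ?_) hE hb'
    (hreg Unit 2 (1 / 20) (by norm_num) (by simp) (by nlinarith))
    (hreg (Fin 2) 2 κ hκ0 (by simp) (by nlinarith))
    (hreg (Option (Fin p)) (p + 1) (1 / 12) (by norm_num) (by simp) hp4)
    (hreg (Σ q : P, Fin q) (∑ q ∈ P, q) (1 / 12) (by norm_num)
      (by rw [Fintype.card_sigma]; simp [Finset.sum_attach P fun q => q]) hP4)
  · refine hmain.trans (le_of_eq ?_)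
    ring
  · simp only [Finset.mem_filter, Finset.mem_univ, true_and] at hτ ⊢
    by_contra hcon
    simp only [not_or, not_not] at hcon
    obtain ⟨c1, c2, c3, c4, c5, c6⟩ := hcon
    refine hτ (alternatingGroup_le_closure_of_regular h40 hκ hκδ hκM c1 c2 c3 c4 hp hlp.le
      ((Nat.mul_le_mul_left 2 (Nat.pow_le_pow_left hp4 2)).trans hL8) c5 (fun q hq => (hP q hq).1)
      ((Nat.mul_le_mul_left 2 (Nat.pow_le_pow_left hP4 2)).trans hL8) ?_ c6)
    rw [hPc]
    omega

end AltWalk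

lemma eventually_log_pow_le {ε : ℝ} (hε : 0 < ε) :
    ∀ᶠ n : ℕ in atTop,
      2000 * (((Nat.log 2 n + 1 : ℕ) : ℝ) ^ 18 * (n : ℝ) ^ ((2 : ℝ) / 3)) ≤ ε * n := by
  have h1 := (isLittleO_log_rpow_rpow_atTop (s := 1 / 3) 18 (by norm_num)).bound
    (show 0 < ε / (2000 * 3 ^ 18) by positivity)
  have h2 := tendsto_natCast_atTop_atTop (R := ℝ) |>.eventually h1
  filter_upwards [h2, eventually_ge_atTop 3] with n hn hn3
  have hn3' : (3 : ℝ) ≤ n := by exact_mod_cast hn3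
  have hlog : 1 ≤ Real.log n := by
    rw [Real.le_log_iff_exp_le (by linarith)]
    linarith [Real.exp_one_lt_d9]
  have hL : ((Nat.log 2 n + 1 : ℕ) : ℝ) ≤ 3 * Real.log n := by
    have h3 : (Nat.log 2 n : ℝ) ≤ Real.logb 2 n := Real.natLog_le_logb n 2
    have h4 : Real.logb 2 n ≤ 2 * Real.log n := by
      rw [Real.logb, div_le_iff₀ (Real.log_pos (by norm_num))]
      nlinarith [Real.log_two_gt_d9]
    push_cast
    linarith
  have hL18 : ((Nat.log 2 n + 1 : ℕ) : ℝ) ^ 18 ≤ 3 ^ 18 * Real.log n ^ 18 := by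
    rw [← mul_pow]
    gcongr
  rw [Real.norm_of_nonneg (by positivity), Real.norm_of_nonneg (by positivity)] at hn
  have h18 : Real.log n ^ (18 : ℝ) = Real.log n ^ 18 := by
    rw [← Real.rpow_natCast]; norm_num
  rw [h18] at hn
  have hsplit : (n : ℝ) ^ ((1 : ℝ) / 3) * (n : ℝ) ^ ((2 : ℝ) / 3) = n := by
    rw [← Real.rpow_add (by linarith)]
    norm_num
  calc 2000 * (((Nat.log 2 n + 1 : ℕ) : ℝ) ^ 18 * (n : ℝ) ^ ((2 : ℝ) / 3))
      ≤ 2000 * (3 ^ 18 * (ε / (2000 * 3 ^ 18) * (n : ℝ) ^ ((1 : ℝ) / 3)) *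
        (n : ℝ) ^ ((2 : ℝ) / 3)) := by
        gcongr
        exact hL18.trans (by gcongr)
    _ = ε * ((n : ℝ) ^ ((1 : ℝ) / 3) * (n : ℝ) ^ ((2 : ℝ) / 3)) := by field_simp
    _ = ε * n := by rw [hsplit]

lemma eventually_add_one_div_two_pow_le {ε : ℝ} (hε : 0 < ε) :
    ∀ᶠ n : ℕ in atTop, ((n : ℝ) + 1) / 2 ^ n ≤ ε := by
  have h1 := tendsto_pow_const_div_const_pow_of_one_lt 1 (show (1 : ℝ) < 2 by norm_num)
  have h0 := tendsto_pow_const_div_const_pow_of_one_lt 0 (show (1 : ℝ) < 2 by norm_num)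
  have h := h1.add h0
  rw [add_zero] at h
  filter_upwards [h.eventually_le_const hε] with n hn
  rw [add_div]
  simpa using hn

open Classical in
lemma card_sameCycle_quotient_le {α : Type*} [Fintype α] [DecidableEq α] (A : Equiv.Perm α) :
    (Fintype.card (Quotient (Equiv.Perm.SameCycle.setoid A)) : ℝ) ≤ 1 / 3 * Fintype.card α +
      2 / 3 * (Finset.univ.filter fun x => A x = x).card +
      1 / 6 * (Finset.univ.filter fun x => A (A x) = x ∧ A x ≠ x).card := by
  have h := sum_cycles_le A (fun _ => (1 : ℝ)) (a := 1 / 3) (b₁ := 2 / 3) (b₂ := 1 / 6)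
    (by norm_num) (by norm_num) (by norm_num) (by norm_num) (fun k hk => by
      have : (3 : ℝ) ≤ k := by exact_mod_cast hk
      rw [div_le_iff₀ (by linarith)]
      linarith)
  simpa using h

set_option exponentiation.threshold 1000 in
open Classical in
lemma exists_card_not_generate_le {η : ℝ} (hη : 0 < η) (hη1 : η ≤ 1) : ∃ δ > 0, ∀ᶠ n : ℕ in atTop,
    ∀ A B : Equiv.Perm (Fin n),
      ((Finset.univ.filter fun x => A x = x).card : ℝ) ≤ δ * (n : ℝ) ^ ((2 : ℝ) / 3) →
      ((Finset.univ.filter fun x => B x = x).card : ℝ) ≤ δ * (n : ℝ) ^ ((2 : ℝ) / 3) →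
      (((Finset.univ.filter fun x => A x = x).card : ℝ) +
          √((Finset.univ.filter fun x => A (A x) = x ∧ A x ≠ x).card / 2)) *
        ((Finset.univ.filter fun x => B x = x).card +
          √((Finset.univ.filter fun x => B (B x) = x ∧ B x ≠ x).card / 2)) ≤ δ * n →
      ((Finset.univ.filter fun x => B (B x) = x ∧ B x ≠ x).card : ℝ) ≤ 2 * δ * n →
      ((Finset.univ.filter fun τ : Equiv.Perm (Fin n) =>
        ¬ alternatingGroup (Fin n) ≤ Subgroup.closure {A, τ * B * τ⁻¹}).card : ℝ) ≤
        η * n.factorial := by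
  have he : 1 ≤ Real.exp 6 := Real.one_le_exp (by norm_num)
  obtain ⟨δ, hδ⟩ : ∃ δ, δ = η / (100 * Real.exp 6) := ⟨_, rfl⟩
  have hδ0 : 0 < δ := by rw [hδ]; positivity
  have hδe : Real.exp 6 * δ = η / 100 := by rw [hδ]; field_simp
  have hδ1 : δ ≤ 1 / 100 := by nlinarith
  obtain ⟨M, hM1, hM⟩ : ∃ M : ℕ, (6 : ℝ) ≤ M ∧ ∀ x : ℝ, x * M < 1 → x * (24 ^ 16 : ℕ) < 1 :=
    ⟨24 ^ 16, by norm_num, fun _ h => h⟩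
  obtain ⟨κ, hκ⟩ : ∃ κ, κ = δ ^ 6 / (4 * M) := ⟨_, rfl⟩
  have hκ0 : 0 < κ := by rw [hκ]; positivity
  have hκM : κ * M = δ ^ 6 / 4 := by rw [hκ]; field_simp
  have hκ6 : κ * 6 ≤ δ ^ 6 / 4 := hκM ▸ mul_le_mul_of_nonneg_left hM1 hκ0.le
  have hκδ : 2 * κ ≤ δ ^ 6 := by linarith
  have hδ6 : δ ^ 6 ≤ 1 := pow_le_one₀ hδ0.le (by linarith)
  have hκ12 : κ ≤ 1 / 12 := by linarith
  refine ⟨δ, hδ0, ?_⟩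
  filter_upwards [eventually_log_pow_le (show 0 < η * κ / 1000 by positivity),
    eventually_add_one_div_two_pow_le (show 0 < η / 4 by positivity),
    eventually_ge_atTop (2 ^ 1000)] with n hlog hpow hn A B hA hB hAB hB2
  have hn1 : 1 ≤ n := Nat.one_le_two_pow.trans hn
  have hnr : (1 : ℝ) ≤ n := by exact_mod_cast hn1
  have : Nonempty (Fin n) := ⟨⟨0, hn1⟩⟩
  have hL : 1000 ≤ Nat.log 2 n + 1 := (Nat.le_log_of_pow_le one_lt_two hn).trans (Nat.le_succ _)
  clear hn
  obtain ⟨v, hv⟩ : ∃ v : ℝ, v = (n : ℝ) ^ ((1 : ℝ) / 6) := ⟨_, rfl⟩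
  have hv0 : 0 < v := by rw [hv]; positivity
  have hv6 : v ^ 6 = n := by
    rw [hv, ← Real.rpow_natCast, ← Real.rpow_mul (by linarith)]
    norm_num
  have hv4 : (n : ℝ) ^ ((2 : ℝ) / 3) = v ^ 4 := by
    rw [hv, ← Real.rpow_natCast, ← Real.rpow_mul (by linarith)]
    norm_num
  rw [hv4] at hlog hA hB
  have hv1 : 1 ≤ v := by
    rw [hv]
    exact Real.one_le_rpow hnr (by norm_num)
  have hv41 : 1 ≤ v ^ 4 := one_le_pow₀ hv1
  have hv46 : v ^ 4 ≤ n := hv6 ▸ pow_le_pow_right₀ hv1 (by norm_num)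
  have hcard : ∀ P : Fin n → Prop, ((Finset.univ.filter fun x => P x).card : ℝ) ≤ n := by
    intro P
    exact_mod_cast (Finset.card_filter_le _ _).trans (by simp)
  have hs : ∀ t : ℝ, 0 ≤ t → t ≤ n → √(t / 2) ≤ v ^ 3 := by
    intro t ht htn
    rw [← Real.sqrt_sq (show 0 ≤ v ^ 3 by positivity), ← pow_mul, hv6]
    exact Real.sqrt_le_sqrt (by linarith)
  have hsq : ∀ t : ℕ, (t : ℝ) ≤ 2 * √(t / 2) ^ 2 := by
    intro t
    rw [Real.sq_sqrt (by positivity)]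
    linarith
  have hA1 : ((Finset.univ.filter fun x => A x = x).card : ℝ) ≤ δ * n :=
    hA.trans (by gcongr)
  have hB1 : ((Finset.univ.filter fun x => B x = x).card : ℝ) ≤ δ * n :=
    hB.trans (by gcongr)
  have hδv : δ * v ^ 4 ≤ v ^ 4 := mul_le_of_le_one_left (by positivity) (by linarith)
  have hA2 : ((Finset.univ.filter fun x => A (A x) = x ∧ A x ≠ x).card : ℝ) ≤ n := by
    exact_mod_cast (Finset.card_filter_le _ _).trans (by simp)
  have hB2' : ((Finset.univ.filter fun x => B (B x) = x ∧ B x ≠ x).card : ℝ) ≤ n := by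
    exact_mod_cast (Finset.card_filter_le _ _).trans (by simp)
  have hBB : ((Finset.univ.filter fun x => B (B x) = x).card : ℝ) ≤
      (Finset.univ.filter fun x => B x = x).card +
      (Finset.univ.filter fun x => B (B x) = x ∧ B x ≠ x).card := by
    have : (Finset.univ.filter fun x => B (B x) = x) ⊆ (Finset.univ.filter fun x => B x = x) ∪
        (Finset.univ.filter fun x => B (B x) = x ∧ B x ≠ x) := by
      intro x hx
      simp only [Finset.mem_union, Finset.mem_filter, Finset.mem_univ, true_and] at hx ⊢
      tauto
    exact_mod_cast (Finset.card_le_card this).trans (Finset.card_union_le _ _)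
  have hδn : δ * n ≤ 1 / 100 * n := by gcongr
  have hηκ : η * κ ≤ κ := mul_le_of_le_one_left hκ0.le hη1
  have hmain := AltWalk.card_not_generate_le A B (L := Nat.log 2 n + 1) (κ := κ) (δ := δ)
    (ε := η * κ / 1000) (q := v ^ 4) (v := v)
    (s := √((Finset.univ.filter fun x => A (A x) = x ∧ A x ≠ x).card / 2))
    (s' := √((Finset.univ.filter fun x => B (B x) = x ∧ B x ≠ x).card / 2))
    hκ0 hκ12 hκδ (hM _ (by linarith)) hL (by simp) hδ0 (by linarith)
    (Real.sqrt_nonneg _) (Real.sqrt_nonneg _) hv0 (by simpa using hv6) hA hB (hsq _) (hsq _)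
    (hs _ (by positivity) hA2) (hs _ (by positivity) hB2') (by rw [hv6]; exact hAB)
    (by
      have h1 := card_sameCycle_quotient_le A
      have h2 := card_sameCycle_quotient_le B
      have h3 : (8 * (Fintype.card (Quotient (Equiv.Perm.SameCycle.setoid A)) +
          Fintype.card (Quotient (Equiv.Perm.SameCycle.setoid B))) : ℝ) ≤
          7 * Fintype.card (Fin n) := by
        rw [Fintype.card_fin] at h1 h2 ⊢
        linarith
      exact_mod_cast h3)
    (by positivity) (by linarith) hv41 (hA.trans hδv) (hB.trans hδv)
    (by
      rw [Fintype.card_fin]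
      have : (30 * (Finset.univ.filter fun x => B (B x) = x).card : ℝ) ≤ n := by linarith
      exact_mod_cast this)
    (by simpa using hlog)
  rw [Fintype.card_fin] at hmain
  refine hmain.trans ?_
  gcongr
  have h5 : 4 * (η * κ / 1000) / κ = η / 250 := by
    field_simp
    norm_num
  rw [h5]
  have h6 : η * κ ≤ η := mul_le_of_le_one_right hη.le (by linarith)
  linarith

lemma card_two_cycle_points_le {α : Type*} [Fintype α] [DecidableEq α] (A : Equiv.Perm α) :
    (Finset.univ.filter fun x => A (A x) = x ∧ A x ≠ x).card ≤ 2 * A.cycleType.count 2 := by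
  have hc : A.cycleType.count 2 =
      (A.cycleFactorsFinset.filter fun c => c.support.card = 2).card := by
    rw [Equiv.Perm.cycleType_def, Multiset.count_map, Finset.card_def, Finset.filter_val]
    congr 1
    exact Multiset.filter_congr fun c _ => eq_comm
  rw [hc]
  refine Finset.card_le_mul_card_image_of_maps_to (f := fun x => A.cycleOf x) ?_ 2 ?_
  · intro x hx
    obtain ⟨h2, h1⟩ := (Finset.mem_filter.1 hx).2
    have hcyc := Equiv.Perm.isCycle_cycleOf A h1
    refine Finset.mem_filter.2 ⟨Equiv.Perm.cycleOf_mem_cycleFactorsFinset_iff.2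
      (Equiv.Perm.mem_support.2 h1), ?_⟩
    have hpow : A.cycleOf x ^ 2 = 1 := by
      refine hcyc.pow_eq_one_iff.2 ⟨x, by simpa using h1, ?_⟩
      rw [Equiv.Perm.cycleOf_pow_apply_self]
      exact h2
    have hdvd := orderOf_dvd_of_pow_eq_one hpow
    rw [hcyc.orderOf] at hdvd
    exact le_antisymm (Nat.le_of_dvd two_pos hdvd) hcyc.two_le_card_support
  · intro c hc
    refine (Finset.card_le_card (t := c.support) fun x hx => ?_).trans
      (Finset.mem_filter.1 hc).2.le
    obtain ⟨hx', rfl⟩ := Finset.mem_filter.1 hx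
    have h1 := (Finset.mem_filter.1 hx').2.2
    rw [Equiv.Perm.mem_support, Equiv.Perm.cycleOf_apply_self]
    exact h1

lemma card_fixedPoints_eq {α : Type*} [Fintype α] [DecidableEq α] (A : Equiv.Perm α) :
    Nat.card (Function.fixedPoints A) = (Finset.univ.filter fun x => A x = x).card := by
  rw [Nat.card_eq_fintype_card, Fintype.card_subtype]
  rfl

section

variable {α : Type*} [Fintype α] [DecidableEq α]

lemma alternatingGroup_le_closure_conj_of_le {a b : Equiv.Perm α} (g : Equiv.Perm α)
    (h : alternatingGroup α ≤ Subgroup.closure {a, b}) :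
    alternatingGroup α ≤ Subgroup.closure {g * a * g⁻¹, g * b * g⁻¹} := by
  intro x hx
  have h1 : g⁻¹ * x * g ∈ Subgroup.closure {a, b} := by
    refine h ?_
    have hnorm : (alternatingGroup α).Normal := inferInstance
    simpa using hnorm.conj_mem x hx g⁻¹
  have h2 : x ∈ (Subgroup.closure {a, b}).map (MulAut.conj g).toMonoidHom :=
    ⟨g⁻¹ * x * g, h1, by simp [mul_assoc]⟩
  rw [MonoidHom.map_closure, Set.image_pair] at h2
  exact h2

lemma alternatingGroup_le_closure_conj_iff {a b : Equiv.Perm α} (g : Equiv.Perm α) :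
    alternatingGroup α ≤ Subgroup.closure {g * a * g⁻¹, g * b * g⁻¹} ↔
      alternatingGroup α ≤ Subgroup.closure {a, b} := by
  refine ⟨fun h => ?_, alternatingGroup_le_closure_conj_of_le g⟩
  simpa [mul_assoc] using alternatingGroup_le_closure_conj_of_le g⁻¹ h

open Classical in
lemma card_not_generate_comm (A B : Equiv.Perm α) :
    (Finset.univ.filter fun τ : Equiv.Perm α =>
      ¬ alternatingGroup α ≤ Subgroup.closure {A, τ * B * τ⁻¹}).card =
    (Finset.univ.filter fun τ : Equiv.Perm α =>
      ¬ alternatingGroup α ≤ Subgroup.closure {B, τ * A * τ⁻¹}).card := by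
  refine Finset.card_equiv (Equiv.inv _) fun τ => ?_
  simp only [Finset.mem_filter, Finset.mem_univ, true_and, Equiv.inv_apply]
  rw [← alternatingGroup_le_closure_conj_iff (a := B) τ, Set.pair_comm]
  simp [mul_assoc]

end

open Classical in
lemma sum_conj_mul_card {G : Type*} [Group G] [Fintype G] (a : G) [DecidablePred (IsConj a)]
    (f : G → ℝ) :
    (∑ g, f (g * a * g⁻¹)) * (Finset.univ.filter fun σ => IsConj a σ).card =
      Fintype.card G * ∑ σ ∈ Finset.univ.filter (fun σ => IsConj a σ), f σ := by
  set C := Finset.univ.filter fun σ => IsConj a σ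
  have hmaps : ∀ g ∈ (Finset.univ : Finset G), g * a * g⁻¹ ∈ C := fun g _ =>
    Finset.mem_filter.2 ⟨Finset.mem_univ _, isConj_iff.2 ⟨g, rfl⟩⟩
  have hk : ∀ σ ∈ C, (Finset.univ.filter fun g => g * a * g⁻¹ = σ).card =
      (Finset.univ.filter fun g => g * a * g⁻¹ = a).card := by
    intro σ hσ
    obtain ⟨c, rfl⟩ := isConj_iff.1 (Finset.mem_filter.1 hσ).2
    refine Finset.card_equiv (Equiv.mulLeft c⁻¹) fun g => ?_
    simp only [Finset.mem_filter, Finset.mem_univ, true_and, Equiv.coe_mulLeft, mul_inv_rev,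
      inv_inv]
    constructor
    · intro h
      calc c⁻¹ * g * a * (g⁻¹ * c) = c⁻¹ * (g * a * g⁻¹) * c := by group
        _ = a := by rw [h]; group
    · intro h
      calc g * a * g⁻¹ = c * (c⁻¹ * g * a * (g⁻¹ * c)) * c⁻¹ := by group
        _ = c * a * c⁻¹ := by rw [h]
  have hsum : ∀ f : G → ℝ, ∑ g, f (g * a * g⁻¹) =
      (Finset.univ.filter fun g => g * a * g⁻¹ = a).card * ∑ σ ∈ C, f σ := by
    intro f
    rw [← Finset.sum_fiberwise_of_maps_to hmaps, Finset.mul_sum]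
    refine Finset.sum_congr rfl fun σ hσ => ?_
    rw [← hk σ hσ, ← nsmul_eq_mul, ← Finset.sum_const]
    exact Finset.sum_congr rfl fun g hg => by rw [(Finset.mem_filter.1 hg).2]
  have hone := hsum fun _ => 1
  simp only [Finset.sum_const, Finset.card_univ, nsmul_eq_mul, mul_one] at hone
  rw [hsum f, hone]
  ring

open Classical in
lemma genProb_eq (n : ℕ) (π π' : Equiv.Perm (Fin n)) :
    genProb n π π' = 1 - (Finset.univ.filter fun τ : Equiv.Perm (Fin n) =>
      ¬ alternatingGroup (Fin n) ≤ Subgroup.closure {π, τ * π' * τ⁻¹}).card / n.factorial := by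
  set C := Finset.univ.filter fun σ => IsConj π σ with hC
  set C' := Finset.univ.filter fun σ => IsConj π' σ with hC'
  have hfac : (Fintype.card (Equiv.Perm (Fin n)) : ℝ) = n.factorial := by
    rw [Fintype.card_perm, Fintype.card_fin]
  have hfac0 : (0 : ℝ) < n.factorial := by exact_mod_cast n.factorial_pos
  let f : Equiv.Perm (Fin n) → Equiv.Perm (Fin n) → ℝ := fun σ ρ =>
    if alternatingGroup (Fin n) ≤ Subgroup.closure {σ, ρ} then 1 else 0
  have hnum : (Nat.card {p : Equiv.Perm (Fin n) × Equiv.Perm (Fin n) //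
      IsConj π p.1 ∧ IsConj π' p.2 ∧
      alternatingGroup (Fin n) ≤ Subgroup.closure {p.1, p.2}} : ℝ) =
      ∑ σ ∈ C, ∑ ρ ∈ C', f σ ρ := by
    rw [Nat.card_eq_fintype_card, Fintype.card_subtype, ← Finset.sum_product',
      Finset.sum_boole]
    congr 2
    ext p
    simp [hC, hC', and_assoc]
  have hcard : (Nat.card {σ : Equiv.Perm (Fin n) // IsConj π σ} : ℝ) = C.card := by
    rw [Nat.card_eq_fintype_card, Fintype.card_subtype]
  have hcard' : (Nat.card {σ : Equiv.Perm (Fin n) // IsConj π' σ} : ℝ) = C'.card := by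
    rw [Nat.card_eq_fintype_card, Fintype.card_subtype]
  have hpos : (0 : ℝ) < C.card := by
    exact_mod_cast Finset.card_pos.2 ⟨π, Finset.mem_filter.2 ⟨Finset.mem_univ _, IsConj.refl _⟩⟩
  have hpos' : (0 : ℝ) < C'.card := by
    exact_mod_cast Finset.card_pos.2 ⟨π', Finset.mem_filter.2 ⟨Finset.mem_univ _, IsConj.refl _⟩⟩
  set F := (Finset.univ.filter fun τ : Equiv.Perm (Fin n) =>
    ¬ alternatingGroup (Fin n) ≤ Subgroup.closure {π, τ * π' * τ⁻¹}).card with hF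
  have hF1 : ∑ τ, f π (τ * π' * τ⁻¹) = n.factorial - F := by
    have h := Finset.card_filter_add_card_filter_not (s := Finset.univ)
      (fun τ : Equiv.Perm (Fin n) =>
        alternatingGroup (Fin n) ≤ Subgroup.closure {π, τ * π' * τ⁻¹})
    rw [Finset.sum_boole, ← hfac, eq_sub_iff_add_eq]
    exact_mod_cast h
  have hF2 : ∀ g, ∑ τ, f (g * π * g⁻¹) (τ * π' * τ⁻¹) = n.factorial - F := by
    intro g
    rw [← hF1, ← Equiv.sum_comp (Equiv.mulLeft g)]
    refine Finset.sum_congr rfl fun τ _ => if_congr ?_ rfl rfl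
    rw [← alternatingGroup_le_closure_conj_iff (a := π) g]
    simp [mul_assoc]
  have h1 : (∑ g, ∑ ρ ∈ C', f (g * π * g⁻¹) ρ) * C.card =
      n.factorial * ∑ σ ∈ C, ∑ ρ ∈ C', f σ ρ := by
    rw [← hfac]
    exact sum_conj_mul_card π fun σ => ∑ ρ ∈ C', f σ ρ
  have h2 : ∀ g, (n.factorial - F : ℝ) * C'.card =
      n.factorial * ∑ ρ ∈ C', f (g * π * g⁻¹) ρ := by
    intro g
    rw [← hF2 g, ← hfac]
    exact sum_conj_mul_card π' (f (g * π * g⁻¹))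
  have h3 : ∑ g, ∑ ρ ∈ C', f (g * π * g⁻¹) ρ = (n.factorial - F) * C'.card := by
    refine mul_left_cancel₀ hfac0.ne' ?_
    rw [Finset.mul_sum, ← Finset.sum_congr rfl fun g _ => h2 g, Finset.sum_const,
      Finset.card_univ, nsmul_eq_mul, hfac]
  rw [genProb, hnum, hcard, hcard', div_eq_iff (mul_pos hpos hpos').ne']
  refine mul_left_cancel₀ hfac0.ne' ?_
  rw [← h1, h3, ← mul_assoc, mul_sub, mul_one, mul_div_cancel₀ _ hfac0.ne']
  ring

open Classical in
lemma exists_genProb_ge {η : ℝ} (hη : 0 < η) (hη1 : η ≤ 1) : ∃ δ > 0, ∀ᶠ n : ℕ in atTop,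
    ∀ π π' : Equiv.Perm (Fin n), (cycleCount π 1 : ℝ) ≤ δ * (n : ℝ) ^ ((2 : ℝ) / 3) →
      (cycleCount π' 1 : ℝ) ≤ δ * (n : ℝ) ^ ((2 : ℝ) / 3) →
      ((cycleCount π 1 : ℝ) + √(cycleCount π 2)) * ((cycleCount π' 1 : ℝ) + √(cycleCount π' 2)) ≤
        δ * n → 1 - η ≤ genProb n π π' := by
  obtain ⟨δ, hδ, h⟩ := exists_card_not_generate_le hη hη1
  refine ⟨δ, hδ, ?_⟩
  filter_upwards [h] with n hn π π' h1 h1' h12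
  have hone : ∀ σ : Equiv.Perm (Fin n),
      ((Finset.univ.filter fun x => σ x = x).card : ℝ) = cycleCount σ 1 := fun σ => by
    rw [cycleCount, if_pos rfl, card_fixedPoints_eq]
  have htwo : ∀ σ : Equiv.Perm (Fin n),
      ((Finset.univ.filter fun x => σ (σ x) = x ∧ σ x ≠ x).card : ℝ) ≤ 2 * cycleCount σ 2 := by
    intro σ
    rw [cycleCount, if_neg (by norm_num)]
    exact_mod_cast card_two_cycle_points_le σ
  have hF : ((Finset.univ.filter fun τ : Equiv.Perm (Fin n) =>
      ¬ alternatingGroup (Fin n) ≤ Subgroup.closure {π, τ * π' * τ⁻¹}).card : ℝ) ≤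
      η * n.factorial := by
    have hprod : ∀ σ ρ : Equiv.Perm (Fin n),
        ((cycleCount σ 1 : ℝ) + √(cycleCount σ 2)) * ((cycleCount ρ 1 : ℝ) + √(cycleCount ρ 2)) ≤
          δ * n → (((Finset.univ.filter fun x => σ x = x).card : ℝ) +
          √((Finset.univ.filter fun x => σ (σ x) = x ∧ σ x ≠ x).card / 2)) *
        ((Finset.univ.filter fun x => ρ x = x).card +
          √((Finset.univ.filter fun x => ρ (ρ x) = x ∧ ρ x ≠ x).card / 2)) ≤ δ * n := by
      intro σ ρ h
      refine le_trans ?_ h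
      rw [hone, hone]
      gcongr
      · linarith [htwo σ]
      · linarith [htwo ρ]
    by_cases hc : (cycleCount π' 2 : ℝ) ≤ δ * n
    · exact hn π π' (by rwa [hone]) (by rwa [hone]) (hprod _ _ h12) ((htwo π').trans (by linarith))
    · rw [card_not_generate_comm]
      refine hn π' π (by rwa [hone]) (by rwa [hone]) (hprod _ _ (by rwa [mul_comm]))
        ((htwo π).trans ?_)
      push Not at hc
      by_contra hc'
      have hc2 : δ * n < cycleCount π 2 := by linarith
      have h3 : √(cycleCount π 2) * √(cycleCount π' 2) ≤ δ * n := by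
        refine le_trans ?_ h12
        gcongr <;> simp
      rw [← Real.sqrt_mul (by positivity), Real.sqrt_le_left (by positivity)] at h3
      nlinarith [mul_nonneg hδ.le (Nat.cast_nonneg (α := ℝ) n)]
  rw [genProb_eq]
  have hfac0 : (0 : ℝ) < n.factorial := by exact_mod_cast n.factorial_pos
  have := (div_le_iff₀ hfac0).2 hF
  linarith

/-- If `c₁(n), c'₁(n) = o(n^{2/3})` and `(c₁ + c₂^{1/2})(c'₁ + c'₂^{1/2}) = o(n)`, then two
independent uniformly random elements of the classes of `π n` and `π' n` generate a subgroup
containing `A_n` with probability tending to `1`. -/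
theorem random_generation_almost_sure
    (π π' : (n : ℕ) → Equiv.Perm (Fin n))
    (h1 : (fun n => (cycleCount (π n) 1 : ℝ)) =o[atTop] fun n => (n : ℝ) ^ ((2 : ℝ) / 3))
    (h1' : (fun n => (cycleCount (π' n) 1 : ℝ)) =o[atTop] fun n => (n : ℝ) ^ ((2 : ℝ) / 3))
    (h2 : (fun n => ((cycleCount (π n) 1 : ℝ) + Real.sqrt (cycleCount (π n) 2)) *
        ((cycleCount (π' n) 1 : ℝ) + Real.sqrt (cycleCount (π' n) 2))) =o[atTop]
        fun n => (n : ℝ)) :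
    Tendsto (fun n => genProb n (π n) (π' n)) atTop (nhds 1) := by
  have hle : ∀ n, genProb n (π n) (π' n) ≤ 1 := fun n => by
    rw [genProb_eq]
    have : (0 : ℝ) < n.factorial := by exact_mod_cast n.factorial_pos
    exact sub_le_self _ (by positivity)
  rw [Metric.tendsto_nhds]
  intro ε hε
  obtain ⟨δ, hδ, h⟩ := exists_genProb_ge (lt_min (half_pos hε) one_pos) (min_le_right (ε / 2) 1)
  filter_upwards [h, h1.bound hδ, h1'.bound hδ, h2.bound hδ] with n hn b1 b1' b2
  rw [Real.norm_of_nonneg (by positivity), Real.norm_of_nonneg (by positivity)] at b1 b1' b2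
  have := hn _ _ b1 b1' b2
  rw [Real.dist_eq, abs_lt]
  constructor <;> linarith [hle n, min_le_left (ε / 2) 1]
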